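/- Consider the planar task-space Cosserat-rod system on [0,ℓ]×[0,∞): p_tt = (R(θ)K₃R(θ)ᵀp_s − R(θ)K₃q̄)_s + g e₃ and θ_tt = K₄θ_ss − (1/(ρJ))(m_c)_s + p̂_sᵀ·(R(θ)K₅(R(θ)ᵀp_s − q̄)) (with p̂_s = (−(p₃)_s, (p₂)_s) rotated by 90°, i.e. p̂ = (−p₃, p₂)), with boundary conditions p(0,t)=0, θ(0,t)=0, (R(θ)ᵀp_s)(ℓ,t)=q̄(ℓ), and m_c(ℓ,t)=K₂θ_s(ℓ,t), where ℓ,ρ,J,K₄,K₅ > 0, K₂ = ρJK₄, K₃ is a positive-definite diagonal 2×2 matrix, g ∈ ℝ, and q̄ : [0,ℓ] → ℝ² is C¹. Let p* : [0,ℓ]×[0,∞) → ℝ² be a C³ desired trajectory with p*(0,t)=0, p*_s(ℓ,t)=p_s(ℓ,t), and with p*_s, p*_ss uniformly bounded; set p̃ = p − p*. Suppose θ* : [0,ℓ]×[0,∞) → ℝ (with θ*_s uniformly bounded, θ*(0,t)=0, θ*_s(ℓ,t)=θ_s(ℓ,t)) and a continuous symmetric matrix field K_v(s,t) with κI ⪯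 K_v(s,t) ⪯ ΚI for some 0 < κ ≤ Κ satisfy the outer-loop matching equation (R(θ*)K₃R(θ*)ᵀp_s − R(θ*)K₃q̄)_s + g e₃ − p*_tt = (K_q p̃_s)_s − K_v p̃_t − K_p p̃, where K_q ∈ C¹([0,ℓ]) and K_p ∈ C⁰([0,ℓ]) are symmetric positive-definite matrix fields. Set θ̃ = θ − θ*, and suppose the input m_c satisfies the inner-loop matching equation K₄θ_ss − (1/(ρJ))(m_c)_s + p̂_sᵀ·(R(θ)K₅(R(θ)ᵀp_s − q̄)) − θ*_tt = (k_uθ̃_s)_s − k_wθ̃_t − k_θθ̃, where k_u ∈ C¹([0,ℓ]) and k_w, k_θ ∈ C⁰([0,ℓ]) are strictly positive. Assume p, θ, θ* are C³ classical solutions and that the smallest eigenvalue of K_q(s) exceeds the largest eigenvalue of K₃ for every s (so that K_q + R(θ)K₃R(θ)ᵀ − R(θ*)K₃R(θ*)ᵀ is positive definite). Then there exist C > 0 and λ > 0 such that for all t ≥ 0: ‖θ̃(·,t)‖_{L∞} + ‖θ̃_t(·,t)‖_{L∞} + ‖θ̃_s(·,t)‖_{L²} + ‖p̃(·,t)‖_{L²}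 + ‖p̃_t(·,t)‖_{L²} + ‖p̃_s(·,t)‖_{L²} ≤ C e^{−λt}. -/

import Mathlib

open Matrix

/-- The planar rotation matrix of angle `θ`. -/
noncomputable def Rot (θ : ℝ) : Matrix (Fin 2) (Fin 2) ℝ :=
  !![Real.cos θ, -Real.sin θ; Real.sin θ, Real.cos θ]

/-- Rotation of a planar vector by 90°: `(p₂, p₃) ↦ (−p₃, p₂)`, i.e. `p ↦ p̂`. -/
def rot90 (v : Fin 2 → ℝ) : Fin 2 → ℝ := ![-(v 1), v 0]

/-- The `L²` norm of a scalar function on `[0, ℓ]`. -/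
noncomputable def L2norm (ℓ : ℝ) (f : ℝ → ℝ) : ℝ :=
  Real.sqrt (∫ s in (0:ℝ)..ℓ, (f s) ^ 2)

/-- The `L²` norm of an `ℝ²`-valued function on `[0, ℓ]`. -/
noncomputable def L2vnorm (ℓ : ℝ) (f : ℝ → Fin 2 → ℝ) : ℝ :=
  Real.sqrt (∫ s in (0:ℝ)..ℓ, ((f s 0) ^ 2 + (f s 1) ^ 2))

/-- The `L∞` norm (sup of `|f|`) on `[0, ℓ]`. -/
noncomputable def LinfNorm (ℓ : ℝ) (f : ℝ → ℝ) : ℝ :=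
  sSup ((fun s => |f s|) '' Set.Icc 0 ℓ)

section ClosedLoopDecay

open Set Filter Topology MeasureTheory intervalIntegral
open scoped RealInnerProductSpace

section Calculus

variable {E : Type*} [NormedAddCommGroup E] [NormedSpace ℝ E]

theorem hasDerivAt_integral_of_continuous {f f' : ℝ × ℝ → E} (hf : Continuous f)
    (hf' : Continuous f') {a b t r : ℝ} (hab : a ≤ b) (hr : 0 < r)
    (h : ∀ s ∈ Icc a b, ∀ τ, |τ - t| < r → HasDerivAt (fun x => f (s, x)) (f' (s, τ)) τ) :
    HasDerivAt (fun x => ∫ s in a..b, f (s, x)) (∫ s in a..b, f' (s, t)) t := by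
  have hK : IsCompact (Icc a b ×ˢ Icc (t - r) (t + r)) :=
    isCompact_Icc.prod isCompact_Icc
  obtain ⟨M, hM⟩ := hK.exists_bound_of_continuousOn hf'.continuousOn
  have hs : Metric.ball t r ∈ 𝓝 t := Metric.ball_mem_nhds t hr
  refine (intervalIntegral.hasDerivAt_integral_of_dominated_loc_of_deriv_le
    (F := fun x s => f (s, x))
    (F' := fun x s => f' (s, x)) (bound := fun _ => M) hs ?_ ?_ ?_ ?_ ?_ ?_).2
  · exact Eventually.of_forall fun x =>
      (by fun_prop : Continuous fun s => f (s, x)).aestronglyMeasurable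
  · exact (by fun_prop : Continuous fun s => f (s, t)).intervalIntegrable _ _
  · exact (by fun_prop : Continuous fun s => f' (s, t)).aestronglyMeasurable
  · refine Eventually.of_forall fun s hs x hx => hM (s, x) ?_
    rw [uIoc_of_le hab] at hs
    rw [Metric.mem_ball, Real.dist_eq, abs_lt] at hx
    exact ⟨⟨hs.1.le, hs.2⟩, ⟨by linarith, by linarith⟩⟩
  · exact intervalIntegrable_const
  · refine Eventually.of_forall fun s hs x hx => ?_
    rw [uIoc_of_le hab] at hs
    exact h s ⟨hs.1.le, hs.2⟩ x hx

theorem continuous_integral_right {f : ℝ × ℝ → E} (hf : Continuous f) (a b : ℝ) :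
    Continuous fun t => ∫ s in a..b, f (s, t) := by
  refine continuous_parametric_intervalIntegral_of_continuous' (f := fun t s => f (s, t)) ?_ a b
  exact (by fun_prop : Continuous fun z : ℝ × ℝ => f (z.2, z.1))

theorem hasDerivAt_diag {a a1 a2 : ℝ × ℝ → ℝ} (h1c : Continuous a1) (h2c : Continuous a2) {c : ℝ}
    (h1 : ∀ x y, c < x → c < y → HasDerivAt (fun x => a (x, y)) (a1 (x, y)) x)
    (h2 : ∀ x y, c < x → c < y → HasDerivAt (fun y => a (x, y)) (a2 (x, y)) y)
    {h t : ℝ} (ht : c < t) (hth : c < t + h) :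
    HasDerivAt (fun t => a (t, t + h)) (a1 (t, t + h) + a2 (t, t + h)) t := by
  have hev : ∀ᶠ v : ℝ × ℝ in 𝓝 (t, t + h), c < v.1 ∧ c < v.2 :=
    (IsOpen.mem_nhds ((isOpen_lt continuous_const continuous_fst).inter
      (isOpen_lt continuous_const continuous_snd)) ⟨ht, hth⟩)
  have key := hasStrictFDerivAt_uncurry_coprod (𝕜 := ℝ) (f := fun x y => a (x, y))
    (u := (t, t + h))
    (f₁ := fun x y => ContinuousLinearMap.toSpanSingleton ℝ (a1 (x, y)))
    (f₂ := fun x y => ContinuousLinearMap.toSpanSingleton ℝ (a2 (x, y)))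
    (hev.mono fun v hv => (h1 v.1 v.2 hv.1 hv.2).hasFDerivAt)
    (hev.mono fun v hv => (h2 v.1 v.2 hv.1 hv.2).hasFDerivAt)
    (by
      have : Continuous fun v : ℝ × ℝ => ContinuousLinearMap.toSpanSingleton ℝ (a1 (v.1, v.2)) :=
        (ContinuousLinearMap.toSpanSingletonCLE (𝕜 := ℝ) (E := ℝ)).continuous.comp h1c
      exact this.continuousAt)
    (by
      have : Continuous fun v : ℝ × ℝ => ContinuousLinearMap.toSpanSingleton ℝ (a2 (v.1, v.2)) :=
        (ContinuousLinearMap.toSpanSingletonCLE (𝕜 := ℝ) (E := ℝ)).continuous.comp h2c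
      exact this.continuousAt)
  have hd : HasDerivAt (fun t : ℝ => (t, t + h)) ((1 : ℝ), (1 : ℝ)) t :=
    (hasDerivAt_id t).prodMk ((hasDerivAt_id t).add_const h)
  have := key.hasFDerivAt.comp_hasDerivAt t hd
  simpa [Function.HasUncurry.uncurry, Function.comp_def] using this

theorem hasDerivAt_mul_self_zero {k : ℝ → ℝ} (hk : ContinuousAt k 0) :
    HasDerivAt (fun h => h * k h) (k 0) 0 := by
  rw [hasDerivAt_iff_tendsto_slope]
  refine (hk.tendsto.mono_left nhdsWithin_le_nhds).congr' ?_
  filter_upwards [self_mem_nhdsWithin] with h hh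
  have : h ≠ 0 := hh
  simp [slope_def_field]
  field_simp

/-- Along the diagonal, `∂₁a - ∂₂a` has derivative `∂₁₁a - ∂₂₂a`; no mixed derivative is needed. -/
theorem integral_diag_second_sub {a a1 a2 a11 a22 : ℝ × ℝ → ℝ}
    (h1c : Continuous a1) (h2c : Continuous a2) (h11c : Continuous a11) (h22c : Continuous a22)
    {c : ℝ}
    (h1 : ∀ x y, c < x → c < y → HasDerivAt (fun x => a (x, y)) (a1 (x, y)) x)
    (h2 : ∀ x y, c < x → c < y → HasDerivAt (fun y => a (x, y)) (a2 (x, y)) y)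
    (h11 : ∀ x y, c < x → c < y → HasDerivAt (fun x => a1 (x, y)) (a11 (x, y)) x)
    (h22 : ∀ x y, c < x → c < y → HasDerivAt (fun y => a2 (x, y)) (a22 (x, y)) y)
    {p q : ℝ} (hp : c < p) (hpq : p ≤ q) :
    ∫ t in p..q, (a11 (t, t) - a22 (t, t))
      = (a1 (q, q) - a2 (q, q)) - (a1 (p, p) - a2 (p, p)) := by
  have hsmall : ∀ᶠ h : ℝ in 𝓝 0, |h| < p - c :=
    (continuous_abs.tendsto' (0:ℝ) 0 abs_zero).eventually_lt_const (by linarith)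
  have hA : HasDerivAt (fun h => ∫ t in p..q, a2 (t, t + h)) (∫ t in p..q, a22 (t, t + 0)) 0 := by
    refine hasDerivAt_integral_of_continuous (f := fun z => a2 (z.1, z.1 + z.2))
      (f' := fun z => a22 (z.1, z.1 + z.2)) (by fun_prop) (by fun_prop) hpq
      (r := p - c) (by linarith) ?_
    intro s hs τ hτ
    rw [sub_zero, abs_lt] at hτ
    exact HasDerivAt.comp_const_add s τ (h22 s (s + τ) (by linarith [hs.1]) (by linarith [hs.1]))
  have hB : HasDerivAt (fun h => ∫ t in p..q, a1 (t - h, t)) (∫ t in p..q, -a11 (t - 0, t)) 0 := by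
    refine hasDerivAt_integral_of_continuous (f := fun z => a1 (z.1 - z.2, z.1))
      (f' := fun z => -a11 (z.1 - z.2, z.1)) (by fun_prop) (by fun_prop) hpq
      (r := p - c) (by linarith) ?_
    intro s hs τ hτ
    rw [sub_zero, abs_lt] at hτ
    exact HasDerivAt.comp_const_sub s τ (h11 (s - τ) s (by linarith [hs.1]) (by linarith [hs.1]))
  have hJ : ∀ y : ℝ, HasDerivAt (fun h => h * ∫ r in (0:ℝ)..1, a1 (y + h * (r - 1), y + h * r))
      (a1 (y, y)) 0 := by
    intro y
    have hk : Continuous fun h => ∫ r in (0:ℝ)..1, a1 (y + h * (r - 1), y + h * r) :=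
      continuous_integral_right (f := fun z => a1 (y + z.2 * (z.1 - 1), y + z.2 * z.1))
        (by fun_prop) 0 1
    have := hasDerivAt_mul_self_zero hk.continuousAt
    simpa using this
  have hJ' : ∀ y h : ℝ, h * ∫ r in (0:ℝ)..1, a1 (y + h * (r - 1), y + h * r)
      = ∫ t in y..(y + h), a1 (t - h, t) := by
    intro y h
    have := intervalIntegral.mul_integral_comp_add_mul (a := 0) (b := 1)
      (f := fun t => a1 (t - h, t)) h y
    simp only [mul_zero, add_zero, mul_one] at this
    rw [← this]
    congr 2
    ext r
    congr 2
    ring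
  -- fundamental theorem of calculus along the shifted diagonal
  have hF : ∀ᶠ h : ℝ in 𝓝 0, ∫ t in p..q, a2 (t, t + h)
      = a (q, q + h) - a (p, p + h) - ((∫ t in p..q, a1 (t - h, t))
        + (h * ∫ r in (0:ℝ)..1, a1 (q + h * (r - 1), q + h * r))
        - (h * ∫ r in (0:ℝ)..1, a1 (p + h * (r - 1), p + h * r))) := by
    filter_upwards [hsmall] with h hh
    rw [abs_lt] at hh
    have hi1 : ∀ x y, IntervalIntegrable (fun t => a1 (t, t + h)) volume x y := fun x y =>
      (by fun_prop : Continuous fun t => a1 (t, t + h)).intervalIntegrable _ _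
    have hi2 : IntervalIntegrable (fun t => a2 (t, t + h)) volume p q :=
      (by fun_prop : Continuous fun t => a2 (t, t + h)).intervalIntegrable _ _
    have hi3 : ∀ x y, IntervalIntegrable (fun t => a1 (t - h, t)) volume x y := fun x y =>
      (by fun_prop : Continuous fun t => a1 (t - h, t)).intervalIntegrable _ _
    have hftc : ∫ t in p..q, (a1 (t, t + h) + a2 (t, t + h)) = a (q, q + h) - a (p, p + h) := by
      refine integral_eq_sub_of_hasDerivAt (f := fun t => a (t, t + h)) (fun t ht => ?_)
        ((hi1 p q).add hi2)
      rw [uIcc_of_le hpq] at ht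
      exact hasDerivAt_diag h1c h2c h1 h2 (by linarith [ht.1]) (by linarith [ht.1])
    rw [integral_add (hi1 p q) hi2] at hftc
    have hshift : ∫ t in p..q, a1 (t, t + h) = ∫ t in (p + h)..(q + h), a1 (t - h, t) := by
      rw [← integral_comp_add_right (fun t => a1 (t - h, t)) h]
      simp
    rw [hJ', hJ']
    have e1 := integral_add_adjacent_intervals (hi3 p q) (hi3 q (q + h))
    have e2 := integral_add_adjacent_intervals (hi3 p (p + h)) (hi3 (p + h) (q + h))
    linarith
  have hq := (h2 q (q + 0) (by linarith) (by linarith)).comp_const_add q 0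
  have hp' := (h2 p (p + 0) (by linarith) (by linarith)).comp_const_add p 0
  have hR := (hq.sub hp').sub ((hB.add (hJ q)).sub (hJ p))
  have huniq := hA.unique (hR.congr_of_eventuallyEq hF)
  simp only [add_zero, sub_zero] at huniq
  rw [intervalIntegral.integral_neg] at huniq
  have i1 : IntervalIntegrable (fun t => a11 (t, t)) volume p q :=
    (by fun_prop : Continuous fun t => a11 (t, t)).intervalIntegrable _ _
  have i2 : IntervalIntegrable (fun t => a22 (t, t)) volume p q :=
    (by fun_prop : Continuous fun t => a22 (t, t)).intervalIntegrable _ _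
  rw [intervalIntegral.integral_sub i1 i2]
  linarith

end Calculus

section Interval

variable {H : Type*} [NormedAddCommGroup H] [InnerProductSpace ℝ H]

theorem integral_inner_deriv_right {f g f' g' : ℝ → H} {a b : ℝ} (hab : a ≤ b)
    (hf : Continuous f) (hg : Continuous g) (hf' : Continuous f') (hg' : Continuous g')
    (hdf : ∀ s ∈ Ioo a b, HasDerivAt f (f' s) s) (hdg : ∀ s ∈ Ioo a b, HasDerivAt g (g' s) s) :
    ∫ s in a..b, ⟪f s, g' s⟫ = ⟪f b, g b⟫ - ⟪f a, g a⟫ - ∫ s in a..b, ⟪f' s, g s⟫ := by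
  have i1 : IntervalIntegrable (fun s => ⟪f s, g' s⟫) volume a b :=
    (by fun_prop : Continuous fun s => ⟪f s, g' s⟫).intervalIntegrable _ _
  have i2 : IntervalIntegrable (fun s => ⟪f' s, g s⟫) volume a b :=
    (by fun_prop : Continuous fun s => ⟪f' s, g s⟫).intervalIntegrable _ _
  have := integral_eq_sub_of_hasDerivAt_of_le (f := fun s => ⟪f s, g s⟫)
    (f' := fun s => ⟪f s, g' s⟫ + ⟪f' s, g s⟫) hab (by fun_prop)
    (fun s hs => (hdf s hs).inner ℝ (hdg s hs)) (i1.add i2)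
  rw [intervalIntegral.integral_add i1 i2] at this
  linarith

theorem sq_integral_le {g : ℝ → ℝ} {a b : ℝ} (hab : a ≤ b) (hg : Continuous g) :
    (∫ s in a..b, g s) ^ 2 ≤ (b - a) * ∫ s in a..b, g s ^ 2 := by
  rcases hab.eq_or_lt with rfl | hlt
  · simp
  have hba : 0 < b - a := sub_pos.2 hlt
  set m := (∫ s in a..b, g s) / (b - a) with hm
  have h0 : 0 ≤ ∫ s in a..b, (g s - m) ^ 2 :=
    integral_nonneg hab fun s _ => sq_nonneg _
  have h1 : ∫ s in a..b, (g s - m) ^ 2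
      = (∫ s in a..b, g s ^ 2) - 2 * m * (∫ s in a..b, g s) + m ^ 2 * (b - a) := by
    have e : ∀ s, (g s - m) ^ 2 = g s ^ 2 - 2 * m * g s + m ^ 2 := fun s => by ring
    simp only [e]
    rw [intervalIntegral.integral_add, intervalIntegral.integral_sub,
      intervalIntegral.integral_const_mul, intervalIntegral.integral_const]
    · simp [mul_comm]
    all_goals exact Continuous.intervalIntegrable (by fun_prop) _ _
  have hmi : ∫ s in a..b, g s = m * (b - a) := by rw [hm]; field_simp
  rw [h1, hmi] at h0
  rw [hmi]
  nlinarith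

theorem norm_sq_sub_le {f f' : ℝ → H} [CompleteSpace H] {a b s : ℝ} (hs : s ∈ Icc a b)
    (hf : Continuous f) (hf' : Continuous f')
    (hdf : ∀ s ∈ Ioo a b, HasDerivAt f (f' s) s) :
    ‖f s - f a‖ ^ 2 ≤ (s - a) * ∫ x in a..b, ‖f' x‖ ^ 2 := by
  have h1 : f s - f a = ∫ x in a..s, f' x :=
    (integral_eq_sub_of_hasDerivAt_of_le hs.1 hf.continuousOn
      (fun x hx => hdf x ⟨hx.1, hx.2.trans_le hs.2⟩) (hf'.intervalIntegrable _ _)).symm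
  have h2 : ‖f s - f a‖ ≤ ∫ x in a..s, ‖f' x‖ := by
    rw [h1]; exact norm_integral_le_integral_norm hs.1
  have h3 := sq_integral_le (g := fun x => ‖f' x‖) hs.1 (by fun_prop)
  have h4 : ∫ x in a..s, ‖f' x‖ ^ 2 ≤ ∫ x in a..b, ‖f' x‖ ^ 2 := by
    have hi : ∀ x y, IntervalIntegrable (fun x => ‖f' x‖ ^ 2) volume x y := fun x y =>
      (by fun_prop : Continuous fun x => ‖f' x‖ ^ 2).intervalIntegrable _ _
    rw [← integral_add_adjacent_intervals (hi a s) (hi s b)]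
    have : 0 ≤ ∫ x in s..b, ‖f' x‖ ^ 2 := integral_nonneg hs.2 fun x _ => sq_nonneg _
    linarith
  calc ‖f s - f a‖ ^ 2 ≤ (∫ x in a..s, ‖f' x‖) ^ 2 := by gcongr
    _ ≤ _ := h3
    _ ≤ _ := by gcongr; linarith [hs.1]

theorem integral_mono_continuous {f g : ℝ → ℝ} {a b : ℝ} (hab : a ≤ b) (hf : Continuous f)
    (hg : Continuous g) (h : ∀ s ∈ Icc a b, f s ≤ g s) :
    ∫ s in a..b, f s ≤ ∫ s in a..b, g s :=
  integral_mono_on hab (hf.intervalIntegrable _ _) (hg.intervalIntegrable _ _) h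

theorem poincare {f f' : ℝ → H} [CompleteSpace H] {l : ℝ} (hl : 0 ≤ l)
    (hf : Continuous f) (hf' : Continuous f') (h0 : f 0 = 0)
    (hdf : ∀ s ∈ Ioo 0 l, HasDerivAt f (f' s) s) :
    ∫ s in (0:ℝ)..l, ‖f s‖ ^ 2 ≤ l ^ 2 * ∫ s in (0:ℝ)..l, ‖f' s‖ ^ 2 := by
  have hI : 0 ≤ ∫ s in (0:ℝ)..l, ‖f' s‖ ^ 2 := integral_nonneg hl fun x _ => sq_nonneg _
  have : ∀ s ∈ Icc 0 l, ‖f s‖ ^ 2 ≤ l * ∫ s in (0:ℝ)..l, ‖f' s‖ ^ 2 := fun s hs => by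
    have := norm_sq_sub_le hs hf hf' hdf
    rw [h0, sub_zero, sub_zero] at this
    exact this.trans (by gcongr; exact hs.2)
  calc _ ≤ ∫ s in (0:ℝ)..l, (l * ∫ s in (0:ℝ)..l, ‖f' s‖ ^ 2) :=
        integral_mono_continuous hl (by fun_prop) continuous_const this
    _ = _ := by rw [intervalIntegral.integral_const]; simp; ring

end Interval

section Wave

variable {H : Type*} [NormedAddCommGroup H] [InnerProductSpace ℝ H]

/-- Kinematics of a field `w (s, t)` on `[0, l] × (0, ∞)` which is clamped at `s = 0` and free at
`s = l`, with flux divergence `A = (K w_s)_s`. -/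
structure WaveField (l : ℝ) (K : ℝ → H →L[ℝ] H) (w ws wt wtt A : ℝ × ℝ → H) : Prop where
  cw : Continuous w
  cws : Continuous ws
  cwt : Continuous wt
  cwtt : Continuous wtt
  cA : Continuous A
  dt : ∀ s ∈ Icc 0 l, ∀ t, 0 < t → HasDerivAt (fun x => w (s, x)) (wt (s, t)) t
  dtt : ∀ s ∈ Icc 0 l, ∀ t, 0 < t → HasDerivAt (fun x => wt (s, x)) (wtt (s, t)) t
  ds : ∀ t, 0 < t → ∀ s ∈ Ioo 0 l, HasDerivAt (fun x => w (x, t)) (ws (s, t)) s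
  dA : ∀ t, 0 < t → ∀ s ∈ Ioo 0 l, HasDerivAt (fun x => K x (ws (x, t))) (A (s, t)) s
  left : ∀ t, 0 < t → w (0, t) = 0
  right : ∀ t, 0 < t → ws (l, t) = 0

/-- Coercive stiffness, restoring and damping coefficients on `[0, l] × (0, ∞)`. -/
structure WaveCoeff (l : ℝ) (K Kp : ℝ → H →L[ℝ] H) (Kv : ℝ × ℝ → H →L[ℝ] H)
    (k0 k1 k2 d0 d1 : ℝ) : Prop where
  l_pos : 0 < l
  k0_pos : 0 < k0
  d0_pos : 0 < d0
  cK : Continuous K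
  cKp : Continuous Kp
  cKv : Continuous Kv
  symmK : ∀ s ∈ Icc 0 l, ∀ x y, ⟪K s x, y⟫ = ⟪x, K s y⟫
  symmKp : ∀ s ∈ Icc 0 l, ∀ x y, ⟪Kp s x, y⟫ = ⟪x, Kp s y⟫
  lowK : ∀ s ∈ Icc 0 l, ∀ x, k0 * ‖x‖ ^ 2 ≤ ⟪K s x, x⟫
  lowKp : ∀ s ∈ Icc 0 l, ∀ x, 0 ≤ ⟪Kp s x, x⟫
  lowKv : ∀ s ∈ Icc 0 l, ∀ t, 0 < t → ∀ x, d0 * ‖x‖ ^ 2 ≤ ⟪Kv (s, t) x, x⟫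
  upK : ∀ s ∈ Icc 0 l, ∀ x, ‖K s x‖ ≤ k1 * ‖x‖
  upKp : ∀ s ∈ Icc 0 l, ∀ x, ‖Kp s x‖ ≤ k2 * ‖x‖
  upKv : ∀ s ∈ Icc 0 l, ∀ t, 0 < t → ∀ x, ‖Kv (s, t) x‖ ≤ d1 * ‖x‖

namespace WaveField

variable {l : ℝ} {K Kp : ℝ → H →L[ℝ] H} {Kv : ℝ × ℝ → H →L[ℝ] H} {k0 k1 k2 d0 d1 : ℝ}
  {w ws wt wtt A F : ℝ × ℝ → H}

theorem integral_inner_flux (h : WaveField l K w ws wt wtt A) (hl : 0 ≤ l) (cK : Continuous K)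
    {x y : ℝ} (hx : 0 < x) (hy : 0 < y) :
    ∫ s in (0:ℝ)..l, ⟪w (s, x), A (s, y)⟫ = -∫ s in (0:ℝ)..l, ⟪ws (s, x), K s (ws (s, y))⟫ := by
  have := h.cw; have := h.cws; have := h.cA
  rw [integral_inner_deriv_right (f := fun s => w (s, x)) (g := fun s => K s (ws (s, y)))
    (f' := fun s => ws (s, x)) (g' := fun s => A (s, y)) hl (by fun_prop) (by fun_prop)
    (by fun_prop) (by fun_prop) (h.ds x hx) (h.dA y hy)]
  simp [h.left x hx, h.right y hy]

theorem hasDerivAt_cross (h : WaveField l K w ws wt wtt A) (hl : 0 ≤ l) {t : ℝ} (ht : 0 < t) :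
    HasDerivAt (fun t => ∫ s in (0:ℝ)..l, ⟪w (s, t), wt (s, t)⟫)
      (∫ s in (0:ℝ)..l, (⟪w (s, t), wtt (s, t)⟫ + ⟪wt (s, t), wt (s, t)⟫)) t := by
  have := h.cw; have := h.cwt; have := h.cwtt
  refine hasDerivAt_integral_of_continuous (f := fun z => ⟪w z, wt z⟫)
    (f' := fun z => ⟪w z, wtt z⟫ + ⟪wt z, wt z⟫) (by fun_prop) (by fun_prop) hl ht ?_
  intro s hs τ hτ
  rw [abs_lt] at hτ
  exact (h.dt s hs τ (by linarith)).inner ℝ (h.dtt s hs τ (by linarith))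

theorem hasDerivAt_elastic (h : WaveField l K w ws wt wtt A) (hl : 0 ≤ l) (cK : Continuous K)
    (symmK : ∀ s ∈ Icc 0 l, ∀ x y, ⟪K s x, y⟫ = ⟪x, K s y⟫) {t : ℝ} (ht : 0 < t) :
    HasDerivAt (fun t => ∫ s in (0:ℝ)..l, ⟪ws (s, t), K s (ws (s, t))⟫)
      (-2 * ∫ s in (0:ℝ)..l, ⟪wt (s, t), A (s, t)⟫) t := by
  have := h.cw; have := h.cwt; have := h.cA
  set a : ℝ × ℝ → ℝ := fun z => ∫ s in (0:ℝ)..l, ⟪w (s, z.1), A (s, z.2)⟫ with ha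
  set a1 : ℝ × ℝ → ℝ := fun z => ∫ s in (0:ℝ)..l, ⟪wt (s, z.1), A (s, z.2)⟫ with ha1
  have hc1 : Continuous a1 :=
    continuous_parametric_intervalIntegral_of_continuous'
      (f := fun (z : ℝ × ℝ) s => ⟪wt (s, z.1), A (s, z.2)⟫) (by fun_prop) 0 l
  have hs : ∀ x y, 0 < x → 0 < y → a (x, y) = a (y, x) := fun x y hx hy => by
    simp only [ha]
    rw [h.integral_inner_flux hl cK hx hy, h.integral_inner_flux hl cK hy hx]
    congr 1
    refine integral_congr fun s hs => ?_
    rw [uIcc_of_le hl] at hs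
    rw [← symmK s hs, real_inner_comm]
  have h1 : ∀ x y, 0 < x → 0 < y → HasDerivAt (fun x => a (x, y)) (a1 (x, y)) x := by
    intro x y hx hy
    refine hasDerivAt_integral_of_continuous (f := fun z => ⟪w z, A (z.1, y)⟫)
      (f' := fun z => ⟪wt z, A (z.1, y)⟫) (by fun_prop) (by fun_prop) hl hx ?_
    intro s hs τ hτ
    rw [abs_lt] at hτ
    simpa using (h.dt s hs τ (by linarith)).inner ℝ (hasDerivAt_const τ (A (s, y)))
  have h2 : ∀ x y, 0 < x → 0 < y → HasDerivAt (fun y => a (x, y)) (a1 (y, x)) y := by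
    intro x y hx hy
    refine (h1 y x hy hx).congr_of_eventuallyEq ?_
    filter_upwards [lt_mem_nhds hy] with z hz using hs x z hx hz
  have hd := hasDerivAt_diag (a := a) (a2 := fun z => a1 (z.2, z.1)) hc1 (by fun_prop) h1 h2
    (h := 0) (t := t) ht (by linarith)
  simp only [add_zero] at hd
  refine (hd.neg.congr_of_eventuallyEq ?_).congr_deriv (by simp only [ha1]; ring)
  filter_upwards [lt_mem_nhds ht] with z hz
  simp only [ha, Pi.neg_apply, h.integral_inner_flux hl cK hz hz, neg_neg]

end WaveField
end Wave

section Wave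

variable {H : Type*} [NormedAddCommGroup H] [InnerProductSpace ℝ H]
variable {l : ℝ} {K Kp : ℝ → H →L[ℝ] H} {Kv : ℝ × ℝ → H →L[ℝ] H} {k0 k1 k2 d0 d1 : ℝ}

theorem two_inner_le_of_pos {c : ℝ} (hc : 0 < c) (x y : H) :
    2 * ⟪x, y⟫ ≤ c * ‖x‖ ^ 2 + c⁻¹ * ‖y‖ ^ 2 := by
  have h := real_inner_le_norm x y
  have h2 : 0 ≤ c⁻¹ * (c * ‖x‖ - ‖y‖) ^ 2 := by positivity
  have h3 : c⁻¹ * (c * ‖x‖ - ‖y‖) ^ 2 = c * ‖x‖ ^ 2 - 2 * (‖x‖ * ‖y‖) + c⁻¹ * ‖y‖ ^ 2 := by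
    field_simp
    ring
  linarith

theorem inner_le_of_norm_le {k : ℝ} {x y z : H} (h : ‖y‖ ≤ k * ‖z‖) :
    ⟪x, y⟫ ≤ k * ‖z‖ * ‖x‖ := by
  calc _ ≤ ‖x‖ * ‖y‖ := real_inner_le_norm x y
    _ ≤ ‖x‖ * (k * ‖z‖) := by gcongr
    _ = _ := by ring

/-- Time derivative of the restoring energy. -/
theorem WaveField.hasDerivAt_restoring {w ws wt wtt A : ℝ × ℝ → H}
    (h : WaveField l K w ws wt wtt A) (hl : 0 ≤ l) (cKp : Continuous Kp)
    (symmKp : ∀ s ∈ Icc 0 l, ∀ x y, ⟪Kp s x, y⟫ = ⟪x, Kp s y⟫) {t : ℝ} (ht : 0 < t) :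
    HasDerivAt (fun t => ∫ s in (0:ℝ)..l, ⟪w (s, t), Kp s (w (s, t))⟫)
      (∫ s in (0:ℝ)..l, 2 * ⟪wt (s, t), Kp s (w (s, t))⟫) t := by
  have := h.cw; have := h.cwt
  refine hasDerivAt_integral_of_continuous (f := fun z => ⟪w z, Kp z.1 (w z)⟫)
    (f' := fun z => 2 * ⟪wt z, Kp z.1 (w z)⟫) (by fun_prop) (by fun_prop) hl ht ?_
  intro s hs τ hτ
  rw [abs_lt] at hτ
  have hd := h.dt s hs τ (by linarith)
  refine (hd.inner ℝ ((Kp s).hasFDerivAt.comp_hasDerivAt τ hd)).congr_deriv ?_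
  rw [← symmKp s hs, real_inner_comm, Function.comp_apply]
  ring

theorem WaveField.hasDerivAt_kinetic {w ws wt wtt A : ℝ × ℝ → H}
    (h : WaveField l K w ws wt wtt A) (hl : 0 ≤ l) {t : ℝ} (ht : 0 < t) :
    HasDerivAt (fun t => ∫ s in (0:ℝ)..l, ⟪wt (s, t), wt (s, t)⟫)
      (∫ s in (0:ℝ)..l, 2 * ⟪wt (s, t), wtt (s, t)⟫) t := by
  have := h.cwt; have := h.cwtt
  refine hasDerivAt_integral_of_continuous (f := fun z => ⟪wt z, wt z⟫)
    (f' := fun z => 2 * ⟪wt z, wtt z⟫) (by fun_prop) (by fun_prop) hl ht ?_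
  intro s hs τ hτ
  rw [abs_lt] at hτ
  have hd := h.dtt s hs τ (by linarith)
  refine (hd.inner ℝ hd).congr_deriv ?_
  rw [real_inner_comm]
  ring

/-- The energy of a field. -/
noncomputable def fieldEnergy (l : ℝ) (w ws wt : ℝ × ℝ → H) (t : ℝ) : ℝ :=
  ∫ s in (0:ℝ)..l, (‖w (s, t)‖ ^ 2 + ‖ws (s, t)‖ ^ 2 + ‖wt (s, t)‖ ^ 2)

theorem WaveCoeff.damping_le (hC : WaveCoeff l K Kp Kv k0 k1 k2 d0 d1) {δ s t : ℝ}
    (hδ0 : 0 < δ) (hδ1 : δ * (2 + 2 * l ^ 2 * d1 ^ 2 / k0) ≤ d0 / 2) (hs : s ∈ Icc 0 l)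
    (ht : 0 < t) (w wt f : H) :
    2 * ⟪wt, f - Kv (s, t) wt⟫ + 2 * δ * (⟪w, f - Kv (s, t) wt - Kp s w⟫ + ‖wt‖ ^ 2)
      ≤ -(d0 / 2) * ‖wt‖ ^ 2 + δ * (k0 / l ^ 2) * ‖w‖ ^ 2
        + (d0⁻¹ + 2 * δ * l ^ 2 / k0) * ‖f‖ ^ 2 := by
  have hl := hC.l_pos; have hk := hC.k0_pos; have hd := hC.d0_pos
  have e1 : 2 * ⟪wt, f⟫ ≤ d0 * ‖wt‖ ^ 2 + d0⁻¹ * ‖f‖ ^ 2 := two_inner_le_of_pos hd _ _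
  have hp : 0 < k0 / (2 * l ^ 2) := by positivity
  have e2 := two_inner_le_of_pos hp w f
  have e3 := two_inner_le_of_pos hp w (-(Kv (s, t) wt))
  have e4 := hC.lowKv s hs t ht wt
  have e5 := hC.lowKp s hs w
  have e6 : ‖Kv (s, t) wt‖ ^ 2 ≤ d1 ^ 2 * ‖wt‖ ^ 2 := by
    rw [← mul_pow]; gcongr; exact hC.upKv s hs t ht wt
  have e7 : (k0 / (2 * l ^ 2))⁻¹ * ‖Kv (s, t) wt‖ ^ 2
      ≤ (k0 / (2 * l ^ 2))⁻¹ * (d1 ^ 2 * ‖wt‖ ^ 2) := by gcongr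
  rw [norm_neg, inner_neg_right] at e3
  simp only [inner_sub_right]
  rw [real_inner_comm] at e4 e5
  have q : (k0 / (2 * l ^ 2))⁻¹ = 2 * l ^ 2 / k0 := by field_simp
  have q2 : k0 / (2 * l ^ 2) = k0 / l ^ 2 / 2 := by field_simp
  rw [q] at e2 e3 e7
  rw [q2] at e2 e3
  have e8 : δ * (2 * ⟪w, f⟫ - 2 * ⟪w, Kv (s, t) wt⟫ - 2 * ⟪w, Kp s w⟫ + 2 * ‖wt‖ ^ 2) ≤
      δ * (k0 / l ^ 2 * ‖w‖ ^ 2 + 2 * l ^ 2 / k0 * ‖f‖ ^ 2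
        + (2 + 2 * l ^ 2 * d1 ^ 2 / k0) * ‖wt‖ ^ 2) := by
    refine mul_le_mul_of_nonneg_left ?_ hδ0.le
    have : 2 * l ^ 2 / k0 * (d1 ^ 2 * ‖wt‖ ^ 2) = 2 * l ^ 2 * d1 ^ 2 / k0 * ‖wt‖ ^ 2 := by ring
    linarith
  have e9 : δ * (2 + 2 * l ^ 2 * d1 ^ 2 / k0) * ‖wt‖ ^ 2 ≤ d0 / 2 * ‖wt‖ ^ 2 := by gcongr
  have r1 : δ * (k0 / l ^ 2 * ‖w‖ ^ 2 + 2 * l ^ 2 / k0 * ‖f‖ ^ 2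
        + (2 + 2 * l ^ 2 * d1 ^ 2 / k0) * ‖wt‖ ^ 2)
      = δ * (k0 / l ^ 2) * ‖w‖ ^ 2 + 2 * δ * l ^ 2 / k0 * ‖f‖ ^ 2
        + δ * (2 + 2 * l ^ 2 * d1 ^ 2 / k0) * ‖wt‖ ^ 2 := by ring
  linarith

variable [CompleteSpace H]

theorem WaveCoeff.exists_lyapunov (hC : WaveCoeff l K Kp Kv k0 k1 k2 d0 d1) :
    ∃ c > 0, ∃ C > 0, ∀ {w ws wt wtt A F : ℝ × ℝ → H}, WaveField l K w ws wt wtt A →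
      Continuous F →
      (∀ s ∈ Icc 0 l, ∀ t, 0 < t →
        wtt (s, t) = A (s, t) - Kv (s, t) (wt (s, t)) - Kp s (w (s, t)) + F (s, t)) →
      ∃ L L' : ℝ → ℝ, (∀ t, 0 < t → HasDerivAt L (L' t) t) ∧
        (∀ t, 0 < t → L' t ≤ -c * L t + C * ∫ s in (0:ℝ)..l, ‖F (s, t)‖ ^ 2) ∧
        (∀ t, 0 < t → c * fieldEnergy l w ws wt t ≤ L t) ∧
        (∀ t, 0 < t → L t ≤ C * fieldEnergy l w ws wt t) := by
  have hl := hC.l_pos; have hk := hC.k0_pos; have hd := hC.d0_pos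
  obtain ⟨δ, hδ0, hδ1, hδ2, hδ3⟩ : ∃ δ : ℝ, 0 < δ ∧ δ * (2 + 2 * l ^ 2 * d1 ^ 2 / k0) ≤ d0 / 2 ∧
      δ ≤ 1 / 2 ∧ δ * l ^ 2 ≤ k0 / 2 := by
    have hp : 0 < 2 + 2 * l ^ 2 * d1 ^ 2 / k0 := by positivity
    refine ⟨min (d0 / 2 / (2 + 2 * l ^ 2 * d1 ^ 2 / k0)) (min (1 / 2) (k0 / 2 / l ^ 2)),
      by positivity, ?_, (min_le_right _ _).trans (min_le_left _ _), ?_⟩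
    · rw [← le_div_iff₀ hp]; exact min_le_left _ _
    · rw [← le_div_iff₀ (by positivity)]; exact (min_le_right _ _).trans (min_le_right _ _)
  set CL := 2 + |k1| + |k2| * l ^ 2 + l ^ 2 with hCL
  have hCLpos : 0 < CL := by positivity
  set c := min (min (1 / 2) (k0 / 2 / (l ^ 2 + 1))) (min (d0 / 2) (δ * k0) / CL) with hc
  have hcpos : 0 < c := by positivity
  have hc1 : c ≤ 1 / 2 := (min_le_left _ _).trans (min_le_left _ _)
  have hc2 : c * (l ^ 2 + 1) ≤ k0 / 2 := by
    rw [← le_div_iff₀ (by positivity)]; exact (min_le_left _ _).trans (min_le_right _ _)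
  have hc3 : c * CL ≤ d0 / 2 := by
    rw [← le_div_iff₀ hCLpos]
    exact (min_le_right _ _).trans (by gcongr; exact min_le_left _ _)
  have hc4 : c * CL ≤ δ * k0 := by
    rw [← le_div_iff₀ hCLpos]
    exact (min_le_right _ _).trans (by gcongr; exact min_le_right _ _)
  refine ⟨c, hcpos, CL + (d0⁻¹ + 2 * δ * l ^ 2 / k0), by positivity, ?_⟩
  intro w ws wt wtt A F h cF heq
  have cw := h.cw; have cws := h.cws; have cwt := h.cwt; have cA := h.cA; have cwtt := h.cwtt
  have cK := hC.cK; have cKp := hC.cKp; have cKv := hC.cKv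
  set L : ℝ → ℝ := fun t => (∫ s in (0:ℝ)..l, ⟪wt (s, t), wt (s, t)⟫)
    + (∫ s in (0:ℝ)..l, ⟪ws (s, t), K s (ws (s, t))⟫)
    + (∫ s in (0:ℝ)..l, ⟪w (s, t), Kp s (w (s, t))⟫)
    + 2 * δ * (∫ s in (0:ℝ)..l, ⟪w (s, t), wt (s, t)⟫) with hL
  set L' : ℝ → ℝ := fun t => (∫ s in (0:ℝ)..l, 2 * ⟪wt (s, t), wtt (s, t)⟫)
    + (-2 * ∫ s in (0:ℝ)..l, ⟪wt (s, t), A (s, t)⟫)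
    + (∫ s in (0:ℝ)..l, 2 * ⟪wt (s, t), Kp s (w (s, t))⟫)
    + 2 * δ * (∫ s in (0:ℝ)..l, (⟪w (s, t), wtt (s, t)⟫ + ⟪wt (s, t), wt (s, t)⟫)) with hL'
  have hderiv : ∀ t, 0 < t → HasDerivAt L (L' t) t := fun t ht =>
    (((h.hasDerivAt_kinetic hl.le ht).add (h.hasDerivAt_elastic hl.le cK hC.symmK ht)).add
      (h.hasDerivAt_restoring hl.le cKp hC.symmKp ht)).add
      ((h.hasDerivAt_cross hl.le ht).const_mul (2 * δ))
  set V : ℝ → ℝ := fun t => ∫ s in (0:ℝ)..l, ‖wt (s, t)‖ ^ 2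
  set S : ℝ → ℝ := fun t => ∫ s in (0:ℝ)..l, ‖ws (s, t)‖ ^ 2
  set W : ℝ → ℝ := fun t => ∫ s in (0:ℝ)..l, ‖w (s, t)‖ ^ 2
  have hV : ∀ t, 0 ≤ V t := fun t => integral_nonneg hl.le fun x _ => sq_nonneg _
  have hS : ∀ t, 0 ≤ S t := fun t => integral_nonneg hl.le fun x _ => sq_nonneg _
  have hW : ∀ t, 0 ≤ W t := fun t => integral_nonneg hl.le fun x _ => sq_nonneg _
  have hWS : ∀ t, 0 < t → W t ≤ l ^ 2 * S t := fun t ht =>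
    poincare hl.le (f := fun s => w (s, t)) (f' := fun s => ws (s, t)) (by fun_prop) (by fun_prop)
      (h.left t ht) (h.ds t ht)
  have hlow : ∀ t, 0 < t → 1 / 2 * V t + k0 / 2 * S t ≤ L t := by
    intro t ht
    have e1 : (∫ s in (0:ℝ)..l, ⟪wt (s, t), wt (s, t)⟫) = V t := by
      simp only [V, real_inner_self_eq_norm_sq]
    have e2 : k0 * S t ≤ ∫ s in (0:ℝ)..l, ⟪ws (s, t), K s (ws (s, t))⟫ := by
      rw [← intervalIntegral.integral_const_mul]
      refine integral_mono_continuous hl.le (by fun_prop) (by fun_prop) fun s hs => ?_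
      rw [real_inner_comm]; exact hC.lowK s hs _
    have e3 : 0 ≤ ∫ s in (0:ℝ)..l, ⟪w (s, t), Kp s (w (s, t))⟫ := by
      refine integral_nonneg hl.le fun s hs => ?_
      rw [real_inner_comm]; exact hC.lowKp s hs _
    have e4 : -(W t + V t) ≤ 2 * ∫ s in (0:ℝ)..l, ⟪w (s, t), wt (s, t)⟫ := by
      rw [← intervalIntegral.integral_const_mul, ← intervalIntegral.integral_add
        (Continuous.intervalIntegrable (by fun_prop) _ _)
        (Continuous.intervalIntegrable (by fun_prop) _ _), ← intervalIntegral.integral_neg]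
      refine integral_mono_continuous hl.le (by fun_prop) (by fun_prop) fun s hs => ?_
      have := two_inner_le_of_pos one_pos (w (s, t)) (-wt (s, t))
      rw [inner_neg_right, norm_neg] at this
      simp only [inv_one, one_mul] at this
      linarith
    have e5 : δ * -(W t + V t) ≤ δ * (2 * ∫ s in (0:ℝ)..l, ⟪w (s, t), wt (s, t)⟫) := by gcongr
    have e6 : δ * W t ≤ δ * (l ^ 2 * S t) := by gcongr; exact hWS t ht
    have e7 : δ * V t ≤ 1 / 2 * V t := mul_le_mul_of_nonneg_right hδ2 (hV t)
    have e8 : δ * l ^ 2 * S t ≤ k0 / 2 * S t := mul_le_mul_of_nonneg_right hδ3 (hS t)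
    have : L t = _ := rfl
    simp only [hL, e1]
    linarith
  have hup : ∀ t, 0 < t → L t ≤ CL * (V t + S t) := by
    intro t ht
    have e1 : (∫ s in (0:ℝ)..l, ⟪wt (s, t), wt (s, t)⟫) = V t := by
      simp only [V, real_inner_self_eq_norm_sq]
    have e2 : ∫ s in (0:ℝ)..l, ⟪ws (s, t), K s (ws (s, t))⟫ ≤ |k1| * S t := by
      rw [← intervalIntegral.integral_const_mul]
      refine integral_mono_continuous hl.le (by fun_prop) (by fun_prop) fun s hs => ?_
      have := inner_le_of_norm_le (x := ws (s, t)) ((hC.upK s hs (ws (s, t))).trans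
        (mul_le_mul_of_nonneg_right (le_abs_self k1) (norm_nonneg _)))
      linarith
    have e3 : ∫ s in (0:ℝ)..l, ⟪w (s, t), Kp s (w (s, t))⟫ ≤ |k2| * W t := by
      rw [← intervalIntegral.integral_const_mul]
      refine integral_mono_continuous hl.le (by fun_prop) (by fun_prop) fun s hs => ?_
      have := inner_le_of_norm_le (x := w (s, t)) ((hC.upKp s hs (w (s, t))).trans
        (mul_le_mul_of_nonneg_right (le_abs_self k2) (norm_nonneg _)))
      linarith
    have e4 : 2 * ∫ s in (0:ℝ)..l, ⟪w (s, t), wt (s, t)⟫ ≤ W t + V t := by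
      rw [← intervalIntegral.integral_const_mul, ← intervalIntegral.integral_add
        (Continuous.intervalIntegrable (by fun_prop) _ _)
        (Continuous.intervalIntegrable (by fun_prop) _ _)]
      refine integral_mono_continuous hl.le (by fun_prop) (by fun_prop) fun s hs => ?_
      have := two_inner_le_of_pos one_pos (w (s, t)) (wt (s, t))
      simp only [inv_one, one_mul] at this
      linarith
    have e5 : δ * (2 * ∫ s in (0:ℝ)..l, ⟪w (s, t), wt (s, t)⟫) ≤ δ * (W t + V t) := by gcongr
    have e6 : δ * (W t + V t) ≤ 1 * (W t + V t) :=
      mul_le_mul_of_nonneg_right (by linarith) (add_nonneg (hW t) (hV t))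
    have e7 := hWS t ht
    have e8 : |k2| * W t ≤ |k2| * (l ^ 2 * S t) := by gcongr
    have e9 : 0 ≤ (|k1| + |k2| * l ^ 2 + l ^ 2) * V t := mul_nonneg (by positivity) (hV t)
    have e10 := hS t
    simp only [hL, e1, hCL]
    linarith
  have hL0 : ∀ t, 0 < t → 0 ≤ L t := fun t ht =>
    le_trans (add_nonneg (mul_nonneg (by norm_num) (hV t)) (mul_nonneg (by linarith) (hS t)))
      (hlow t ht)
  have hE : ∀ t, fieldEnergy l w ws wt t = W t + S t + V t := fun t => by
    simp only [fieldEnergy, W, S, V]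
    rw [intervalIntegral.integral_add, intervalIntegral.integral_add]
    all_goals exact Continuous.intervalIntegrable (by fun_prop) _ _
  refine ⟨L, L', hderiv, fun t ht => ?_, fun t ht => ?_, fun t ht => ?_⟩
  · have e1 : L' t = (∫ s in (0:ℝ)..l, (2 * ⟪wt (s, t), F (s, t) - Kv (s, t) (wt (s, t))⟫
        + 2 * δ * (⟪w (s, t), F (s, t) - Kv (s, t) (wt (s, t)) - Kp s (w (s, t))⟫
          + ‖wt (s, t)‖ ^ 2))) + 2 * δ * ∫ s in (0:ℝ)..l, ⟪w (s, t), A (s, t)⟫ := by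
      simp only [hL']
      rw [← intervalIntegral.integral_const_mul, ← intervalIntegral.integral_const_mul,
        ← intervalIntegral.integral_const_mul,
        ← intervalIntegral.integral_add, ← intervalIntegral.integral_add,
        ← intervalIntegral.integral_add, ← intervalIntegral.integral_add]
      · refine integral_congr fun s hs => ?_
        rw [uIcc_of_le hl.le] at hs
        simp only [heq s hs t ht, inner_add_right, inner_sub_right, real_inner_self_eq_norm_sq]
        ring
      all_goals exact Continuous.intervalIntegrable (by fun_prop) _ _
    have e2 : ∫ s in (0:ℝ)..l, (2 * ⟪wt (s, t), F (s, t) - Kv (s, t) (wt (s, t))⟫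
        + 2 * δ * (⟪w (s, t), F (s, t) - Kv (s, t) (wt (s, t)) - Kp s (w (s, t))⟫
          + ‖wt (s, t)‖ ^ 2)) ≤ -(d0 / 2) * V t + δ * (k0 / l ^ 2) * W t
            + (d0⁻¹ + 2 * δ * l ^ 2 / k0) * ∫ s in (0:ℝ)..l, ‖F (s, t)‖ ^ 2 := by
      simp only [V, W]
      rw [← intervalIntegral.integral_const_mul, ← intervalIntegral.integral_const_mul,
        ← intervalIntegral.integral_const_mul,
        ← intervalIntegral.integral_add, ← intervalIntegral.integral_add]
      · exact integral_mono_continuous hl.le (by fun_prop) (by fun_prop) fun s hs =>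
          hC.damping_le hδ0 hδ1 hs ht _ _ _
      all_goals exact Continuous.intervalIntegrable (by fun_prop) _ _
    have e3 : k0 * S t ≤ ∫ s in (0:ℝ)..l, ⟪ws (s, t), K s (ws (s, t))⟫ := by
      simp only [S]
      rw [← intervalIntegral.integral_const_mul]
      refine integral_mono_continuous hl.le (by fun_prop) (by fun_prop) fun s hs => ?_
      rw [real_inner_comm]; exact hC.lowK s hs _
    rw [h.integral_inner_flux hl.le cK ht ht] at e1
    have e4 : δ * (k0 / l ^ 2) * W t ≤ δ * k0 * S t := by
      calc _ ≤ δ * (k0 / l ^ 2) * (l ^ 2 * S t) := by gcongr; exact hWS t ht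
        _ = _ := by field_simp
    have e5 : δ * (k0 * S t) ≤ δ * ∫ s in (0:ℝ)..l, ⟪ws (s, t), K s (ws (s, t))⟫ := by gcongr
    have e6 : c * L t ≤ c * (CL * (V t + S t)) := by gcongr; exact hup t ht
    have e7 : c * CL * V t ≤ d0 / 2 * V t := mul_le_mul_of_nonneg_right hc3 (hV t)
    have e8 : c * CL * S t ≤ δ * k0 * S t := mul_le_mul_of_nonneg_right hc4 (hS t)
    have e9 : 0 ≤ CL * ∫ s in (0:ℝ)..l, ‖F (s, t)‖ ^ 2 :=
      mul_nonneg hCLpos.le (integral_nonneg hl.le fun x _ => sq_nonneg _)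
    rw [e1]
    linarith
  · rw [hE]
    have := hlow t ht
    have e1 : c * W t ≤ c * (l ^ 2 * S t) := by gcongr; exact hWS t ht
    have e2 : c * (l ^ 2 + 1) * S t ≤ k0 / 2 * S t := mul_le_mul_of_nonneg_right hc2 (hS t)
    have e3 : c * V t ≤ 1 / 2 * V t := mul_le_mul_of_nonneg_right hc1 (hV t)
    linarith
  · rw [hE]
    refine (hup t ht).trans ?_
    have e1 : 0 ≤ (d0⁻¹ + 2 * δ * l ^ 2 / k0) * (W t + S t + V t) := by
      have := hW t; have := hS t; have := hV t
      positivity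
    have e2 := mul_nonneg hCLpos.le (hW t)
    linarith

end Wave

theorem exp_decay_of_deriv_le {L L' : ℝ → ℝ} {c : ℝ} (hL : ∀ t, 0 < t → HasDerivAt L (L' t) t)
    (hle : ∀ t, 0 < t → L' t ≤ -c * L t) {a t : ℝ} (ha : 0 < a) (hat : a ≤ t) :
    L t ≤ L a * Real.exp (-c * (t - a)) := by
  have hd : ∀ x, 0 < x → HasDerivAt (fun x => L x * Real.exp (c * x))
      ((L' x + c * L x) * Real.exp (c * x)) x := fun x hx => by
    have := (hL x hx).mul (((hasDerivAt_id x).const_mul c).exp)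
    refine this.congr_deriv ?_
    simp only [id, mul_one]
    ring
  have hanti : AntitoneOn (fun x => L x * Real.exp (c * x)) (Ici a) := by
    refine antitoneOn_of_deriv_nonpos (convex_Ici a)
      (fun x hx => (hd x (ha.trans_le hx)).continuousAt.continuousWithinAt)
      (fun x hx => ?_) fun x hx => ?_
    · rw [interior_Ici] at hx
      exact (hd x (ha.trans hx)).differentiableAt.differentiableWithinAt
    · rw [interior_Ici] at hx
      rw [(hd x (ha.trans hx)).deriv]
      have := hle x (ha.trans hx)
      exact mul_nonpos_of_nonpos_of_nonneg (by linarith) (Real.exp_pos _).le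
  have h := hanti self_mem_Ici hat hat
  simp only at h
  have e : Real.exp (-c * (t - a)) = Real.exp (c * a) * Real.exp (-(c * t)) := by
    rw [← Real.exp_add]; congr 1; ring
  rw [e, ← mul_assoc, Real.exp_neg, ← div_eq_mul_inv, le_div_iff₀ (Real.exp_pos _)]
  exact h

section Wave

variable {H : Type*} [NormedAddCommGroup H] [InnerProductSpace ℝ H]
variable {l : ℝ} {K Kp : ℝ → H →L[ℝ] H} {Kv : ℝ × ℝ → H →L[ℝ] H} {k0 k1 k2 d0 d1 : ℝ}

/-- Forward difference quotient in time. -/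
noncomputable def timeQuot (h : ℝ) (w : ℝ × ℝ → H) (z : ℝ × ℝ) : H :=
  h⁻¹ • (w (z.1, z.2 + h) - w z)

theorem WaveField.timeQuot {w ws wt wtt A : ℝ × ℝ → H} (hw : WaveField l K w ws wt wtt A)
    {h : ℝ} (hh : 0 < h) :
    WaveField l K (timeQuot h w) (timeQuot h ws) (timeQuot h wt) (timeQuot h wtt)
      (timeQuot h A) := by
  have cw := hw.cw; have cws := hw.cws; have cwt := hw.cwt; have cA := hw.cA
  have cwtt := hw.cwtt
  unfold _root_.timeQuot
  refine ⟨by fun_prop, by fun_prop, by fun_prop, by fun_prop, by fun_prop, ?_, ?_, ?_, ?_, ?_, ?_⟩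
  · intro s hs t ht
    exact (((hw.dt s hs (t + h) (by linarith)).comp_add_const t h).sub
      (hw.dt s hs t ht)).const_smul h⁻¹
  · intro s hs t ht
    exact (((hw.dtt s hs (t + h) (by linarith)).comp_add_const t h).sub
      (hw.dtt s hs t ht)).const_smul h⁻¹
  · intro t ht s hs
    exact ((hw.ds (t + h) (by linarith) s hs).sub (hw.ds t ht s hs)).const_smul h⁻¹
  · intro t ht s hs
    have := ((hw.dA (t + h) (by linarith) s hs).sub (hw.dA t ht s hs)).const_smul h⁻¹
    refine this.congr_of_eventuallyEq (Eventually.of_forall fun x => ?_)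
    simp
  · intro t ht
    simp [hw.left t ht, hw.left (t + h) (by linarith)]
  · intro t ht
    simp [hw.right t ht, hw.right (t + h) (by linarith)]

theorem norm_timeQuot_le {w wt : ℝ × ℝ → H} {s a b M : ℝ}
    (hd : ∀ t ∈ Icc a b, HasDerivAt (fun x => w (s, x)) (wt (s, t)) t)
    (hM : ∀ t ∈ Icc a b, ‖wt (s, t)‖ ≤ M) {h t : ℝ} (hh : 0 < h) (ht : a ≤ t) (hth : t + h ≤ b) :
    ‖timeQuot h w (s, t)‖ ≤ M := by
  have := (convex_Icc a b).norm_image_sub_le_of_norm_hasDerivWithin_le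
    (fun x hx => (hd x hx).hasDerivWithinAt) hM (x := t) (y := t + h)
    ⟨ht, by linarith⟩ ⟨by linarith, hth⟩
  rw [timeQuot, norm_smul, norm_inv, Real.norm_of_nonneg hh.le, inv_mul_le_iff₀ hh]
  simpa [abs_of_pos hh, mul_comm] using this

theorem tendsto_timeQuot {w wt : ℝ × ℝ → H} {s t : ℝ}
    (hd : HasDerivAt (fun x => w (s, x)) (wt (s, t)) t) :
    Tendsto (fun h => timeQuot h w (s, t)) (𝓝[>] 0) (𝓝 (wt (s, t))) :=
  hd.tendsto_slope_zero.mono_left (nhdsWithin_mono _ fun _ hx => ne_of_gt hx)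

theorem WaveField.norm_sq_le_fieldEnergy [CompleteSpace H] {w ws wt wtt A : ℝ × ℝ → H}
    (h : WaveField l K w ws wt wtt A) (hl : 0 ≤ l) {s t : ℝ} (hs : s ∈ Icc 0 l) (ht : 0 < t) :
    ‖w (s, t)‖ ^ 2 ≤ l * fieldEnergy l w ws wt t := by
  have cw := h.cw; have cws := h.cws; have cwt := h.cwt
  have := norm_sq_sub_le (f := fun s => w (s, t)) (f' := fun s => ws (s, t)) hs (by fun_prop)
    (by fun_prop) (h.ds t ht)
  rw [h.left t ht, sub_zero, sub_zero] at this
  have h0 : 0 ≤ ∫ s in (0:ℝ)..l, ‖ws (s, t)‖ ^ 2 := integral_nonneg hl fun _ _ => sq_nonneg _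
  refine this.trans ?_
  calc _ ≤ l * ∫ s in (0:ℝ)..l, ‖ws (s, t)‖ ^ 2 := by gcongr; exact hs.2
    _ ≤ _ := by
      unfold fieldEnergy
      gcongr
      refine integral_mono_continuous hl (by fun_prop) (by fun_prop) fun s _ => ?_
      nlinarith [sq_nonneg ‖w (s, t)‖, sq_nonneg ‖wt (s, t)‖]

theorem WaveField.integral_wt_sq_le_fieldEnergy {w ws wt wtt A : ℝ × ℝ → H}
    (h : WaveField l K w ws wt wtt A) (hl : 0 ≤ l) (t : ℝ) :
    ∫ s in (0:ℝ)..l, ‖wt (s, t)‖ ^ 2 ≤ fieldEnergy l w ws wt t := by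
  have cw := h.cw; have cws := h.cws; have cwt := h.cwt
  unfold fieldEnergy
  refine integral_mono_continuous hl (by fun_prop) (by fun_prop) fun s _ => ?_
  nlinarith [sq_nonneg ‖w (s, t)‖, sq_nonneg ‖ws (s, t)‖]

/-- If `w` and `w_t` are bounded on `[1, 2]`, some energy in between is controlled by the bound. -/
theorem WaveCoeff.exists_fieldEnergy_le (hC : WaveCoeff l K Kp Kv k0 k1 k2 d0 d1) (M : ℝ) :
    ∃ Q : ℝ, ∀ {w ws wt wtt A : ℝ × ℝ → H}, WaveField l K w ws wt wtt A →
      (∀ s ∈ Icc 0 l, ∀ t, 0 < t →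
        wtt (s, t) = A (s, t) - Kv (s, t) (wt (s, t)) - Kp s (w (s, t))) →
      (∀ s ∈ Icc 0 l, ∀ t ∈ Icc (1:ℝ) 2, ‖w (s, t)‖ ≤ M ∧ ‖wt (s, t)‖ ≤ M) →
      ∃ t ∈ Ioo (1:ℝ) 2, fieldEnergy l w ws wt t ≤ Q := by
  have hl := hC.l_pos; have hk := hC.k0_pos
  refine ⟨2 * l * M ^ 2 + k0⁻¹ * (l * (3 + |d1| + |k2|) * M ^ 2), ?_⟩
  intro w ws wt wtt A h heq hM
  have cw := h.cw; have cws := h.cws; have cwt := h.cwt; have cA := h.cA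
  have cwtt := h.cwtt
  have cK := hC.cK
  have hM0 : 0 ≤ M := (norm_nonneg _).trans (hM 0 ⟨le_rfl, hl.le⟩ 1 (by norm_num)).1
  set X : ℝ → ℝ := fun t => ∫ s in (0:ℝ)..l, ⟪w (s, t), wt (s, t)⟫ with hX
  have hXd := fun t (ht : (0:ℝ) < t) => h.hasDerivAt_cross hl.le ht
  obtain ⟨τ, hτ, hτX⟩ := exists_hasDerivAt_eq_slope X _ (show (1:ℝ) < 2 by norm_num)
    (fun t ht => (hXd t (by linarith [ht.1])).continuousAt.continuousWithinAt)
    (fun t ht => hXd t (by linarith [ht.1]))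
  have hτ' : τ ∈ Icc (1:ℝ) 2 := ⟨hτ.1.le, hτ.2.le⟩
  have hτ0 : 0 < τ := by linarith [hτ.1]
  refine ⟨τ, hτ, ?_⟩
  have hXb : ∀ t ∈ Icc (1:ℝ) 2, |X t| ≤ l * M ^ 2 := fun t ht => by
    have := norm_integral_le_of_norm_le_const (a := 0) (b := l) (C := M ^ 2)
      (f := fun s => ⟪w (s, t), wt (s, t)⟫) fun s hs => by
        rw [uIoc_of_le hl.le] at hs
        obtain ⟨b1, b2⟩ := hM s ⟨hs.1.le, hs.2⟩ t ht
        calc _ ≤ ‖w (s, t)‖ * ‖wt (s, t)‖ := norm_inner_le_norm _ _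
          _ ≤ M * M := by gcongr
          _ = _ := by ring
    rw [sub_zero, abs_of_pos hl] at this
    simpa [hX, mul_comm] using this
  have e1 : k0 * ∫ s in (0:ℝ)..l, ‖ws (s, τ)‖ ^ 2 ≤ l * (3 + |d1| + |k2|) * M ^ 2 := by
    have a1 : k0 * ∫ s in (0:ℝ)..l, ‖ws (s, τ)‖ ^ 2 ≤ -∫ s in (0:ℝ)..l, ⟪w (s, τ), A (s, τ)⟫ := by
      rw [h.integral_inner_flux hl.le cK hτ0 hτ0, neg_neg, ← intervalIntegral.integral_const_mul]
      refine integral_mono_continuous hl.le (by fun_prop) (by fun_prop) fun s hs => ?_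
      rw [real_inner_comm]; exact hC.lowK s hs _
    have a2 : -∫ s in (0:ℝ)..l, ⟪w (s, τ), A (s, τ)⟫ ≤
        (∫ s in (0:ℝ)..l, (1 + |d1| + |k2|) * M ^ 2)
          - ∫ s in (0:ℝ)..l, (⟪w (s, τ), wtt (s, τ)⟫ + ⟪wt (s, τ), wt (s, τ)⟫) := by
      rw [← intervalIntegral.integral_neg, ← intervalIntegral.integral_sub
        (Continuous.intervalIntegrable (by fun_prop) _ _)
        (Continuous.intervalIntegrable (by fun_prop) _ _)]
      refine integral_mono_continuous hl.le (by fun_prop) (by fun_prop) fun s hs => ?_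
      obtain ⟨b1, b2⟩ := hM s hs τ hτ'
      rw [heq s hs τ hτ0, inner_sub_right, inner_sub_right, real_inner_self_eq_norm_sq]
      have c1 := inner_le_of_norm_le (x := -w (s, τ)) ((hC.upKv s hs τ hτ0 (wt (s, τ))).trans
        (mul_le_mul_of_nonneg_right (le_abs_self d1) (norm_nonneg _)))
      have c2 := inner_le_of_norm_le (x := -w (s, τ)) ((hC.upKp s hs (w (s, τ))).trans
        (mul_le_mul_of_nonneg_right (le_abs_self k2) (norm_nonneg _)))
      rw [norm_neg, inner_neg_left] at c1 c2
      have c3 : |d1| * ‖wt (s, τ)‖ * ‖w (s, τ)‖ ≤ |d1| * M * M := by gcongr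
      have c4 : |k2| * ‖w (s, τ)‖ * ‖w (s, τ)‖ ≤ |k2| * M * M := by gcongr
      have c5 : ‖wt (s, τ)‖ ^ 2 ≤ M ^ 2 := by gcongr
      linarith
    rw [hτX, intervalIntegral.integral_const, sub_zero, smul_eq_mul] at a2
    have b1 := abs_le.1 (hXb 1 (by norm_num))
    have b2 := abs_le.1 (hXb 2 (by norm_num))
    have : (X 2 - X 1) / (2 - 1) = X 2 - X 1 := by norm_num
    rw [this] at a2
    linarith [b1.1, b2.1, b1.2, b2.2]
  have e2 : fieldEnergy l w ws wt τ ≤ 2 * l * M ^ 2 + ∫ s in (0:ℝ)..l, ‖ws (s, τ)‖ ^ 2 := by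
    have : 2 * l * M ^ 2 = ∫ s in (0:ℝ)..l, 2 * M ^ 2 := by
      rw [intervalIntegral.integral_const]; simp; ring
    rw [this, ← intervalIntegral.integral_add (Continuous.intervalIntegrable (by fun_prop) _ _)
        (Continuous.intervalIntegrable (by fun_prop) _ _)]
    refine integral_mono_continuous hl.le (by fun_prop) (by fun_prop) fun s hs => ?_
    obtain ⟨b1, b2⟩ := hM s hs τ hτ'
    have c5 : ‖wt (s, τ)‖ ^ 2 ≤ M ^ 2 := by gcongr
    have c6 : ‖w (s, τ)‖ ^ 2 ≤ M ^ 2 := by gcongr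
    linarith
  rw [← le_inv_mul_iff₀ hk] at e1
  linarith

theorem WaveCoeff.norm_le_of_lowK (hC : WaveCoeff l K Kp Kv k0 k1 k2 d0 d1) {s : ℝ}
    (hs : s ∈ Icc 0 l) (x : H) : ‖x‖ ≤ k0⁻¹ * ‖K s x‖ := by
  have hk := hC.k0_pos
  rw [le_inv_mul_iff₀ hk]
  rcases (norm_nonneg x).eq_or_lt with h0 | h0
  · rw [← h0]; simp
  · have h1 := (hC.lowK s hs x).trans (real_inner_le_norm _ _)
    nlinarith

/-- Decay of solutions of the unforced equation with time-independent damping, up to pointwise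
decay of both first derivatives. -/
theorem WaveCoeff.homogeneous_decay [CompleteSpace H] {D : ℝ → H →L[ℝ] H}
    (hC : WaveCoeff l K Kp (fun z => D z.1) k0 k1 k2 d0 d1)
    {w ws wt wtt A : ℝ × ℝ → H} (hw : WaveField l K w ws wt wtt A)
    (heq : ∀ s ∈ Icc 0 l, ∀ t, 0 < t →
      wtt (s, t) = A (s, t) - D s (wt (s, t)) - Kp s (w (s, t))) :
    ∃ C > 0, ∃ lam > 0, ∀ t, 2 ≤ t → ∀ s ∈ Icc 0 l, ‖w (s, t)‖ ≤ C * Real.exp (-lam * t) ∧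
      ‖wt (s, t)‖ ≤ C * Real.exp (-lam * t) ∧ ‖ws (s, t)‖ ≤ C * Real.exp (-lam * t) := by
  have hl := hC.l_pos; have hk := hC.k0_pos
  have cw := hw.cw; have cws := hw.cws; have cwt := hw.cwt; have cA := hw.cA
  have cwtt := hw.cwtt
  obtain ⟨c, hc, C, hCp, hLyap⟩ := hC.exists_lyapunov
  -- energy decay for unforced solutions
  have hdecay : ∀ {w ws wt wtt A : ℝ × ℝ → H}, WaveField l K w ws wt wtt A →
      (∀ s ∈ Icc 0 l, ∀ t, 0 < t →
        wtt (s, t) = A (s, t) - D s (wt (s, t)) - Kp s (w (s, t))) →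
      ∀ a t, 0 < a → a ≤ t → fieldEnergy l w ws wt t
        ≤ C / c * fieldEnergy l w ws wt a * Real.exp (-c * (t - a)) := by
    intro w ws wt wtt A h he a t ha hat
    obtain ⟨L, L', h1, h2, h3, h4⟩ := hLyap h (F := fun _ => 0) continuous_const
      (fun s hs t ht => by simpa using he s hs t ht)
    have := exp_decay_of_deriv_le h1 (fun t ht => by simpa using h2 t ht) ha hat
    have h5 := (h3 t (ha.trans_le hat)).trans this
    rw [div_mul_eq_mul_div, div_mul_eq_mul_div, le_div_iff₀ hc, mul_comm _ c]
    exact h5.trans (by gcongr; exact h4 a ha)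
  obtain ⟨M, hM⟩ : ∃ M, ∀ z ∈ Icc 0 l ×ˢ Icc (1:ℝ) 3, ‖wt z‖ ≤ M ∧ ‖wtt z‖ ≤ M := by
    obtain ⟨M1, h1⟩ := (isCompact_Icc.prod isCompact_Icc).exists_bound_of_continuousOn
      (s := Icc 0 l ×ˢ Icc (1:ℝ) 3) cwt.continuousOn
    obtain ⟨M2, h2⟩ := (isCompact_Icc.prod isCompact_Icc).exists_bound_of_continuousOn
      (s := Icc 0 l ×ˢ Icc (1:ℝ) 3) cwtt.continuousOn
    exact ⟨max M1 M2, fun z hz => ⟨(h1 z hz).trans (le_max_left _ _),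
      (h2 z hz).trans (le_max_right _ _)⟩⟩
  obtain ⟨Q, hQ⟩ := hC.exists_fieldEnergy_le M
  have hquot : ∀ h, 0 < h → h ≤ 1 → ∀ t, 2 ≤ t →
      fieldEnergy l (timeQuot h w) (timeQuot h ws) (timeQuot h wt) t
        ≤ C / c * |Q| * Real.exp (2 * c) * Real.exp (-c * t) := by
    intro h hh hh1 t ht
    have hz := hw.timeQuot hh
    have he : ∀ s ∈ Icc 0 l, ∀ t, 0 < t → timeQuot h wtt (s, t)
        = timeQuot h A (s, t) - D s (timeQuot h wt (s, t)) - Kp s (timeQuot h w (s, t)) := by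
      intro s hs t ht
      simp only [timeQuot, heq s hs t ht, heq s hs (t + h) (by linarith), map_smul, map_sub]
      module
    obtain ⟨τ, hτ, hτQ⟩ := hQ hz he (fun s hs t ht => ⟨
      norm_timeQuot_le (a := 1) (b := 3) (fun x hx => hw.dt s hs x (by linarith [hx.1]))
        (fun x hx => (hM (s, x) ⟨hs, hx⟩).1) hh ht.1 (by linarith [ht.2]),
      norm_timeQuot_le (a := 1) (b := 3) (fun x hx => hw.dtt s hs x (by linarith [hx.1]))
        (fun x hx => (hM (s, x) ⟨hs, hx⟩).2) hh ht.1 (by linarith [ht.2])⟩)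
    refine (hdecay hz he τ t (by linarith [hτ.1]) (by linarith [hτ.2])).trans ?_
    rw [mul_assoc (C / c * |Q|), ← Real.exp_add]
    gcongr
    · exact hτQ.trans (le_abs_self _)
    · nlinarith [hτ.2]
  set Q' := C / c * |Q| * Real.exp (2 * c) with hQ'
  have hQ'0 : 0 ≤ Q' := by positivity
  set P := C / c * |fieldEnergy l w ws wt 1| * Real.exp c with hP
  have hP0 : 0 ≤ P := by positivity
  have hbw : ∀ t, 2 ≤ t → ∀ s ∈ Icc 0 l, ‖w (s, t)‖ ^ 2 ≤ l * P * Real.exp (-c * t) := by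
    intro t ht s hs
    refine (hw.norm_sq_le_fieldEnergy hl.le hs (by linarith)).trans ?_
    rw [mul_assoc]
    gcongr
    refine (hdecay hw heq 1 t one_pos (by linarith)).trans ?_
    rw [hP, mul_assoc (C / c * _), ← Real.exp_add]
    gcongr
    · exact le_abs_self _
    · linarith
  have hev : ∀ᶠ h : ℝ in 𝓝[>] 0, 0 < h ∧ h ≤ 1 :=
    inter_mem self_mem_nhdsWithin (mem_nhdsWithin_of_mem_nhds (Iic_mem_nhds one_pos))
  have hbt : ∀ t, 2 ≤ t → ∀ s ∈ Icc 0 l, ‖wt (s, t)‖ ^ 2 ≤ l * Q' * Real.exp (-c * t) := by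
    intro t ht s hs
    refine le_of_tendsto ((tendsto_timeQuot (hw.dt s hs t (by linarith))).norm.pow 2) ?_
    filter_upwards [hev] with h hh
    refine ((hw.timeQuot hh.1).norm_sq_le_fieldEnergy hl.le hs (by linarith)).trans ?_
    rw [mul_assoc]
    gcongr
    exact hquot h hh.1 hh.2 t ht
  have hsqrt : ∀ {x y t : ℝ}, 0 ≤ y → x ^ 2 ≤ y * Real.exp (-c * t) →
      x ≤ Real.sqrt y * Real.exp (-(c / 2) * t) := by
    intro x y t hy hx
    refine (Real.le_sqrt_of_sq_le hx).trans (le_of_eq ?_)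
    rw [Real.sqrt_mul hy, Real.sqrt_eq_rpow (Real.exp _), ← Real.exp_mul]
    congr 2
    ring
  have hbw' := fun t ht s hs => hsqrt (by positivity) (hbw t ht s hs)
  have hbt' := fun t ht s hs => hsqrt (by positivity) (hbt t ht s hs)
  set Cw := Real.sqrt (l * P)
  set Ct := Real.sqrt (l * Q')
  have hbs : ∀ t, 2 ≤ t → ∀ s ∈ Icc 0 l, ‖ws (s, t)‖
      ≤ k0⁻¹ * (Ct + l * (|d1| * Ct + |k2| * Cw)) * Real.exp (-(c / 2) * t) := by
    intro t ht s hs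
    have ht0 : 0 < t := by linarith
    refine (hC.norm_le_of_lowK hs _).trans ?_
    rw [mul_assoc]
    gcongr
    have cK := hC.cK
    have cKp := hC.cKp
    have cD : Continuous D := hC.cKv.comp (g := fun z : ℝ × ℝ => D z.1)
      (f := fun s : ℝ => (s, (0:ℝ))) (by fun_prop)
    have hftc := integral_eq_sub_of_hasDerivAt_of_le hs.2 (f := fun x => K x (ws (x, t)))
      (f' := fun x => A (x, t)) (by fun_prop)
      (fun x hx => hw.dA t ht0 x ⟨hs.1.trans_lt hx.1, hx.2⟩)
      ((by fun_prop : Continuous fun x => A (x, t)).intervalIntegrable _ _)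
    simp only [hw.right t ht0, map_zero, zero_sub] at hftc
    have hsplit : ∫ x in s..l, A (x, t) = (∫ x in s..l, wtt (x, t))
        + ∫ x in s..l, (D x (wt (x, t)) + Kp x (w (x, t))) := by
      rw [← intervalIntegral.integral_add (Continuous.intervalIntegrable (by fun_prop) _ _)
        (Continuous.intervalIntegrable (by fun_prop) _ _)]
      refine integral_congr fun x hx => ?_
      rw [uIcc_of_le hs.2] at hx
      simp only [heq x ⟨hs.1.trans hx.1, hx.2⟩ t ht0]
      abel
    have hb2 : ‖∫ x in s..l, (D x (wt (x, t)) + Kp x (w (x, t)))‖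
        ≤ l * (|d1| * Ct + |k2| * Cw) * Real.exp (-(c / 2) * t) := by
      have := norm_integral_le_of_norm_le_const (a := s) (b := l)
        (C := (|d1| * Ct + |k2| * Cw) * Real.exp (-(c / 2) * t))
        (f := fun x => D x (wt (x, t)) + Kp x (w (x, t))) fun x hx => by
          rw [uIoc_of_le hs.2] at hx
          have hx' : x ∈ Icc 0 l := ⟨hs.1.trans hx.1.le, hx.2⟩
          have b1 := (hC.upKv x hx' t ht0 (wt (x, t))).trans
            (mul_le_mul_of_nonneg_right (le_abs_self d1) (norm_nonneg _))
          have b2 := (hC.upKp x hx' (w (x, t))).trans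
            (mul_le_mul_of_nonneg_right (le_abs_self k2) (norm_nonneg _))
          have b3 : |d1| * ‖wt (x, t)‖ ≤ |d1| * (Ct * Real.exp (-(c / 2) * t)) := by
            gcongr; exact hbt' t ht x hx'
          have b4 : |k2| * ‖w (x, t)‖ ≤ |k2| * (Cw * Real.exp (-(c / 2) * t)) := by
            gcongr; exact hbw' t ht x hx'
          have b5 := norm_add_le (D x (wt (x, t))) (Kp x (w (x, t)))
          linarith
      refine this.trans ?_
      rw [mul_comm, ← mul_assoc]
      gcongr
      rw [abs_of_nonneg (by linarith [hs.2])]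
      linarith [hs.1]
    have hb1 : ‖∫ x in s..l, wtt (x, t)‖ ≤ Ct * Real.exp (-(c / 2) * t) := by
      refine hsqrt (by positivity) ?_
      have hder : HasDerivAt (fun τ => ∫ x in s..l, wt (x, τ)) (∫ x in s..l, wtt (x, t)) t := by
        refine hasDerivAt_integral_of_continuous cwt cwtt hs.2 ht0 fun x hx τ hτ => ?_
        rw [abs_lt] at hτ
        exact hw.dtt x ⟨hs.1.trans hx.1, hx.2⟩ τ (by linarith)
      have hlim := hder.tendsto_slope_zero.mono_left
        (nhdsWithin_mono _ fun _ (hx : _ ∈ Ioi (0:ℝ)) => ne_of_gt hx)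
      refine le_of_tendsto (hlim.norm.pow 2) ?_
      filter_upwards [hev] with h hh
      have hz := hw.timeQuot hh.1
      have e : h⁻¹ • ((∫ x in s..l, wt (x, t + h)) - ∫ x in s..l, wt (x, t))
          = ∫ x in s..l, timeQuot h wt (x, t) := by
        simp only [timeQuot]
        rw [intervalIntegral.integral_smul, intervalIntegral.integral_sub
          (Continuous.intervalIntegrable (by fun_prop) _ _)
          (Continuous.intervalIntegrable (by fun_prop) _ _)]
      rw [e]
      have cz := hz.cwt
      have hc2 : Continuous fun x => ‖timeQuot h wt (x, t)‖ := by fun_prop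
      have hsq : ‖∫ x in s..l, timeQuot h wt (x, t)‖ ^ 2
          ≤ (l - s) * ∫ x in s..l, ‖timeQuot h wt (x, t)‖ ^ 2 :=
        le_trans (by gcongr; exact norm_integral_le_integral_norm hs.2) (sq_integral_le hs.2 hc2)
      have hi : ∀ x y, IntervalIntegrable (fun x => ‖timeQuot h wt (x, t)‖ ^ 2) volume x y :=
        fun x y => (hc2.pow 2).intervalIntegrable _ _
      have hmono : ∫ x in s..l, ‖timeQuot h wt (x, t)‖ ^ 2
          ≤ ∫ x in (0:ℝ)..l, ‖timeQuot h wt (x, t)‖ ^ 2 := by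
        rw [← integral_add_adjacent_intervals (hi 0 s) (hi s l)]
        have : 0 ≤ ∫ x in (0:ℝ)..s, ‖timeQuot h wt (x, t)‖ ^ 2 :=
          integral_nonneg hs.1 fun _ _ => sq_nonneg _
        linarith
      have h0 : 0 ≤ ∫ x in s..l, ‖timeQuot h wt (x, t)‖ ^ 2 :=
        integral_nonneg hs.2 fun _ _ => sq_nonneg _
      calc _ ≤ _ := hsq
        _ ≤ l * ∫ x in s..l, ‖timeQuot h wt (x, t)‖ ^ 2 := by gcongr; linarith [hs.1]
        _ ≤ l * (Q' * Real.exp (-c * t)) := by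
          gcongr
          exact hmono.trans ((hz.integral_wt_sq_le_fieldEnergy hl.le t).trans
            (hquot h hh.1 hh.2 t ht))
        _ = _ := by ring
    have : ‖K s (ws (s, t))‖ = ‖∫ x in s..l, A (x, t)‖ := by rw [hftc, norm_neg]
    rw [this, hsplit]
    refine (norm_add_le _ _).trans ?_
    linarith
  set Cs := k0⁻¹ * (Ct + l * (|d1| * Ct + |k2| * Cw))
  have hCs : 0 ≤ Cs := by positivity
  have hCt : 0 ≤ Ct := Real.sqrt_nonneg _
  have hCw : 0 ≤ Cw := Real.sqrt_nonneg _
  refine ⟨Cw + Ct + Cs + 1, by positivity, c / 2, by positivity, fun t ht s hs => ⟨?_, ?_, ?_⟩⟩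
  · exact (hbw' t ht s hs).trans (by gcongr; linarith)
  · exact (hbt' t ht s hs).trans (by gcongr; linarith)
  · exact (hbs t ht s hs).trans (by gcongr; linarith)

end Wave

section Scalar

theorem sub_le_integral_of_deriv_le {L L' φ : ℝ → ℝ} {a b : ℝ} (hab : a ≤ b)
    (hL : ∀ t ∈ Icc a b, HasDerivAt L (L' t) t) (hφ : Continuous φ)
    (h : ∀ t ∈ Icc a b, L' t ≤ φ t) : L b - L a ≤ ∫ t in a..b, φ t :=
  sub_le_integral_of_hasDeriv_right_of_le hab
    (fun t ht => (hL t ht).continuousAt.continuousWithinAt)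
    (fun t ht => (hL t (Ioo_subset_Icc_self ht)).hasDerivWithinAt)
    hφ.continuousOn.integrableOn_Icc (fun t ht => h t (Ioo_subset_Icc_self ht))

theorem integral_exp_neg_le {μ a b : ℝ} (hμ : 0 < μ) :
    ∫ t in a..b, Real.exp (-μ * t) ≤ Real.exp (-μ * a) / μ := by
  have h : ∀ t ∈ uIcc a b,
      HasDerivAt (fun t => -(Real.exp (-μ * t) / μ)) (Real.exp (-μ * t)) t := by
    intro t _
    have h1 : HasDerivAt (fun t => -μ * t) (-μ) t := by
      simpa using (hasDerivAt_id t).const_mul (-μ)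
    exact ((h1.exp).div_const μ).neg.congr_deriv
      (by rw [mul_neg, neg_div, neg_neg, mul_div_cancel_right₀ _ hμ.ne'])
  rw [integral_eq_sub_of_hasDerivAt h (Continuous.intervalIntegrable (by fun_prop) _ _)]
  have : 0 < Real.exp (-μ * b) / μ := by positivity
  linarith

/-- An exponentially small forcing by a quantity `N` whose weighted time integral is controlled on
a slightly longer window does not destroy exponential decay. -/
theorem exp_decay_of_window {L L' N : ℝ → ℝ} {c C0 μ C1 : ℝ} (hc : 0 < c) (hμ : 0 < μ)
    (hC0 : 0 ≤ C0) (hC1 : 0 ≤ C1) (hNc : Continuous N) (hN : ∀ t, 0 ≤ N t)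
    (hLc : Continuous L)
    (hL0 : ∀ t, 1 ≤ t → 0 ≤ L t) (hL : ∀ t, 1 ≤ t → HasDerivAt L (L' t) t)
    (hL' : ∀ t, 1 ≤ t → L' t ≤ -c * L t + C0 * Real.exp (-(2 * μ) * t) * (1 + N t + L t))
    (hwin : ∀ T ρ M : ℝ, 1 ≤ T → 0 < ρ → ρ ≤ 1 → 1 ≤ M →
      (∀ t ∈ Icc 1 (T + 2 * ρ), 1 + L t ≤ M) →
      ∫ t in (1:ℝ)..T, Real.exp (-μ * t) * N t ≤ C1 * (M + 1 / ρ ^ 2)) :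
    ∃ C > 0, ∃ lam > 0, ∀ t, 1 ≤ t → L t ≤ C * Real.exp (-lam * t) := by
  have hee : ∀ t : ℝ, Real.exp (-(2 * μ) * t) = Real.exp (-μ * t) * Real.exp (-μ * t) := by
    intro t; rw [← Real.exp_add]; ring_nf
  -- choice of the starting time
  obtain ⟨a, ha1, haε⟩ : ∃ a : ℝ, 1 ≤ a ∧ Real.exp (-μ * a) * (C0 * (1 / μ + C1)) ≤ 1 / 8 := by
    have ht : Tendsto (fun a : ℝ => Real.exp (-μ * a) * (C0 * (1 / μ + C1))) atTop (𝓝 0) := by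
      have h1 : Tendsto (fun a : ℝ => -μ * a) atTop atBot :=
        tendsto_id.const_mul_atTop_of_neg (by linarith)
      simpa using (Real.tendsto_exp_atBot.comp h1).mul_const (C0 * (1 / μ + C1))
    have := (ht.eventually_le_const (by norm_num : (0:ℝ) < 1 / 8)).and (eventually_ge_atTop 1)
    obtain ⟨a, ha⟩ := this.exists
    exact ⟨a, ha.2, ha.1⟩
  obtain ⟨K, hK⟩ := (isCompact_Icc (a := (1:ℝ)) (b := a)).exists_bound_of_continuousOn
    hLc.continuousOn
  have hK0 : 0 ≤ K := (norm_nonneg _).trans (hK 1 ⟨le_rfl, ha1⟩)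
  have step : ∀ T ρ M : ℝ, a ≤ T → 0 < ρ → ρ ≤ 1 → 1 ≤ M →
      (∀ t ∈ Icc 1 (T + 2 * ρ), 1 + L t ≤ M) →
      ∀ t ∈ Icc 1 T, 1 + L t ≤ 1 + K + 1 / 8 * (M + 1 / ρ ^ 2) := by
    intro T ρ M hT hρ hρ1 hM hb t ht
    have hnn : 0 ≤ 1 / 8 * (M + 1 / ρ ^ 2) := by positivity
    rcases le_total t a with hta | hta
    · have := hK t ⟨ht.1, hta⟩
      rw [Real.norm_eq_abs] at this
      linarith [le_abs_self (L t)]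
    have h1 := sub_le_integral_of_deriv_le (L := L) (L' := L')
      (φ := fun t => Real.exp (-μ * a) * (C0 * (M * Real.exp (-μ * t) + Real.exp (-μ * t) * N t)))
      hta (fun x hx => hL x (ha1.trans hx.1)) (by fun_prop) (by
        intro x hx
        have hx1 : 1 ≤ x := ha1.trans hx.1
        have hbx := hb x ⟨hx1, by linarith [hx.2, ht.2]⟩
        have := hL' x hx1
        have h2 : 0 ≤ c * L x := mul_nonneg hc.le (hL0 x hx1)
        have h3 : Real.exp (-μ * x) ≤ Real.exp (-μ * a) :=
          Real.exp_le_exp.2 (by nlinarith [hx.1])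
        rw [hee] at this
        have h4 : C0 * (Real.exp (-μ * x) * Real.exp (-μ * x)) * (1 + N x + L x)
            ≤ C0 * (Real.exp (-μ * a) * Real.exp (-μ * x)) * (M + N x) := by
          have := hN x; have := hL0 x hx1
          have : 1 + N x + L x ≤ M + N x := by linarith
          gcongr
        calc L' x ≤ _ := this
          _ ≤ C0 * (Real.exp (-μ * x) * Real.exp (-μ * x)) * (1 + N x + L x) := by linarith
          _ ≤ _ := h4
          _ = _ := by ring)
    have h5 : ∫ t in a..t, Real.exp (-μ * t) * N t ≤ C1 * (M + 1 / ρ ^ 2) := by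
      refine le_trans ?_ (hwin T ρ M (ha1.trans hT) hρ hρ1 hM hb)
      refine integral_mono_interval ha1 hta ht.2 ?_
        (Continuous.intervalIntegrable (by fun_prop) _ _)
      exact Eventually.of_forall fun x => mul_nonneg (Real.exp_pos _).le (hN x)
    have h6 : ∫ t in a..t, Real.exp (-μ * t) ≤ 1 / μ :=
      (integral_exp_neg_le hμ).trans (by
        gcongr
        exact Real.exp_le_one_iff.2 (by nlinarith))
    rw [intervalIntegral.integral_const_mul, intervalIntegral.integral_const_mul,
      intervalIntegral.integral_add (Continuous.intervalIntegrable (by fun_prop) _ _)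
        (Continuous.intervalIntegrable (by fun_prop) _ _),
      intervalIntegral.integral_const_mul] at h1
    have h7 : Real.exp (-μ * a) * (C0 * (M * (∫ t in a..t, Real.exp (-μ * t))
          + ∫ t in a..t, Real.exp (-μ * t) * N t))
        ≤ Real.exp (-μ * a) * (C0 * ((M + 1 / ρ ^ 2) * (1 / μ) + C1 * (M + 1 / ρ ^ 2))) := by
      have : M ≤ M + 1 / ρ ^ 2 := le_add_of_nonneg_right (by positivity)
      have h8 : M * (∫ t in a..t, Real.exp (-μ * t)) ≤ (M + 1 / ρ ^ 2) * (1 / μ) :=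
        (mul_le_mul_of_nonneg_left h6 (by linarith)).trans
          (mul_le_mul_of_nonneg_right this (by positivity))
      gcongr
    have h9 := mul_le_mul_of_nonneg_right haε (by positivity : 0 ≤ M + 1 / ρ ^ 2)
    have h10 := hK a ⟨ha1, le_rfl⟩
    rw [Real.norm_eq_abs] at h10
    have h11 := le_abs_self (L a)
    have h12 : Real.exp (-μ * a) * (C0 * ((M + 1 / ρ ^ 2) * (1 / μ) + C1 * (M + 1 / ρ ^ 2)))
      = Real.exp (-μ * a) * (C0 * (1 / μ + C1)) * (M + 1 / ρ ^ 2) := by ring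
    linarith
  -- uniform bound
  set M0 : ℝ := 4 * (1 + K) with hM0
  have hM01 : 1 ≤ M0 := by linarith
  have hbdd : ∀ t, 1 ≤ t → 1 + L t ≤ M0 := by
    intro t ht
    set T0 := max t a with hT0
    obtain ⟨B, hB⟩ := (isCompact_Icc (a := (1:ℝ)) (b := T0 + 4)).exists_bound_of_continuousOn
      hLc.continuousOn
    obtain ⟨n, hn⟩ := pow_unbounded_of_one_lt (1 + B) (by norm_num : (1:ℝ) < 4)
    have desc : ∀ j ≤ n, ∀ x ∈ Icc 1 (T0 + 4 - 4 * (1 / 2) ^ (n - j)),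
        1 + L x ≤ M0 * 4 ^ (n - j) := by
      intro j
      induction j with
      | zero =>
        intro _ x hx
        have h2 : (0:ℝ) < 4 * (1 / 2) ^ (n - 0) := by positivity
        have := hB x ⟨hx.1, by linarith [hx.2]⟩
        rw [Real.norm_eq_abs] at this
        have h3 := le_abs_self (L x)
        have h4 : (0:ℝ) < 4 ^ n := by positivity
        simp only [Nat.sub_zero]
        nlinarith
      | succ j ih =>
        intro hj x hx
        have hj' := ih (by omega)
        obtain ⟨m, hm⟩ : ∃ m, n - j = m + 1 := ⟨n - j - 1, by omega⟩
        have hm' : n - (j + 1) = m := by omega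
        rw [hm] at hj'
        rw [hm'] at hx ⊢
        have hp : (0:ℝ) < (1 / 2) ^ m := by positivity
        have hp1 : ((1:ℝ) / 2) ^ m ≤ 1 := pow_le_one₀ (by norm_num) (by norm_num)
        have h41 : (1:ℝ) ≤ 4 ^ m := one_le_pow₀ (by norm_num)
        have h42 : 1 / ((1:ℝ) / 2 ^ m) ^ 2 = 4 ^ m := by
          rw [_root_.one_div_pow, one_div_one_div, ← pow_mul, mul_comm, pow_mul]; norm_num
        have key := step (T0 + 4 - 4 * (1 / 2) ^ m) ((1 / 2) ^ m) (M0 * 4 ^ (m + 1))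
          (by have := le_max_right t a; rw [← hT0] at this; nlinarith) hp hp1
          (by rw [pow_succ]; nlinarith) (by
            intro y hy
            exact hj' y ⟨hy.1, hy.2.trans (by rw [pow_succ]; linarith)⟩) x hx
        rw [_root_.one_div_pow, h42, pow_succ] at key
        have : M0 ≤ M0 * 4 ^ m := le_mul_of_one_le_right (by linarith) h41
        have : (4:ℝ) ^ m ≤ M0 * 4 ^ m := le_mul_of_one_le_left (by linarith) hM01
        nlinarith
    have := desc n le_rfl t ⟨ht, by simp; exact le_max_left _ _⟩
    simpa using this
  -- decay
  set c' := min c μ with hc'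
  have hc'0 : 0 < c' := lt_min hc hμ
  refine ⟨Real.exp c' * L 1 + C0 * (M0 / μ + C1 * (M0 + 1)) + 1, ?_, c', hc'0, ?_⟩
  · have := hL0 1 le_rfl; positivity
  intro t ht
  have h1 := sub_le_integral_of_deriv_le (L := fun t => Real.exp (c' * t) * L t)
    (L' := fun t => Real.exp (c' * t) * (c' * 1) * L t + Real.exp (c' * t) * L' t)
    (φ := fun t => C0 * (M0 * Real.exp (-μ * t) + Real.exp (-μ * t) * N t)) ht
    (fun x hx => (((hasDerivAt_id x).const_mul c').exp).mul (hL x hx.1)) (by fun_prop) (by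
      intro x hx
      have h2 := mul_le_mul_of_nonneg_left (hL' x hx.1) (Real.exp_pos (c' * x)).le
      have h3 : Real.exp (c' * x) * (c' * L x) ≤ Real.exp (c' * x) * (c * L x) := by
        have := hL0 x hx.1
        gcongr
        exact min_le_left _ _
      have h4 : Real.exp (c' * x) * Real.exp (-(2 * μ) * x) ≤ Real.exp (-μ * x) := by
        rw [← Real.exp_add, Real.exp_le_exp]
        have : c' ≤ μ := min_le_right _ _
        nlinarith [hx.1]
      have h5 : Real.exp (c' * x) * Real.exp (-(2 * μ) * x) * (C0 * (1 + N x + L x))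
          ≤ Real.exp (-μ * x) * (C0 * (M0 + N x)) := by
        have := hN x; have := hL0 x hx.1; have := hbdd x hx.1
        gcongr ?_ * (C0 * ?_)
        linarith
      have e1 : Real.exp (c' * x) * (-c * L x + C0 * Real.exp (-(2 * μ) * x) * (1 + N x + L x))
        = -(Real.exp (c' * x) * (c * L x))
          + Real.exp (c' * x) * Real.exp (-(2 * μ) * x) * (C0 * (1 + N x + L x)) := by ring
      rw [e1] at h2
      calc _ = Real.exp (c' * x) * (c' * L x) + Real.exp (c' * x) * L' x := by ring
        _ ≤ Real.exp (-μ * x) * (C0 * (M0 + N x)) := by linarith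
        _ = _ := by ring)
  have h2 := hwin t 1 M0 ht one_pos le_rfl hM01 fun x hx => hbdd x hx.1
  rw [intervalIntegral.integral_const_mul,
    intervalIntegral.integral_add (Continuous.intervalIntegrable (by fun_prop) _ _)
      (Continuous.intervalIntegrable (by fun_prop) _ _),
    intervalIntegral.integral_const_mul] at h1
  have h3 : ∫ t in (1:ℝ)..t, Real.exp (-μ * t) ≤ 1 / μ :=
    (integral_exp_neg_le hμ).trans (by
      gcongr
      exact Real.exp_le_one_iff.2 (by nlinarith))
  have h4 : C0 * (M0 * (∫ t in (1:ℝ)..t, Real.exp (-μ * t))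
      + ∫ t in (1:ℝ)..t, Real.exp (-μ * t) * N t) ≤ C0 * (M0 / μ + C1 * (M0 + 1)) := by
    have : M0 * (∫ t in (1:ℝ)..t, Real.exp (-μ * t)) ≤ M0 / μ := by
      rw [div_eq_mul_one_div]; gcongr
    rw [one_pow, div_one] at h2
    gcongr
  have h5 : Real.exp (c' * t) * L t
      ≤ Real.exp c' * L 1 + C0 * (M0 / μ + C1 * (M0 + 1)) + 1 := by
    simp only [mul_one] at h1
    linarith
  have h6 : L t = Real.exp (c' * t) * L t * Real.exp (-c' * t) := by
    rw [mul_right_comm, ← Real.exp_add]; simp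
  rw [h6]
  gcongr

end Scalar

section Window

/-- A weighted bound for the time integral of `q` from a function of two times whose pure second
derivatives dominate `q` on the diagonal. -/
theorem integral_le_of_diag {a a1 a2 a11 a22 : ℝ × ℝ → ℝ} (hac : Continuous a)
    (h1c : Continuous a1) (h2c : Continuous a2) (h11c : Continuous a11) (h22c : Continuous a22)
    (h1 : ∀ x y, 0 < x → 0 < y → HasDerivAt (fun x => a (x, y)) (a1 (x, y)) x)
    (h2 : ∀ x y, 0 < x → 0 < y → HasDerivAt (fun y => a (x, y)) (a2 (x, y)) y)
    (h11 : ∀ x y, 0 < x → 0 < y → HasDerivAt (fun x => a1 (x, y)) (a11 (x, y)) x)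
    (h22 : ∀ x y, 0 < x → 0 < y → HasDerivAt (fun y => a2 (x, y)) (a22 (x, y)) y)
    {q R : ℝ → ℝ} (hq : Continuous q) (hR : Continuous R) (hq0 : ∀ t, 1 ≤ t → 0 ≤ q t)
    (hR0 : ∀ t, 1 ≤ t → 0 ≤ R t) {μ C M T ρ : ℝ} (hμ : 0 < μ) (hC : 0 ≤ C) (hM : 1 ≤ M)
    (hT : 1 ≤ T) (hρ : 0 < ρ)
    (b11 : ∀ t ∈ Icc 1 (T + ρ), 2 * q t ≤ -a11 (t, t) + C * M + R t)
    (b22 : ∀ t ∈ Icc 1 (T + ρ), |a22 (t, t)| ≤ q t + C * M)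
    (b2 : ∀ t ∈ Icc 1 (T + ρ), |a2 (t, t)| ≤ C * M)
    (b0 : ∀ t ∈ Icc 1 (T + ρ), a (t, t) ^ 2 ≤ C * M)
    (b1 : |a1 (1, 1)| ≤ C) :
    ∫ t in (1:ℝ)..T, Real.exp (-μ * t) * q t
      ≤ ((2 * C + 2 * μ * C + μ ^ 2 * (1 + C)) / μ + 1 + 5 * C + 2 * μ * (1 + C))
          * (M + 1 / ρ ^ 2) + ∫ t in (1:ℝ)..(T + ρ), Real.exp (-μ * t) * R t := by
  have hd : ∀ t, 0 < t → HasDerivAt (fun t => a (t, t)) (a1 (t, t) + a2 (t, t)) t := by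
    intro t ht
    simpa using hasDerivAt_diag (h := 0) h1c h2c h1 h2 ht (by simpa using ht)
  obtain ⟨τ, hτ, hτd⟩ := exists_hasDerivAt_eq_slope (fun t => a (t, t))
    (fun t => a1 (t, t) + a2 (t, t)) (by linarith : T < T + ρ) (by fun_prop)
    (fun t ht => hd t (by linarith [ht.1]))
  have hT1 : 1 ≤ τ := hT.trans hτ.1.le
  have habs : ∀ t ∈ Icc 1 (T + ρ), |a (t, t)| ≤ (1 + C) * M := fun t ht => by
    have := b0 t ht
    rw [← sq_abs] at this
    nlinarith [sq_nonneg (|a (t, t)| - 1), abs_nonneg (a (t, t))]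
  have hadiv : ∀ t ∈ Icc 1 (T + ρ), |a (t, t)| / ρ ≤ (1 / ρ ^ 2 + C * M) / 2 := fun t ht => by
    have h := b0 t ht
    have h' : |a (t, t)| / ρ = |a (t, t)| * (1 / ρ) := by ring
    have h'' : (1:ℝ) / ρ ^ 2 = (1 / ρ) ^ 2 := by rw [_root_.one_div_pow]
    rw [← sq_abs] at h
    rw [h', h'']
    nlinarith [sq_nonneg (|a (t, t)| - 1 / ρ)]
  -- the weighted function of two times
  have he : ∀ y : ℝ, HasDerivAt (fun y => Real.exp (-μ * y)) (Real.exp (-μ * y) * (-μ)) y := by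
    intro y
    simpa using (((hasDerivAt_id y).const_mul (-μ)).exp)
  have key := integral_diag_second_sub
    (a := fun z => a z * Real.exp (-μ * z.2)) (a1 := fun z => a1 z * Real.exp (-μ * z.2))
    (a2 := fun z => a2 z * Real.exp (-μ * z.2) + a z * (Real.exp (-μ * z.2) * (-μ)))
    (a11 := fun z => a11 z * Real.exp (-μ * z.2))
    (a22 := fun z => (a22 z * Real.exp (-μ * z.2) + a2 z * (Real.exp (-μ * z.2) * (-μ)))
      + (a2 z * (Real.exp (-μ * z.2) * (-μ)) + a z * (Real.exp (-μ * z.2) * (-μ) * (-μ))))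
    (by fun_prop) (by fun_prop) (by fun_prop) (by fun_prop) (c := 0)
    (fun x y hx hy => (h1 x y hx hy).mul_const (Real.exp (-μ * y)))
    (fun x y hx hy => (h2 x y hx hy).mul (he y))
    (fun x y hx hy => (h11 x y hx hy).mul_const (Real.exp (-μ * y)))
    (fun x y hx hy => ((h22 x y hx hy).mul (he y)).add
      ((h2 x y hx hy).mul ((he y).mul_const (-μ))))
    one_pos hT1
  simp only at key
  have h_int : ∀ f : ℝ → ℝ, Continuous f → ∀ x y, IntervalIntegrable f volume x y :=
    fun f hf x y => hf.intervalIntegrable x y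
  set D : ℝ := 2 * C * M + 2 * μ * C * M + μ ^ 2 * ((1 + C) * M) with hD
  have hle : ∫ t in (1:ℝ)..τ, Real.exp (-μ * t) * q t
      ≤ ∫ t in (1:ℝ)..τ, (Real.exp (-μ * t) * R t + D * Real.exp (-μ * t)
        - (a11 (t, t) * Real.exp (-μ * t)
          - ((a22 (t, t) * Real.exp (-μ * t) + a2 (t, t) * (Real.exp (-μ * t) * (-μ)))
      + (a2 (t, t) * (Real.exp (-μ * t) * (-μ))
        + a (t, t) * (Real.exp (-μ * t) * (-μ) * (-μ)))))) := by
    refine integral_mono_continuous hT1 (by fun_prop) (by fun_prop) fun t ht => ?_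
    have ht' : t ∈ Icc 1 (T + ρ) := ⟨ht.1, ht.2.trans hτ.2.le⟩
    have e1 := b11 t ht'
    have e2 := (abs_le.1 (b22 t ht')).2
    have e3 := (abs_le.1 (b2 t ht'))
    have e4 := (abs_le.1 (habs t ht'))
    have e2' := (abs_le.1 (b22 t ht')).1
    have e5 : q t ≤ R t + D - (a11 (t, t) - (a22 (t, t) - 2 * μ * a2 (t, t)
        + μ ^ 2 * a (t, t))) := by
      have f3 : μ * (2 * a2 (t, t)) ≤ μ * (2 * (C * M)) :=
        mul_le_mul_of_nonneg_left (by linarith) hμ.le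
      have f4 : μ ^ 2 * -a (t, t) ≤ μ ^ 2 * ((1 + C) * M) :=
        mul_le_mul_of_nonneg_left (by linarith) (by positivity)
      rw [hD]
      linarith
    have := mul_le_mul_of_nonneg_left e5 (Real.exp_pos (-μ * t)).le
    calc _ ≤ _ := this
      _ = _ := by ring
  rw [intervalIntegral.integral_sub (h_int _ (by fun_prop) _ _) (h_int _ (by fun_prop) _ _), key,
    intervalIntegral.integral_add (h_int _ (by fun_prop) _ _) (h_int _ (by fun_prop) _ _),
    intervalIntegral.integral_const_mul] at hle
  have hexp1 : ∀ t : ℝ, 1 ≤ t → Real.exp (-μ * t) ≤ 1 := fun t ht =>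
    Real.exp_le_one_iff.2 (by nlinarith)
  have hχ : ∫ t in (1:ℝ)..τ, Real.exp (-μ * t) ≤ 1 / μ :=
    (integral_exp_neg_le hμ).trans (by
      have := hexp1 1 le_rfl
      gcongr)
  have hqm : ∫ t in (1:ℝ)..T, Real.exp (-μ * t) * q t
      ≤ ∫ t in (1:ℝ)..τ, Real.exp (-μ * t) * q t := by
    rw [← integral_add_adjacent_intervals (h_int _ (by fun_prop) 1 T) (h_int _ (by fun_prop) T τ)]
    have : 0 ≤ ∫ t in T..τ, Real.exp (-μ * t) * q t := integral_nonneg hτ.1.le fun x hx =>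
      mul_nonneg (Real.exp_pos _).le (hq0 x (hT.trans hx.1))
    linarith
  have hRm : ∫ t in (1:ℝ)..τ, Real.exp (-μ * t) * R t
      ≤ ∫ t in (1:ℝ)..(T + ρ), Real.exp (-μ * t) * R t := by
    rw [← integral_add_adjacent_intervals (h_int _ (by fun_prop) 1 τ)
      (h_int _ (by fun_prop) τ (T + ρ))]
    have : 0 ≤ ∫ t in τ..(T + ρ), Real.exp (-μ * t) * R t := integral_nonneg hτ.2.le fun x hx =>
      mul_nonneg (Real.exp_pos _).le (hR0 x (hT1.trans hx.1))
    linarith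
  have hτm : τ ∈ Icc 1 (T + ρ) := ⟨hT1, hτ.2.le⟩
  have h1m : (1:ℝ) ∈ Icc 1 (T + ρ) := ⟨le_rfl, by linarith⟩
  have hdiff : |a1 (τ, τ) + a2 (τ, τ)| ≤ 1 / ρ ^ 2 + C * M := by
    rw [hτd, show T + ρ - T = ρ by ring, abs_div, abs_of_pos hρ]
    have e1 := hadiv T ⟨hT, by linarith⟩
    have e2 := hadiv (T + ρ) ⟨by linarith, le_rfl⟩
    calc |a (T + ρ, T + ρ) - a (T, T)| / ρ
        ≤ (|a (T + ρ, T + ρ)| + |a (T, T)|) / ρ := by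
          gcongr
          exact abs_sub _ _
      _ = |a (T + ρ, T + ρ)| / ρ + |a (T, T)| / ρ := add_div _ _ _
      _ ≤ _ := by linarith
  have hbτ : -((a1 (τ, τ) - a2 (τ, τ) + μ * a (τ, τ)) * Real.exp (-μ * τ))
      ≤ 1 / ρ ^ 2 + 3 * C * M + μ * ((1 + C) * M) := by
    have g1 := abs_le.1 hdiff
    have g2 := abs_le.1 (b2 τ hτm)
    have g3 : μ * -a (τ, τ) ≤ μ * ((1 + C) * M) :=
      mul_le_mul_of_nonneg_left (by linarith [(abs_le.1 (habs τ hτm)).1]) hμ.le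
    have g4 : -(a1 (τ, τ) - a2 (τ, τ) + μ * a (τ, τ))
      ≤ 1 / ρ ^ 2 + 3 * C * M + μ * ((1 + C) * M) := by linarith
    have g5 : 0 ≤ 1 / ρ ^ 2 + 3 * C * M + μ * ((1 + C) * M) := by positivity
    rw [← neg_mul]
    calc _ ≤ (1 / ρ ^ 2 + 3 * C * M + μ * ((1 + C) * M)) * Real.exp (-μ * τ) := by gcongr
      _ ≤ _ := mul_le_of_le_one_right g5 (hexp1 τ hT1)
  have hb1 : (a1 (1, 1) - a2 (1, 1) + μ * a (1, 1)) * Real.exp (-μ * 1)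
      ≤ C + C * M + μ * ((1 + C) * M) := by
    have g1 := abs_le.1 b1
    have g2 := abs_le.1 (b2 1 h1m)
    have g3 : μ * a (1, 1) ≤ μ * ((1 + C) * M) :=
      mul_le_mul_of_nonneg_left (by linarith [(abs_le.1 (habs 1 h1m)).2]) hμ.le
    have g4 : (a1 (1, 1) - a2 (1, 1) + μ * a (1, 1)) ≤ C + C * M + μ * ((1 + C) * M) := by
      linarith
    have g5 : 0 ≤ C + C * M + μ * ((1 + C) * M) := by positivity
    calc _ ≤ (C + C * M + μ * ((1 + C) * M)) * Real.exp (-μ * 1) := by gcongr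
      _ ≤ _ := mul_le_of_le_one_right g5 (hexp1 1 le_rfl)
  have hDχ : D * ∫ t in (1:ℝ)..τ, Real.exp (-μ * t) ≤ D * (1 / μ) := by
    have : 0 ≤ D := by positivity
    gcongr
  have hCM : C ≤ C * M := le_mul_of_one_le_right hC hM
  have hfin : D * (1 / μ) + (1 / ρ ^ 2 + 3 * C * M + μ * ((1 + C) * M))
      + (C * M + C * M + μ * ((1 + C) * M))
      ≤ ((2 * C + 2 * μ * C + μ ^ 2 * (1 + C)) / μ + 1 + 5 * C + 2 * μ * (1 + C))
          * (M + 1 / ρ ^ 2) := by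
    have e1 : D * (1 / μ) = (2 * C + 2 * μ * C + μ ^ 2 * (1 + C)) / μ * M := by rw [hD]; ring
    have e2 : 0 ≤ ((2 * C + 2 * μ * C + μ ^ 2 * (1 + C)) / μ + 5 * C + 2 * μ * (1 + C))
      * (1 / ρ ^ 2) := by positivity
    rw [e1]
    linarith
  linarith

end Window

section Pairing

variable {H : Type*} [NormedAddCommGroup H] [InnerProductSpace ℝ H]

theorem continuous_integral_pair {f g : ℝ × ℝ → H} (hf : Continuous f) (hg : Continuous g)
    (a b : ℝ) : Continuous fun z : ℝ × ℝ => ∫ s in a..b, ⟪f (s, z.1), g (s, z.2)⟫ := by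
  refine continuous_parametric_intervalIntegral_of_continuous'
    (f := fun (z : ℝ × ℝ) s => ⟪f (s, z.1), g (s, z.2)⟫) ?_ a b
  exact (by fun_prop : Continuous fun w : (ℝ × ℝ) × ℝ => ⟪f (w.2, w.1.1), g (w.2, w.1.2)⟫)

theorem hasDerivAt_integral_inner_left {f f' : ℝ × ℝ → H} {g : ℝ → H} (hf : Continuous f)
    (hf' : Continuous f') (hg : Continuous g) {l t : ℝ} (hl : 0 ≤ l) (ht : 0 < t)
    (h : ∀ s ∈ Icc 0 l, ∀ t, 0 < t → HasDerivAt (fun x => f (s, x)) (f' (s, t)) t) :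
    HasDerivAt (fun x => ∫ s in (0:ℝ)..l, ⟪f (s, x), g s⟫)
      (∫ s in (0:ℝ)..l, ⟪f' (s, t), g s⟫) t := by
  refine hasDerivAt_integral_of_continuous (f := fun z => ⟪f z, g z.1⟫)
    (f' := fun z => ⟪f' z, g z.1⟫) (by fun_prop) (by fun_prop) hl ht fun s hs τ hτ => ?_
  have hτ0 : 0 < τ := by linarith [(abs_lt.1 hτ).1]
  simpa using (h s hs τ hτ0).inner ℝ (hasDerivAt_const τ (g s))

theorem hasDerivAt_integral_inner_right {g g' : ℝ × ℝ → H} {f : ℝ → H} (hg : Continuous g)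
    (hg' : Continuous g') (hf : Continuous f) {l t : ℝ} (hl : 0 ≤ l) (ht : 0 < t)
    (h : ∀ s ∈ Icc 0 l, ∀ t, 0 < t → HasDerivAt (fun x => g (s, x)) (g' (s, t)) t) :
    HasDerivAt (fun x => ∫ s in (0:ℝ)..l, ⟪f s, g (s, x)⟫)
      (∫ s in (0:ℝ)..l, ⟪f s, g' (s, t)⟫) t := by
  simp only [real_inner_comm _ (f _)]
  exact hasDerivAt_integral_inner_left hg hg' hf hl ht h

end Pairing

section Track

variable {H : Type*} [NormedAddCommGroup H] [InnerProductSpace ℝ H]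

theorem abs_integral_le_of_abs_le {f g : ℝ → ℝ} {a b : ℝ} (hab : a ≤ b) (hf : Continuous f)
    (hg : Continuous g) (h : ∀ s ∈ Icc a b, |f s| ≤ g s) :
    |∫ s in a..b, f s| ≤ ∫ s in a..b, g s :=
  (abs_integral_le_integral_abs hab).trans (integral_mono_continuous hab hf.abs hg h)

theorem abs_inner_le_of_pos {c : ℝ} (hc : 0 < c) (x y : H) :
    |⟪x, y⟫| ≤ (c * ‖x‖ ^ 2 + c⁻¹ * ‖y‖ ^ 2) / 2 := by
  have h1 := two_inner_le_of_pos hc x y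
  have h2 := two_inner_le_of_pos hc (-x) y
  rw [inner_neg_left, norm_neg] at h2
  rw [abs_le]
  constructor <;> linarith

theorem abs_integral_inner_le {f g : ℝ → H} {a b c : ℝ} (hab : a ≤ b) (hc : 0 < c)
    (hf : Continuous f) (hg : Continuous g) :
    |∫ s in a..b, ⟪f s, g s⟫|
      ≤ (c * (∫ s in a..b, ‖f s‖ ^ 2) + c⁻¹ * ∫ s in a..b, ‖g s‖ ^ 2) / 2 := by
  refine (abs_integral_le_of_abs_le hab (by fun_prop) (by fun_prop)
    (g := fun s => (c * ‖f s‖ ^ 2 + c⁻¹ * ‖g s‖ ^ 2) / 2)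
    (fun s _ => abs_inner_le_of_pos hc _ _)).trans_eq ?_
  rw [intervalIntegral.integral_div, intervalIntegral.integral_add,
    intervalIntegral.integral_const_mul, intervalIntegral.integral_const_mul]
  all_goals exact Continuous.intervalIntegrable (by fun_prop) _ _

/-- A tracking error `u` and a reference `v`, both clamped at `s = 0`, such that `v` has bounded
first and second space derivatives and `v_tt` is, up to terms of order of the energy of `u`, a
coercive multiple of `-u_ss`. -/
structure TrackField (l B c0 C0 : ℝ) (u us uss ut utt v vs vss vt vtt : ℝ × ℝ → H) : Prop where
  wave : WaveField l (fun _ => ContinuousLinearMap.id ℝ H) u us ut utt uss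
  l_pos : 0 < l
  B_nonneg : 0 ≤ B
  c0_pos : 0 < c0
  C0_pos : 0 < C0
  cv : Continuous v
  cvs : Continuous vs
  cvss : Continuous vss
  cvt : Continuous vt
  cvtt : Continuous vtt
  dt : ∀ s ∈ Icc 0 l, ∀ t, 0 < t → HasDerivAt (fun x => v (s, x)) (vt (s, t)) t
  dtt : ∀ s ∈ Icc 0 l, ∀ t, 0 < t → HasDerivAt (fun x => vt (s, x)) (vtt (s, t)) t
  ds : ∀ t, 0 < t → ∀ s ∈ Ioo 0 l, HasDerivAt (fun x => v (x, t)) (vs (s, t)) s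
  dss : ∀ t, 0 < t → ∀ s ∈ Ioo 0 l, HasDerivAt (fun x => vs (x, t)) (vss (s, t)) s
  left : ∀ t, 0 < t → v (0, t) = 0
  vs_le : ∀ t, 0 < t → ∀ s ∈ Icc 0 l, ‖vs (s, t)‖ ≤ B
  vss_le : ∀ t, 0 < t → ∀ s ∈ Icc 0 l, ‖vss (s, t)‖ ≤ B
  coer : ∀ t, 0 < t → ∀ s ∈ Icc 0 l, c0 * ‖uss (s, t)‖ ^ 2 ≤ -⟪vtt (s, t), uss (s, t)⟫
    + C0 * (1 + (‖u (s, t)‖ ^ 2 + ‖us (s, t)‖ ^ 2 + ‖ut (s, t)‖ ^ 2))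
  vtt_le : ∀ t, 0 < t → ∀ s ∈ Icc 0 l, ‖vtt (s, t)‖ ^ 2 ≤ C0 * (1 + ‖uss (s, t)‖ ^ 2
    + (‖u (s, t)‖ ^ 2 + ‖us (s, t)‖ ^ 2 + ‖ut (s, t)‖ ^ 2))
  utt_le : ∀ t, 0 < t → ∀ s ∈ Icc 0 l, ‖utt (s, t)‖ ^ 2 ≤ C0 * (1 + ‖uss (s, t)‖ ^ 2
    + (‖u (s, t)‖ ^ 2 + ‖us (s, t)‖ ^ 2 + ‖ut (s, t)‖ ^ 2))

namespace TrackField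

variable {l B c0 C0 : ℝ} {u us uss ut utt v vs vss vt vtt : ℝ × ℝ → H}

theorem integral_weight_le (h : TrackField l B c0 C0 u us uss ut utt v vs vss vt vtt)
    {f : ℝ × ℝ → H} (hf : Continuous f) {ω : ℝ → ℝ} (hω : Continuous ω) {W : ℝ}
    (hω0 : ∀ s ∈ Icc 0 l, 0 ≤ ω s) (hωW : ∀ s ∈ Icc 0 l, ω s ≤ W) {t : ℝ}
    (hfle : ∀ s ∈ Icc 0 l, ‖f (s, t)‖ ^ 2 ≤ C0 * (1 + ‖uss (s, t)‖ ^ 2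
      + (‖u (s, t)‖ ^ 2 + ‖us (s, t)‖ ^ 2 + ‖ut (s, t)‖ ^ 2))) :
    ∫ s in (0:ℝ)..l, ω s * ‖f (s, t)‖ ^ 2
      ≤ C0 * (∫ s in (0:ℝ)..l, ω s * ‖uss (s, t)‖ ^ 2)
        + C0 * W * (l + fieldEnergy l u us ut t) := by
  have cu := h.wave.cw; have cus := h.wave.cws; have cut := h.wave.cwt; have cuss := h.wave.cA
  have hC0 := h.C0_pos
  have : ∫ s in (0:ℝ)..l, ω s * ‖f (s, t)‖ ^ 2
      ≤ ∫ s in (0:ℝ)..l, (C0 * (ω s * ‖uss (s, t)‖ ^ 2) + (C0 * W + C0 * W *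
        (‖u (s, t)‖ ^ 2 + ‖us (s, t)‖ ^ 2 + ‖ut (s, t)‖ ^ 2))) := by
    refine integral_mono_continuous h.l_pos.le (by fun_prop) (by fun_prop) fun s hs => ?_
    have h1 := mul_le_mul_of_nonneg_left (hfle s hs) (hω0 s hs)
    have h2 : ω s * (C0 * (1 + (‖u (s, t)‖ ^ 2 + ‖us (s, t)‖ ^ 2 + ‖ut (s, t)‖ ^ 2)))
      ≤ W * (C0 * (1 + (‖u (s, t)‖ ^ 2 + ‖us (s, t)‖ ^ 2 + ‖ut (s, t)‖ ^ 2))) := by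
      have := hωW s hs
      gcongr
    linarith
  refine this.trans_eq ?_
  have hi : ∀ f : ℝ → ℝ, Continuous f → IntervalIntegrable f volume 0 l := fun f hf =>
    hf.intervalIntegrable _ _
  rw [intervalIntegral.integral_add (hi _ (by fun_prop)) (hi _ (by fun_prop)),
    intervalIntegral.integral_add (hi _ (by fun_prop)) (hi _ (by fun_prop)),
    intervalIntegral.integral_const, intervalIntegral.integral_const_mul,
    intervalIntegral.integral_const_mul, fieldEnergy, smul_eq_mul, sub_zero]
  ring

theorem fieldEnergy_nonneg (h : TrackField l B c0 C0 u us uss ut utt v vs vss vt vtt) (t : ℝ) :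
    0 ≤ fieldEnergy l u us ut t :=
  integral_nonneg h.l_pos.le fun s _ => by positivity

theorem sq_integral_inner_le [CompleteSpace H]
    (h : TrackField l B c0 C0 u us uss ut utt v vs vss vt vtt)
    {f : ℝ → H} (hf : Continuous f) {t : ℝ} (ht : 0 < t) :
    (∫ s in (0:ℝ)..l, ⟪f s, u (s, t)⟫) ^ 2
      ≤ l ^ 2 * (∫ s in (0:ℝ)..l, ‖f s‖ ^ 2) * fieldEnergy l u us ut t := by
  have cu := h.wave.cw
  have hl := h.l_pos
  have h1 := sq_integral_le (g := fun s => ⟪f s, u (s, t)⟫) hl.le (by fun_prop)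
  have h2 : ∫ s in (0:ℝ)..l, ⟪f s, u (s, t)⟫ ^ 2
      ≤ ∫ s in (0:ℝ)..l, ‖f s‖ ^ 2 * (l * fieldEnergy l u us ut t) := by
    refine integral_mono_continuous hl.le (by fun_prop) (by fun_prop) fun s hs => ?_
    have h3 := h.wave.norm_sq_le_fieldEnergy hl.le hs ht
    calc ⟪f s, u (s, t)⟫ ^ 2 = |⟪f s, u (s, t)⟫| ^ 2 := (sq_abs _).symm
      _ ≤ (‖f s‖ * ‖u (s, t)‖) ^ 2 := by
        gcongr
        exact abs_real_inner_le_norm _ _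
      _ = ‖f s‖ ^ 2 * ‖u (s, t)‖ ^ 2 := by ring
      _ ≤ _ := by gcongr
  rw [intervalIntegral.integral_mul_const] at h2
  rw [sub_zero] at h1
  calc _ ≤ l * ((∫ s in (0:ℝ)..l, ‖f s‖ ^ 2) * (l * fieldEnergy l u us ut t)) :=
        h1.trans (by gcongr)
    _ = _ := by ring

theorem coer_weighted (h : TrackField l B c0 C0 u us uss ut utt v vs vss vt vtt) {t : ℝ}
    (ht : 0 < t) {s : ℝ} (hs : s ∈ Icc 0 l) :
    c0 / 2 * ((l - s) ^ 2 * ‖uss (s, t)‖ ^ 2)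
      ≤ -⟪vtt (s, t), (l - s) ^ 2 • uss (s, t) - (2 * (l - s)) • us (s, t)⟫
        + (l ^ 2 * (C0 + c0 / 2) + 2 * C0 / c0)
          * (1 + (‖u (s, t)‖ ^ 2 + ‖us (s, t)‖ ^ 2 + ‖ut (s, t)‖ ^ 2)) := by
  have hc0 := h.c0_pos
  have hC0 := h.C0_pos
  have hx0 : 0 ≤ l - s := by linarith [hs.2]
  have hxl : (l - s) ^ 2 ≤ l ^ 2 := by
    gcongr
    linarith [hs.1]
  have hδ : 0 < c0 / (2 * C0) := by positivity
  have h1 := mul_le_mul_of_nonneg_left (h.coer t ht s hs) (sq_nonneg (l - s))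
  have h2 := two_inner_le_of_pos hδ ((l - s) • vtt (s, t)) (-us (s, t))
  have h3 := mul_le_mul_of_nonneg_left (h.vtt_le t ht s hs)
    (mul_nonneg hδ.le (sq_nonneg (l - s)))
  rw [norm_neg, norm_smul, mul_pow, Real.norm_eq_abs, sq_abs, inner_neg_right,
    real_inner_smul_left, inv_div] at h2
  rw [inner_sub_right, real_inner_smul_right, real_inner_smul_right]
  set ε := ‖u (s, t)‖ ^ 2 + ‖us (s, t)‖ ^ 2 + ‖ut (s, t)‖ ^ 2 with hε
  have hε0 : 0 ≤ ε := by positivity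
  have hus : ‖us (s, t)‖ ^ 2 ≤ 1 + ε := by
    rw [hε]; nlinarith [sq_nonneg ‖u (s, t)‖, sq_nonneg ‖ut (s, t)‖]
  have e1 : c0 / (2 * C0) * (l - s) ^ 2 * (C0 * (1 + ‖uss (s, t)‖ ^ 2 + ε))
    = c0 / 2 * ((l - s) ^ 2 * ‖uss (s, t)‖ ^ 2) + c0 / 2 * (1 + ε) * (l - s) ^ 2 := by
    field_simp
    ring
  rw [e1] at h3
  have h4 : (C0 + c0 / 2) * (1 + ε) * (l - s) ^ 2 ≤ (C0 + c0 / 2) * (1 + ε) * l ^ 2 := by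
    gcongr
  have h5 : 2 * C0 / c0 * ‖us (s, t)‖ ^ 2 ≤ 2 * C0 / c0 * (1 + ε) := by gcongr
  linarith

set_option maxHeartbeats 1000000 in
/-- Interior estimate: the weighted second derivative is controlled in time average. -/
theorem exists_weighted_bound [CompleteSpace H]
    (h : TrackField l B c0 C0 u us uss ut utt v vs vss vt vtt) {μ : ℝ} (hμ : 0 < μ) :
    ∃ C, 0 ≤ C ∧ ∀ T ρ M : ℝ, 1 ≤ T → 0 < ρ → 1 ≤ M →
      (∀ t ∈ Icc 1 (T + ρ), 1 + fieldEnergy l u us ut t ≤ M) →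
      ∫ t in (1:ℝ)..T, Real.exp (-μ * t) * (∫ s in (0:ℝ)..l, (l - s) ^ 2 * ‖uss (s, t)‖ ^ 2)
        ≤ C * (M + 1 / ρ ^ 2) := by
  have cu := h.wave.cw; have cus := h.wave.cws; have cut := h.wave.cwt; have cuss := h.wave.cA
  have cutt := h.wave.cwtt
  have cv := h.cv; have cvs := h.cvs; have cvss := h.cvss; have cvt := h.cvt; have cvtt := h.cvtt
  have hl := h.l_pos; have hc0 := h.c0_pos; have hC0 := h.C0_pos; have hB := h.B_nonneg
  set α : ℝ × ℝ → H := fun z => (l - z.1) ^ 2 • uss z - (2 * (l - z.1)) • us z with hα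
  set g : ℝ × ℝ → H := fun z => (l - z.1) • vss z - (2:ℝ) • vs z with hg
  set γ : ℝ × ℝ → H := fun z => (l - z.1) • g z with hγ
  have cα : Continuous α := by fun_prop
  have cg : Continuous g := by fun_prop
  have cγ : Continuous γ := by fun_prop
  set G : ℝ := (l + 2) * B with hG
  have hG0 : 0 ≤ G := by positivity
  have hgle : ∀ t, 0 < t → ∀ s ∈ Icc 0 l, ‖g (s, t)‖ ≤ G := by
    intro t ht s hs
    have h1 := h.vs_le t ht s hs
    have h2 := h.vss_le t ht s hs
    calc ‖g (s, t)‖ ≤ ‖(l - s) • vss (s, t)‖ + ‖(2:ℝ) • vs (s, t)‖ := norm_sub_le _ _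
      _ = |l - s| * ‖vss (s, t)‖ + 2 * ‖vs (s, t)‖ := by
        rw [norm_smul, norm_smul, Real.norm_eq_abs]; norm_num
      _ ≤ l * B + 2 * B := by
        gcongr
        rw [abs_of_nonneg (by linarith [hs.2])]
        linarith [hs.1]
      _ = G := by rw [hG]; ring
  have hg2 : ∀ t, 0 < t → ∫ s in (0:ℝ)..l, ‖g (s, t)‖ ^ 2 ≤ l * G ^ 2 := by
    intro t ht
    have := integral_mono_continuous hl.le (f := fun s => ‖g (s, t)‖ ^ 2)
      (g := fun _ => G ^ 2) (by fun_prop) (by fun_prop) (fun s hs => by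
        have := hgle t ht s hs
        gcongr)
    simpa using this
  have hγ2 : ∀ t, 0 < t → ∫ s in (0:ℝ)..l, ‖γ (s, t)‖ ^ 2 ≤ l ^ 2 * (l * G ^ 2) := by
    intro t ht
    refine le_trans ?_ (mul_le_mul_of_nonneg_left (hg2 t ht) (sq_nonneg l))
    rw [← intervalIntegral.integral_const_mul]
    refine integral_mono_continuous hl.le (by fun_prop) (by fun_prop) fun s hs => ?_
    have : (l - s) ^ 2 ≤ l ^ 2 :=
      pow_le_pow_left₀ (by linarith [hs.2]) (by linarith [hs.1]) 2
    simp only [hγ, norm_smul, mul_pow, Real.norm_eq_abs, sq_abs]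
    gcongr
  -- two representations of the pairing
  have hrep : ∀ x y, 0 < x → 0 < y → ∫ s in (0:ℝ)..l, ⟪γ (s, x), u (s, y)⟫
      = ∫ s in (0:ℝ)..l, ⟪v (s, x), α (s, y)⟫ := by
    intro x y hx hy
    have hq : ∀ s : ℝ, HasDerivAt (fun s => (l - s) ^ 2) (-(2 * (l - s))) s := fun s => by
      have := ((hasDerivAt_id s).const_sub l).pow 2
      refine this.congr_deriv ?_
      simp
    rw [integral_inner_deriv_right (f := fun s => v (s, x)) (g := fun s => (l - s) ^ 2 • us (s, y))
      (f' := fun s => vs (s, x)) (g' := fun s => α (s, y)) hl.le (by fun_prop) (by fun_prop)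
      (by fun_prop) (by fun_prop) (h.ds x hx) (fun s hs => by
        refine ((hq s).smul (h.wave.dA y hy s hs)).congr_deriv ?_
        simp only [hα, ContinuousLinearMap.id_apply]
        module)]
    have h2 := integral_inner_deriv_right (f := fun s => (l - s) ^ 2 • vs (s, x))
      (g := fun s => u (s, y))
      (f' := fun s => γ (s, x)) (g' := fun s => us (s, y)) hl.le (by fun_prop) (by fun_prop)
      (by fun_prop) (by fun_prop) (fun s hs => by
        refine ((hq s).smul (h.dss x hx s hs)).congr_deriv ?_
        simp only [hγ, hg]
        module) (h.wave.ds y hy)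
    simp only [sub_self, ne_eq, OfNat.ofNat_ne_zero, not_false_eq_true, zero_pow, zero_smul,
      inner_zero_left, inner_zero_right, h.wave.left y hy, h.left x hx, zero_sub] at h2 ⊢
    have h3 : ∀ s, ⟪(l - s) ^ 2 • vs (s, x), us (s, y)⟫ = ⟪vs (s, x), (l - s) ^ 2 • us (s, y)⟫ :=
      fun s => by rw [real_inner_smul_left, real_inner_smul_right]
    simp only [h3] at h2
    linarith
  obtain ⟨C3, hC3⟩ : ∃ x : ℝ, x = l ^ 2 * (C0 + c0 / 2) + 2 * C0 / c0 := ⟨_, rfl⟩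
  obtain ⟨C4, hC4⟩ : ∃ x : ℝ, x = c0 / 4 * l ^ 2 * (l + 1) + C0 / c0 * (l * G ^ 2) := ⟨_, rfl⟩
  obtain ⟨C5, hC5⟩ : ∃ x : ℝ, x = l ^ 2 * (l * G ^ 2) + 1 := ⟨_, rfl⟩
  obtain ⟨C6, hC6⟩ : ∃ x : ℝ, x = l ^ 2 * (l ^ 2 * (l * G ^ 2)) := ⟨_, rfl⟩
  obtain ⟨C7, hC7⟩ : ∃ x : ℝ, x = |∫ s in (0:ℝ)..l, ⟪vt (s, 1), α (s, 1)⟫| := ⟨_, rfl⟩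
  have h3 : 0 ≤ C3 := by rw [hC3]; positivity
  have h4 : 0 ≤ C4 := by rw [hC4]; positivity
  have h5 : 0 ≤ C5 := by rw [hC5]; positivity
  have h6 : 0 ≤ C6 := by rw [hC6]; positivity
  have h7 : 0 ≤ C7 := hC7 ▸ abs_nonneg _
  have h31 : 0 ≤ C3 * (l + 1) := by positivity
  obtain ⟨C, hC⟩ : ∃ x : ℝ, x = C3 * (l + 1) + C4 + C5 + C6 + C7 := ⟨_, rfl⟩
  have hCn : 0 ≤ C := by rw [hC]; positivity
  have hmc : Continuous fun t => ∫ s in (0:ℝ)..l, (l - s) ^ 2 * ‖uss (s, t)‖ ^ 2 :=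
    continuous_integral_right (f := fun z => (l - z.1) ^ 2 * ‖uss z‖ ^ 2) (by fun_prop) 0 l
  have hm0 : ∀ t, 0 ≤ ∫ s in (0:ℝ)..l, (l - s) ^ 2 * ‖uss (s, t)‖ ^ 2 := fun t =>
    integral_nonneg hl.le fun s _ => by positivity
  refine ⟨4 / c0 * ((2 * C + 2 * μ * C + μ ^ 2 * (1 + C)) / μ + 1 + 5 * C + 2 * μ * (1 + C)),
    by positivity, fun T ρ M hT hρ hM hE => ?_⟩
  have key := integral_le_of_diag (a := fun z => ∫ s in (0:ℝ)..l, ⟪γ (s, z.1), u (s, z.2)⟫)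
    (a1 := fun z => ∫ s in (0:ℝ)..l, ⟪vt (s, z.1), α (s, z.2)⟫)
    (a2 := fun z => ∫ s in (0:ℝ)..l, ⟪γ (s, z.1), ut (s, z.2)⟫)
    (a11 := fun z => ∫ s in (0:ℝ)..l, ⟪vtt (s, z.1), α (s, z.2)⟫)
    (a22 := fun z => ∫ s in (0:ℝ)..l, ⟪γ (s, z.1), utt (s, z.2)⟫)
    (continuous_integral_pair cγ cu 0 l) (continuous_integral_pair cvt cα 0 l)
    (continuous_integral_pair cγ cut 0 l) (continuous_integral_pair cvtt cα 0 l)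
    (continuous_integral_pair cγ cutt 0 l)
    (fun x y hx hy => (hasDerivAt_integral_inner_left (g := fun s => α (s, y)) cv cvt
      (by fun_prop) hl.le hx h.dt).congr_of_eventuallyEq
      (by filter_upwards [lt_mem_nhds hx] with z hz using hrep z y hz hy))
    (fun x y hx hy => hasDerivAt_integral_inner_right (f := fun s => γ (s, x)) cu cut
      (by fun_prop) hl.le hy h.wave.dt)
    (fun x y hx hy => hasDerivAt_integral_inner_left (g := fun s => α (s, y)) cvt cvtt
      (by fun_prop) hl.le hx h.dtt)
    (fun x y hx hy => hasDerivAt_integral_inner_right (f := fun s => γ (s, x)) cut cutt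
      (by fun_prop) hl.le hy h.wave.dtt)
    (q := fun t => c0 / 4 * ∫ s in (0:ℝ)..l, (l - s) ^ 2 * ‖uss (s, t)‖ ^ 2) (R := fun _ => 0)
    (by fun_prop) (by fun_prop) (fun t _ => mul_nonneg (by positivity) (hm0 t))
    (fun _ _ => le_rfl) hμ hCn hM hT hρ (C := C) ?_ ?_ ?_ ?_ ?_
  · have e1 : ∀ t : ℝ, Real.exp (-μ * t)
        * (c0 / 4 * ∫ s in (0:ℝ)..l, (l - s) ^ 2 * ‖uss (s, t)‖ ^ 2)
        = c0 / 4 * (Real.exp (-μ * t) * ∫ s in (0:ℝ)..l, (l - s) ^ 2 * ‖uss (s, t)‖ ^ 2) :=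
      fun t => by ring
    simp only [e1, mul_zero, intervalIntegral.integral_zero, add_zero] at key
    rw [intervalIntegral.integral_const_mul] at key
    have := mul_le_mul_of_nonneg_left key (by positivity : 0 ≤ 4 / c0)
    rw [← mul_assoc, show 4 / c0 * (c0 / 4) = 1 by field_simp, one_mul] at this
    linarith
  · intro t ht
    have ht0 : 0 < t := by linarith [ht.1]
    have h_int := integral_mono_continuous hl.le
      (f := fun s => c0 / 2 * ((l - s) ^ 2 * ‖uss (s, t)‖ ^ 2))
      (g := fun s => -⟪vtt (s, t), α (s, t)⟫
        + (C3 + C3 * (‖u (s, t)‖ ^ 2 + ‖us (s, t)‖ ^ 2 + ‖ut (s, t)‖ ^ 2)))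
      (by fun_prop) (by fun_prop) (fun s hs => by
        have := h.coer_weighted ht0 hs
        rw [← hC3] at this
        simp only [hα]
        linarith)
    rw [intervalIntegral.integral_add (Continuous.intervalIntegrable (by fun_prop) _ _)
        (Continuous.intervalIntegrable (by fun_prop) _ _),
      intervalIntegral.integral_add (Continuous.intervalIntegrable (by fun_prop) _ _)
        (Continuous.intervalIntegrable (by fun_prop) _ _),
      intervalIntegral.integral_neg, intervalIntegral.integral_const,
      intervalIntegral.integral_const_mul, intervalIntegral.integral_const_mul, smul_eq_mul]
      at h_int
    change _ ≤ -_ + ((l - 0) * C3 + C3 * fieldEnergy l u us ut t) at h_int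
    have hEt := hE t ht
    have he0 := h.fieldEnergy_nonneg t
    have f1 : (l - 0) * C3 + C3 * fieldEnergy l u us ut t ≤ C3 * (l + 1) * M := by
      have : l ≤ l * M := le_mul_of_one_le_right hl.le hM
      calc _ = C3 * (l + fieldEnergy l u us ut t) := by ring
        _ ≤ C3 * (l * M + M) := by gcongr; linarith
        _ = _ := by ring
    have f2 : C3 * (l + 1) * M ≤ C * M := by
      gcongr
      rw [hC]; linarith
    linarith
  · intro t ht
    have ht0 : 0 < t := by linarith [ht.1]
    have hδ : 0 < C0 / (c0 / 2) := by positivity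
    have e1 : ∫ s in (0:ℝ)..l, ⟪γ (s, t), utt (s, t)⟫
        = ∫ s in (0:ℝ)..l, ⟪g (s, t), (l - s) • utt (s, t)⟫ := by
      congr 1; ext s
      simp only [hγ]
      rw [real_inner_smul_left, real_inner_smul_right]
    have h1 := abs_integral_inner_le (f := fun s => g (s, t))
      (g := fun s => (l - s) • utt (s, t)) hl.le hδ (by fun_prop) (by fun_prop)
    simp only [norm_smul, mul_pow, Real.norm_eq_abs, sq_abs] at h1
    have h2 := h.integral_weight_le cutt (ω := fun s => (l - s) ^ 2) (W := l ^ 2) (by fun_prop)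
      (fun s _ => sq_nonneg _) (fun s hs =>
        pow_le_pow_left₀ (by linarith [hs.2]) (by linarith [hs.1]) 2) (h.utt_le t ht0)
    have h2' := mul_le_mul_of_nonneg_left h2 (inv_pos.2 hδ).le
    have h3' := mul_le_mul_of_nonneg_left (hg2 t ht0) hδ.le
    have hEt := hE t ht
    have he0 := h.fieldEnergy_nonneg t
    have f0 : l + fieldEnergy l u us ut t ≤ (l + 1) * M := by
      have : l ≤ l * M := le_mul_of_one_le_right hl.le hM
      linarith
    have f1 : (C0 / (c0 / 2))⁻¹ * (C0 * (∫ s in (0:ℝ)..l, (l - s) ^ 2 * ‖uss (s, t)‖ ^ 2)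
        + C0 * l ^ 2 * (l + fieldEnergy l u us ut t))
        = c0 / 2 * (∫ s in (0:ℝ)..l, (l - s) ^ 2 * ‖uss (s, t)‖ ^ 2)
          + c0 / 2 * l ^ 2 * (l + fieldEnergy l u us ut t) := by
      field_simp
    rw [f1] at h2'
    have f2 : c0 / 2 * l ^ 2 * (l + fieldEnergy l u us ut t) ≤ c0 / 2 * l ^ 2 * ((l + 1) * M) := by
      gcongr
    have f3 : C0 / (c0 / 2) * (l * G ^ 2) ≤ C0 / (c0 / 2) * (l * G ^ 2) * M :=
      le_mul_of_one_le_right (by positivity) hM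
    have f4 : C4 * M ≤ C * M := by
      gcongr
      rw [hC]; linarith
    have f5 : (c0 / 2 * l ^ 2 * ((l + 1) * M) + C0 / (c0 / 2) * (l * G ^ 2) * M) / 2 = C4 * M := by
      rw [hC4]; field_simp; ring
    simp only [e1]
    linarith
  · intro t ht
    have ht0 : 0 < t := by linarith [ht.1]
    have h1 := abs_integral_inner_le (f := fun s => γ (s, t))
      (g := fun s => ut (s, t)) hl.le one_pos (by fun_prop) (by fun_prop)
    have h2 := h.wave.integral_wt_sq_le_fieldEnergy hl.le t
    have h3' := hγ2 t ht0
    have hEt := hE t ht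
    have f1 : l ^ 2 * (l * G ^ 2) ≤ l ^ 2 * (l * G ^ 2) * M :=
      le_mul_of_one_le_right (by positivity) hM
    have f2 : C5 * M ≤ C * M := by
      gcongr
      rw [hC]; linarith
    have f3 : 0 ≤ l ^ 2 * (l * G ^ 2) * M := by positivity
    have f4 : C5 * M = l ^ 2 * (l * G ^ 2) * M + M := by rw [hC5]; ring
    simp only [inv_one, one_mul] at h1
    simp only
    linarith
  · intro t ht
    have ht0 : 0 < t := by linarith [ht.1]
    have h1 := h.sq_integral_inner_le (f := fun s => γ (s, t)) (by fun_prop) ht0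
    have hEt := hE t ht
    have he0 := h.fieldEnergy_nonneg t
    calc _ ≤ _ := h1
      _ ≤ l ^ 2 * (l ^ 2 * (l * G ^ 2)) * M := by
        gcongr
        · exact hγ2 t ht0
        · linarith
      _ = C6 * M := by rw [hC6]
      _ ≤ C * M := by
        gcongr
        rw [hC]; linarith
  · simp only
    rw [← hC7, hC]; linarith

end TrackField

end Track

section Layer

/-- A regularized fifth root `Y` of the distance to the right end point, used to build a
boundary-layer length scale `k * Y ^ 3`. -/
structure LayerScale (l k η : ℝ) (Y : ℝ → ℝ) : Prop where
  l_pos : 0 < l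
  k_pos : 0 < k
  k_le : 4 * (k * (l + 1) ^ 3) ≤ l
  η_pos : 0 < η
  η_le : η ≤ 1
  cY : Continuous Y
  pos : ∀ s, 0 < Y s
  pow_eq : ∀ s ∈ Icc 0 l, Y s ^ 5 = l - s + η
  deriv : ∀ s ∈ Ioo 0 l, HasDerivAt Y (-(5 * Y s ^ 4)⁻¹) s

theorem exists_layerScale {l η : ℝ} (hl : 0 < l) (hη : 0 < η) (hη1 : η ≤ 1) :
    ∃ Y, LayerScale l (l / (4 * (l + 1) ^ 3)) η Y := by
  have hpos : ∀ s, 0 < max (l - s) 0 + η := fun s => by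
    have := le_max_right (l - s) 0
    linarith
  have hpow : ∀ x : ℝ, 0 < x → (x ^ (1 / 5 : ℝ)) ^ 5 = x := fun x hx => by
    rw [← Real.rpow_natCast, ← Real.rpow_mul hx.le]
    norm_num
  refine ⟨fun s => (max (l - s) 0 + η) ^ (1 / 5 : ℝ), hl, by positivity, ?_, hη, hη1, ?_,
    fun s => Real.rpow_pos_of_pos (hpos s) _, ?_, ?_⟩
  · apply le_of_eq
    field_simp
  · exact Continuous.rpow_const (by fun_prop) fun s => Or.inl (hpos s).ne'
  · intro s hs
    rw [hpow _ (hpos s), max_eq_left (by linarith [hs.2])]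
  · intro s hs
    have h1 : HasDerivAt (fun s => (l - s + η) ^ (1 / 5 : ℝ))
        (-1 * (1 / 5 : ℝ) * (l - s + η) ^ ((1 / 5 : ℝ) - 1)) s :=
      (((hasDerivAt_id s).const_sub l).add_const η).rpow_const
        (Or.inl (by simp only [id]; linarith [hs.2]))
    have hx : 0 < l - s + η := by linarith [hs.2]
    refine (h1.congr_of_eventuallyEq ?_).congr_deriv ?_
    · filter_upwards [gt_mem_nhds hs.2] with x hx
      rw [max_eq_left (by linarith)]
    · rw [max_eq_left (by linarith [hs.2]), ← Real.rpow_natCast, ← Real.rpow_mul hx.le, mul_inv,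
        ← Real.rpow_neg hx.le]
      norm_num

namespace LayerScale

variable {l k η : ℝ} {Y : ℝ → ℝ}

theorem le_add_one (h : LayerScale l k η Y) {s : ℝ} (hs : s ∈ Icc 0 l) : Y s ≤ l + 1 := by
  have hl := h.l_pos
  refine le_of_pow_le_pow_left₀ (by norm_num : 5 ≠ 0) (by linarith) ?_
  rw [h.pow_eq s hs]
  calc l - s + η ≤ l + 1 := by linarith [hs.1, h.η_le]
    _ ≤ (l + 1) ^ 5 := le_self_pow₀ (by linarith) (by norm_num)

theorem scale_pos (h : LayerScale l k η Y) (s : ℝ) : 0 < k * Y s ^ 3 := by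
  have := h.pos s
  have := h.k_pos
  positivity

theorem scale_le (h : LayerScale l k η Y) {s : ℝ} (hs : s ∈ Icc 0 l) : 4 * (k * Y s ^ 3) ≤ l := by
  have := h.pos s
  have := h.k_pos
  have := h.le_add_one hs
  refine le_trans ?_ h.k_le
  gcongr

theorem hasDerivAt_scale (h : LayerScale l k η Y) {s : ℝ} (hs : s ∈ Ioo 0 l) :
    HasDerivAt (fun s => k * Y s ^ 3) (-(3 / 5 * k * (Y s ^ 2)⁻¹)) s := by
  have hY := h.pos s
  refine (((h.deriv s hs).pow 3).const_mul k).congr_deriv ?_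
  push_cast
  field_simp

theorem integral_inv_le (h : LayerScale l k η Y) :
    ∫ s in (0:ℝ)..l, (Y s ^ 4)⁻¹ ≤ 5 * (l + 1) := by
  have cY := h.cY
  have hp := h.pos
  have ci : Continuous fun s => (Y s ^ 4)⁻¹ :=
    (cY.pow 4).inv₀ fun s => (pow_pos (hp s) 4).ne'
  rw [integral_eq_sub_of_hasDerivAt_of_le (f := fun s => -5 * Y s) h.l_pos.le (by fun_prop)
    (fun s hs => ((h.deriv s hs).const_mul (-5)).congr_deriv (by have := hp s; field_simp))
    (ci.intervalIntegrable 0 l)]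
  have := h.le_add_one (s := 0) ⟨le_rfl, h.l_pos.le⟩
  linarith [hp l]

theorem integral_comp_le (h : LayerScale l k η Y) {g : ℝ → ℝ} (hg : Continuous g)
    (hg0 : ∀ s, 0 ≤ g s) {j : ℝ} (hj1 : 1 ≤ j) (hj2 : j ≤ 2) :
    ∫ s in (0:ℝ)..l, Y s ^ 4 * g (l - j * (k * Y s ^ 3))
      ≤ 5 / (3 * k ^ 3) * ∫ s in (0:ℝ)..l, (l - s) ^ 2 * g s := by
  have cY := h.cY
  have hp := h.pos
  have hl := h.l_pos
  have hk := h.k_pos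
  have ci : Continuous fun s => (Y s ^ 2)⁻¹ :=
    (cY.pow 2).inv₀ fun s => (pow_pos (hp s) 2).ne'
  have hsub := intervalIntegral.integral_comp_mul_deriv'' (a := 0) (b := l)
    (f := fun s => l - j * (k * Y s ^ 3)) (f' := fun s => j * (3 / 5 * k * (Y s ^ 2)⁻¹))
    (g := fun x => (l - x) ^ 2 * g x) (by fun_prop) (by
      intro s hs
      rw [min_eq_left hl.le, max_eq_right hl.le] at hs
      exact ((((h.hasDerivAt_scale hs).const_mul j).const_sub l).congr_deriv
        (by ring)).hasDerivWithinAt)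
    (Continuous.continuousOn (by fun_prop)) (by fun_prop)
  simp only [Function.comp_def, sub_sub_cancel] at hsub
  have e1 : ∀ s, (j * (k * Y s ^ 3)) ^ 2 * g (l - j * (k * Y s ^ 3))
      * (j * (3 / 5 * k * (Y s ^ 2)⁻¹))
      = (3 * k ^ 3 / 5 * j ^ 3) * (Y s ^ 4 * g (l - j * (k * Y s ^ 3))) := fun s => by
    have := hp s
    field_simp
  simp only [e1] at hsub
  rw [intervalIntegral.integral_const_mul] at hsub
  have hm : ∀ s ∈ Icc 0 l, 0 ≤ l - j * (k * Y s ^ 3) ∧ l - j * (k * Y s ^ 3) ≤ l := fun s hs => by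
    have h1 := h.scale_le hs
    have h2 := h.scale_pos s
    constructor <;> nlinarith
  have hY0l : Y l ≤ Y 0 := by
    refine le_of_pow_le_pow_left₀ (by norm_num : 5 ≠ 0) (hp 0).le ?_
    rw [h.pow_eq l ⟨hl.le, le_rfl⟩, h.pow_eq 0 ⟨le_rfl, hl.le⟩]
    linarith
  have hle : ∫ x in (l - j * (k * Y 0 ^ 3))..(l - j * (k * Y l ^ 3)), (l - x) ^ 2 * g x
      ≤ ∫ s in (0:ℝ)..l, (l - s) ^ 2 * g s := by
    refine intervalIntegral.integral_mono_interval (hm 0 ⟨le_rfl, hl.le⟩).1 ?_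
      (hm l ⟨hl.le, le_rfl⟩).2 (ae_of_all _ fun x => mul_nonneg (sq_nonneg _) (hg0 x))
      (Continuous.intervalIntegrable (by fun_prop) _ _)
    have := (hp l).le
    gcongr
  rw [← hsub] at hle
  have hI0 : 0 ≤ ∫ s in (0:ℝ)..l, Y s ^ 4 * g (l - j * (k * Y s ^ 3)) :=
    integral_nonneg hl.le fun s _ => mul_nonneg (by positivity) (hg0 _)
  have hj3 : 1 ≤ j ^ 3 := one_le_pow₀ hj1
  have h5 : (3 * k ^ 3 / 5) * ∫ s in (0:ℝ)..l, Y s ^ 4 * g (l - j * (k * Y s ^ 3))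
      ≤ ∫ s in (0:ℝ)..l, (l - s) ^ 2 * g s := by
    refine le_trans ?_ hle
    gcongr
    exact le_mul_of_one_le_right (by positivity) hj3
  calc _ = 5 / (3 * k ^ 3) * ((3 * k ^ 3 / 5)
        * ∫ s in (0:ℝ)..l, Y s ^ 4 * g (l - j * (k * Y s ^ 3))) := by
        rw [← mul_assoc, show 5 / (3 * k ^ 3) * (3 * k ^ 3 / 5) = 1 by field_simp, one_mul]
    _ ≤ _ := by gcongr

end LayerScale

variable {H : Type*} [NormedAddCommGroup H] [InnerProductSpace ℝ H]

/-- The difference quotient of `f` over the segment `[l - 2σ, l - σ]` with `σ = k * Y ^ 3`. -/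
noncomputable def layerQuot (l k : ℝ) (Y : ℝ → ℝ) (f : ℝ × ℝ → H) (z : ℝ × ℝ) : H :=
  (k * Y z.1 ^ 3)⁻¹ • (f (l - 1 * (k * Y z.1 ^ 3), z.2) - f (l - 2 * (k * Y z.1 ^ 3), z.2))

/-- The space derivative of `layerQuot l k Y f`, where `fs` is the space derivative of `f`. -/
noncomputable def layerQuotDeriv (l k : ℝ) (Y : ℝ → ℝ) (f fs : ℝ × ℝ → H) (z : ℝ × ℝ) : H :=
  (3 / 5 * k * (Y z.1 ^ 2)⁻¹ * (k * Y z.1 ^ 3)⁻¹) • (layerQuot l k Y f z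
    + fs (l - 1 * (k * Y z.1 ^ 3), z.2) - (2:ℝ) • fs (l - 2 * (k * Y z.1 ^ 3), z.2))

namespace LayerScale

variable {l k η : ℝ} {Y : ℝ → ℝ} {f ft fs fss : ℝ × ℝ → H}

theorem mem_Ioo (h : LayerScale l k η Y) {s : ℝ} (hs : s ∈ Icc 0 l) {j : ℝ} (hj1 : 1 ≤ j)
    (hj2 : j ≤ 2) : l - j * (k * Y s ^ 3) ∈ Ioo 0 l := by
  have h1 := h.scale_le hs
  have h2 := h.scale_pos s
  constructor <;> nlinarith [h.l_pos]

theorem continuous_layerQuot (h : LayerScale l k η Y) (hf : Continuous f) :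
    Continuous (layerQuot l k Y f) := by
  have cY := h.cY
  have ci : Continuous fun z : ℝ × ℝ => (k * Y z.1 ^ 3)⁻¹ :=
    Continuous.inv₀ (by fun_prop) fun z => (h.scale_pos _).ne'
  unfold layerQuot
  fun_prop

theorem continuous_layerQuotDeriv (h : LayerScale l k η Y) (hf : Continuous f)
    (hfs : Continuous fs) : Continuous (layerQuotDeriv l k Y f fs) := by
  have cY := h.cY
  have ci : Continuous fun z : ℝ × ℝ => (k * Y z.1 ^ 3)⁻¹ :=
    Continuous.inv₀ (by fun_prop) fun z => (h.scale_pos _).ne'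
  have ci2 : Continuous fun z : ℝ × ℝ => (Y z.1 ^ 2)⁻¹ :=
    Continuous.inv₀ (by fun_prop) fun z => (pow_pos (h.pos _) 2).ne'
  have := h.continuous_layerQuot hf
  unfold layerQuotDeriv
  fun_prop

theorem hasDerivAt_layerQuot_right (h : LayerScale l k η Y)
    (hft : ∀ s ∈ Icc 0 l, ∀ t, 0 < t → HasDerivAt (fun x => f (s, x)) (ft (s, t)) t) :
    ∀ s ∈ Icc 0 l, ∀ t, 0 < t →
      HasDerivAt (fun x => layerQuot l k Y f (s, x)) (layerQuot l k Y ft (s, t)) t := by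
  intro s hs t ht
  exact HasDerivAt.const_smul (k * Y s ^ 3)⁻¹
    ((hft _ (Ioo_subset_Icc_self (h.mem_Ioo hs le_rfl one_le_two)) t ht).sub
      (hft _ (Ioo_subset_Icc_self (h.mem_Ioo hs one_le_two le_rfl)) t ht))

theorem hasDerivAt_layerQuot_left (h : LayerScale l k η Y) {t : ℝ}
    (hfs : ∀ s ∈ Ioo 0 l, HasDerivAt (fun x => f (x, t)) (fs (s, t)) s) :
    ∀ s ∈ Ioo 0 l,
      HasDerivAt (fun x => layerQuot l k Y f (x, t)) (layerQuotDeriv l k Y f fs (s, t)) s := by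
  intro s hs
  have hσ := h.scale_pos s
  have hs' := Ioo_subset_Icc_self hs
  have hd := h.hasDerivAt_scale hs
  have hc : ∀ j : ℝ, 1 ≤ j → j ≤ 2 → HasDerivAt (fun x => f (l - j * (k * Y x ^ 3), t))
      ((j * (3 / 5 * k * (Y s ^ 2)⁻¹)) • fs (l - j * (k * Y s ^ 3), t)) s := fun j hj1 hj2 => by
    have h1 := hfs _ (h.mem_Ioo hs' hj1 hj2)
    have h2 : HasDerivAt (fun s => l - j * (k * Y s ^ 3)) (j * (3 / 5 * k * (Y s ^ 2)⁻¹)) s :=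
      ((hd.const_mul j).const_sub l).congr_deriv (by ring)
    exact HasDerivAt.scomp (h := fun x => l - j * (k * Y x ^ 3))
      (g₁ := fun x => f (x, t)) s h1 h2
  refine ((hd.inv hσ.ne').smul ((hc 1 le_rfl one_le_two).sub
    (hc 2 one_le_two le_rfl))).congr_deriv ?_
  simp only [layerQuotDeriv, layerQuot, Pi.inv_apply, Pi.sub_apply]
  have e : -(-(3 / 5 * k * (Y s ^ 2)⁻¹)) / (k * Y s ^ 3) ^ 2
    = (3 / 5 * k * (Y s ^ 2)⁻¹) * (k * Y s ^ 3)⁻¹ * (k * Y s ^ 3)⁻¹ := by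
    field_simp
  rw [e]
  module

end LayerScale
end Layer

section LayerBounds

variable {H : Type*} [NormedAddCommGroup H] [InnerProductSpace ℝ H]

theorem norm_sub_le_of_hasDerivAt {f f' : ℝ → H} {a b B x : ℝ} (hf : Continuous f)
    (h : ∀ s ∈ Ico a b, HasDerivAt f (f' s) s) (hB : ∀ s ∈ Ico a b, ‖f' s‖ ≤ B)
    (hx : x ∈ Icc a b) : ‖f x - f a‖ ≤ B * (x - a) :=
  norm_image_sub_le_of_norm_deriv_right_le_segment hf.continuousOn
    (fun s hs => (h s hs).hasDerivWithinAt) hB x hx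

/-- Hardy's inequality at the right end point, with a regularized distance. -/
theorem integral_norm_sq_div_le {g g' : ℝ → H} {l η : ℝ} {X : ℝ → ℝ} (hl : 0 ≤ l)
    (hg : Continuous g) (hg' : Continuous g') (hd : ∀ s ∈ Ioo 0 l, HasDerivAt g (g' s) s)
    (hgl : g l = 0) (hX : Continuous X) (hX0 : ∀ s, 0 < X s)
    (hXe : ∀ s ∈ Icc 0 l, X s = l - s + η) :
    ∫ s in (0:ℝ)..l, ‖(X s)⁻¹ • g s‖ ^ 2 ≤ 4 * ∫ s in (0:ℝ)..l, ‖g' s‖ ^ 2 := by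
  have ci : Continuous fun s => (X s)⁻¹ := hX.inv₀ fun s => (hX0 s).ne'
  have hXd : ∀ s ∈ Ioo 0 l, HasDerivAt (fun s => (X s)⁻¹) ((X s)⁻¹ ^ 2) s := fun s hs => by
    have h1 : HasDerivAt X (-1) s := by
      refine (((hasDerivAt_id s).const_sub l).add_const η).congr_of_eventuallyEq ?_
      filter_upwards [Ioo_mem_nhds hs.1 hs.2] with x hx using hXe x (Ioo_subset_Icc_self hx)
    refine (h1.inv (hX0 s).ne').congr_deriv ?_
    rw [neg_neg, inv_pow, one_div]
  have hibp := integral_inner_deriv_right (f := fun s => (X s)⁻¹ • g s) (g := g)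
    (f' := fun s => (X s)⁻¹ • g' s + (X s)⁻¹ ^ 2 • g s) (g' := g') hl (by fun_prop) hg
    (by fun_prop) hg' (fun s hs => (hXd s hs).smul (hd s hs)) hd
  have hle : ∫ s in (0:ℝ)..l, ‖(X s)⁻¹ • g s‖ ^ 2
      ≤ ∫ s in (0:ℝ)..l, ((⟪(X s)⁻¹ • g' s + (X s)⁻¹ ^ 2 • g s, g s⟫
        + ⟪(X s)⁻¹ • g s, g' s⟫) + (2⁻¹ * ‖(X s)⁻¹ • g s‖ ^ 2 + 2 * ‖g' s‖ ^ 2)) := by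
    refine integral_mono_continuous hl (by fun_prop) (by fun_prop) fun s _ => ?_
    have h1 := two_inner_le_of_pos (by norm_num : (0:ℝ) < 2⁻¹) ((X s)⁻¹ • g s) (-g' s)
    rw [inner_add_left, real_inner_smul_left, real_inner_smul_left, real_inner_smul_left,
      real_inner_self_eq_norm_sq, real_inner_comm]
    rw [inner_neg_right, norm_neg, real_inner_smul_left, inv_inv] at h1
    rw [norm_smul, mul_pow, Real.norm_eq_abs, sq_abs] at h1 ⊢
    linarith
  have hi : ∀ f : ℝ → ℝ, Continuous f → IntervalIntegrable f volume 0 l := fun f hf =>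
    hf.intervalIntegrable _ _
  rw [intervalIntegral.integral_add (hi _ (by fun_prop)) (hi _ (by fun_prop)),
    intervalIntegral.integral_add (hi _ (by fun_prop)) (hi _ (by fun_prop)),
    intervalIntegral.integral_add (hi _ (by fun_prop)) (hi _ (by fun_prop)),
    intervalIntegral.integral_const_mul, intervalIntegral.integral_const_mul] at hle
  have h0 : 0 ≤ ⟪(X 0)⁻¹ • g 0, g 0⟫ := by
    rw [real_inner_smul_left]
    exact mul_nonneg (inv_nonneg.2 (hX0 0).le) real_inner_self_nonneg
  rw [hgl, inner_zero_right] at hibp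
  linarith

namespace LayerScale

variable {l k η : ℝ} {Y : ℝ → ℝ} {f ft fs fss : ℝ × ℝ → H}

theorem norm_layerQuot_sub_le (h : LayerScale l k η Y) {B t : ℝ} (hf : Continuous f)
    (hfs : Continuous fs) (hd : ∀ s ∈ Ioo 0 l, HasDerivAt (fun x => f (x, t)) (fs (s, t)) s)
    (hds : ∀ s ∈ Ioo 0 l, HasDerivAt (fun x => fs (x, t)) (fss (s, t)) s)
    (hB : ∀ s ∈ Icc 0 l, ‖fss (s, t)‖ ≤ B) {s : ℝ} (hs : s ∈ Icc 0 l) :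
    ‖layerQuot l k Y f (s, t) - fs (l - 2 * (k * Y s ^ 3), t)‖ ≤ B * (k * Y s ^ 3)
      ∧ ‖fs (l - 1 * (k * Y s ^ 3), t) - fs (l - 2 * (k * Y s ^ 3), t)‖ ≤ B * (k * Y s ^ 3) := by
  have hσ := h.scale_pos s
  have ha := h.mem_Ioo hs one_le_two le_rfl
  have hb := h.mem_Ioo hs le_rfl one_le_two
  simp only [layerQuot]
  set σ := k * Y s ^ 3 with hσd
  set a := l - 2 * σ with had
  set b := l - 1 * σ with hbd
  have hab : b - a = σ := by rw [had, hbd]; ring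
  have hB0 : 0 ≤ B := (norm_nonneg _).trans (hB a (Ioo_subset_Icc_self ha))
  have hIco : ∀ x ∈ Icc a b, x ∈ Ioo 0 l := fun x hx =>
    ⟨ha.1.trans_le hx.1, hx.2.trans_lt hb.2⟩
  have h1 : ∀ x ∈ Icc a b, ‖fs (x, t) - fs (a, t)‖ ≤ B * σ := fun x hx => by
    refine (norm_sub_le_of_hasDerivAt (f := fun x => fs (x, t)) (f' := fun x => fss (x, t))
      (by fun_prop) (fun s hs => hds s (hIco s (Ico_subset_Icc_self hs)))
      (fun s hs => hB s (Ioo_subset_Icc_self (hIco s (Ico_subset_Icc_self hs)))) hx).trans ?_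
    gcongr
    linarith [hx.2]
  have hbm : b ∈ Icc a b := ⟨by linarith, le_rfl⟩
  refine ⟨?_, h1 b hbm⟩
  have h2 := norm_sub_le_of_hasDerivAt (f := fun x => f (x, t) - x • fs (a, t))
    (f' := fun x => fs (x, t) - (1:ℝ) • fs (a, t)) (B := B * σ) (a := a) (b := b) (by fun_prop)
    (fun s hs => (hd s (hIco s (Ico_subset_Icc_self hs))).sub
      ((hasDerivAt_id s).smul_const (fs (a, t))))
    (fun s hs => by rw [one_smul]; exact h1 s (Ico_subset_Icc_self hs)) hbm
  have e : σ⁻¹ • (f (b, t) - f (a, t)) - fs (a, t)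
      = σ⁻¹ • (f (b, t) - b • fs (a, t) - (f (a, t) - a • fs (a, t))) := by
    have : fs (a, t) = (σ⁻¹ * (b - a)) • fs (a, t) := by
      rw [hab, inv_mul_cancel₀ hσ.ne', one_smul]
    nth_rewrite 1 [this]
    module
  rw [e, norm_smul, norm_inv, Real.norm_eq_abs, abs_of_pos hσ, inv_mul_le_iff₀ hσ]
  rw [hab] at h2
  linarith

theorem norm_layerQuotDeriv_le (h : LayerScale l k η Y) {B t : ℝ} (hf : Continuous f)
    (hfs : Continuous fs) (hd : ∀ s ∈ Ioo 0 l, HasDerivAt (fun x => f (x, t)) (fs (s, t)) s)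
    (hds : ∀ s ∈ Ioo 0 l, HasDerivAt (fun x => fs (x, t)) (fss (s, t)) s)
    (hB : ∀ s ∈ Icc 0 l, ‖fss (s, t)‖ ≤ B) {s : ℝ} (hs : s ∈ Icc 0 l) :
    ‖layerQuotDeriv l k Y f fs (s, t)‖ ≤ 6 / 5 * k * B * (Y s ^ 2)⁻¹ := by
  obtain ⟨h1, h2⟩ := h.norm_layerQuot_sub_le hf hfs hd hds hB hs
  have hσ := h.scale_pos s
  have hY := h.pos s
  have hk := h.k_pos
  have e : layerQuot l k Y f (s, t) + fs (l - 1 * (k * Y s ^ 3), t)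
      - (2:ℝ) • fs (l - 2 * (k * Y s ^ 3), t)
      = (layerQuot l k Y f (s, t) - fs (l - 2 * (k * Y s ^ 3), t))
        + (fs (l - 1 * (k * Y s ^ 3), t) - fs (l - 2 * (k * Y s ^ 3), t)) := by module
  rw [layerQuotDeriv, norm_smul, Real.norm_eq_abs, abs_of_pos (by positivity)]
  dsimp only
  rw [e]
  calc _ ≤ 3 / 5 * k * (Y s ^ 2)⁻¹ * (k * Y s ^ 3)⁻¹ * (B * (k * Y s ^ 3) + B * (k * Y s ^ 3)) := by
        gcongr
        exact (norm_add_le _ _).trans (add_le_add h1 h2)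
    _ = _ := by field_simp; ring

theorem integral_layerQuotDeriv_sq_le (h : LayerScale l k η Y) {B t : ℝ} (hf : Continuous f)
    (hfs : Continuous fs) (hd : ∀ s ∈ Ioo 0 l, HasDerivAt (fun x => f (x, t)) (fs (s, t)) s)
    (hds : ∀ s ∈ Ioo 0 l, HasDerivAt (fun x => fs (x, t)) (fss (s, t)) s)
    (hB : ∀ s ∈ Icc 0 l, ‖fss (s, t)‖ ≤ B) :
    ∫ s in (0:ℝ)..l, ‖layerQuotDeriv l k Y f fs (s, t)‖ ^ 2
      ≤ (6 / 5 * k * B) ^ 2 * (5 * (l + 1)) := by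
  have cY := h.cY
  have ci : Continuous fun s => (Y s ^ 4)⁻¹ :=
    (cY.pow 4).inv₀ fun s => (pow_pos (h.pos s) 4).ne'
  have cq := h.continuous_layerQuotDeriv hf hfs
  have : ∫ s in (0:ℝ)..l, ‖layerQuotDeriv l k Y f fs (s, t)‖ ^ 2
      ≤ ∫ s in (0:ℝ)..l, (6 / 5 * k * B) ^ 2 * (Y s ^ 4)⁻¹ := by
    refine integral_mono_continuous h.l_pos.le (by fun_prop) (by fun_prop) fun s hs => ?_
    refine (pow_le_pow_left₀ (norm_nonneg _)
      (h.norm_layerQuotDeriv_le hf hfs hd hds hB hs) 2).trans_eq ?_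
    rw [mul_pow, inv_pow, ← pow_mul]
  rw [intervalIntegral.integral_const_mul] at this
  exact this.trans (mul_le_mul_of_nonneg_left h.integral_inv_le (sq_nonneg _))

theorem norm_right_sub_layerQuot_le (h : LayerScale l k η Y) {B t : ℝ} (hf : Continuous f)
    (hfs : Continuous fs) (hd : ∀ s ∈ Ioo 0 l, HasDerivAt (fun x => f (x, t)) (fs (s, t)) s)
    (hds : ∀ s ∈ Ioo 0 l, HasDerivAt (fun x => fs (x, t)) (fss (s, t)) s)
    (hB : ∀ s ∈ Icc 0 l, ‖fss (s, t)‖ ≤ B) :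
    ‖fs (l, t) - layerQuot l k Y f (l, t)‖ ≤ 3 * B * (k * Y l ^ 3) := by
  have hl : l ∈ Icc 0 l := ⟨h.l_pos.le, le_rfl⟩
  obtain ⟨h1, -⟩ := h.norm_layerQuot_sub_le hf hfs hd hds hB hl
  have ha := h.mem_Ioo hl one_le_two le_rfl
  have h2 := norm_sub_le_of_hasDerivAt (f := fun x => fs (x, t)) (f' := fun x => fss (x, t))
    (a := l - 2 * (k * Y l ^ 3)) (b := l) (x := l) (B := B) (by fun_prop)
    (fun s hs => hds s ⟨ha.1.trans_le hs.1, hs.2⟩)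
    (fun s hs => hB s ⟨ha.1.le.trans hs.1, hs.2.le⟩) ⟨ha.2.le, le_rfl⟩
  have h3 := norm_sub_le (fs (l, t) - fs (l - 2 * (k * Y l ^ 3), t))
    (layerQuot l k Y f (l, t) - fs (l - 2 * (k * Y l ^ 3), t))
  rw [sub_sub_sub_cancel_right] at h3
  linarith

theorem integral_weight_layerQuot_le (h : LayerScale l k η Y) (hf : Continuous f) (t : ℝ) :
    ∫ s in (0:ℝ)..l, ‖Y s ^ 5 • layerQuot l k Y f (s, t)‖ ^ 2
      ≤ 20 / (3 * k ^ 5) * ∫ s in (0:ℝ)..l, (l - s) ^ 2 * ‖f (s, t)‖ ^ 2 := by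
  have cY := h.cY
  have hk := h.k_pos
  have cq := h.continuous_layerQuot hf
  have h1 := h.integral_comp_le (g := fun s => ‖f (s, t)‖ ^ 2) (by fun_prop)
    (fun s => sq_nonneg _) le_rfl one_le_two
  have h2 := h.integral_comp_le (g := fun s => ‖f (s, t)‖ ^ 2) (by fun_prop)
    (fun s => sq_nonneg _) one_le_two le_rfl
  have h3 : ∫ s in (0:ℝ)..l, ‖Y s ^ 5 • layerQuot l k Y f (s, t)‖ ^ 2
      ≤ ∫ s in (0:ℝ)..l, 2 / k ^ 2 * (Y s ^ 4 * ‖f (l - 1 * (k * Y s ^ 3), t)‖ ^ 2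
        + Y s ^ 4 * ‖f (l - 2 * (k * Y s ^ 3), t)‖ ^ 2) := by
    refine integral_mono_continuous h.l_pos.le (by fun_prop) (by fun_prop) fun s hs => ?_
    have hY := h.pos s
    simp only [layerQuot, norm_smul, mul_pow, Real.norm_eq_abs, sq_abs]
    set x := f (l - 1 * (k * Y s ^ 3), t)
    set y := f (l - 2 * (k * Y s ^ 3), t)
    have h4 : ‖x - y‖ ^ 2 ≤ 2 * (‖x‖ ^ 2 + ‖y‖ ^ 2) := by
      nlinarith [norm_sub_le x y, norm_nonneg (x - y), sq_nonneg (‖x‖ - ‖y‖)]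
    calc _ = Y s ^ 4 / k ^ 2 * ‖x - y‖ ^ 2 := by field_simp
      _ ≤ Y s ^ 4 / k ^ 2 * (2 * (‖x‖ ^ 2 + ‖y‖ ^ 2)) := by gcongr
      _ = _ := by ring
  rw [intervalIntegral.integral_const_mul, intervalIntegral.integral_add
    (Continuous.intervalIntegrable (by fun_prop) _ _)
    (Continuous.intervalIntegrable (by fun_prop) _ _)] at h3
  refine h3.trans ?_
  calc _ ≤ 2 / k ^ 2 * (5 / (3 * k ^ 3) * (∫ s in (0:ℝ)..l, (l - s) ^ 2 * ‖f (s, t)‖ ^ 2)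
        + 5 / (3 * k ^ 3) * ∫ s in (0:ℝ)..l, (l - s) ^ 2 * ‖f (s, t)‖ ^ 2) := by gcongr
    _ = _ := by field_simp; ring

theorem norm_layerQuot_le (h : LayerScale l k η Y) {V t : ℝ}
    (hV : ∀ s ∈ Icc 0 l, ‖f (s, t)‖ ≤ V) {s : ℝ} (hs : s ∈ Icc 0 l) :
    ‖layerQuot l k Y f (s, t)‖ ≤ 2 * V * (k * Y s ^ 3)⁻¹ := by
  have hσ := h.scale_pos s
  have h1 := hV _ (Ioo_subset_Icc_self (h.mem_Ioo hs le_rfl one_le_two))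
  have h2 := hV _ (Ioo_subset_Icc_self (h.mem_Ioo hs one_le_two le_rfl))
  rw [layerQuot, norm_smul, norm_inv, Real.norm_eq_abs, abs_of_pos hσ, mul_comm]
  gcongr
  dsimp only
  linarith [norm_sub_le (f (l - 1 * (k * Y s ^ 3), t)) (f (l - 2 * (k * Y s ^ 3), t))]

end LayerScale
end LayerBounds

section TrackBound

variable {H : Type*} [NormedAddCommGroup H] [InnerProductSpace ℝ H]

namespace TrackField

variable {l B c0 C0 k η : ℝ} {u us uss ut utt v vs vss vt vtt : ℝ × ℝ → H} {Y : ℝ → ℝ}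

theorem layer_pairing_eq (h : TrackField l B c0 C0 u us uss ut utt v vs vss vt vtt)
    (hY : LayerScale l k η Y) {x y : ℝ} (hx : 0 < x) (hy : 0 < y) :
    (∫ s in (0:ℝ)..l, ⟪vss (s, x) - layerQuotDeriv l k Y v vs (s, x), u (s, y)⟫)
        - ⟪vs (l, x) - layerQuot l k Y v (l, x), u (l, y)⟫
      = (∫ s in (0:ℝ)..l, ⟪v (s, x), uss (s, y)⟫)
        + ∫ s in (0:ℝ)..l, ⟪layerQuot l k Y v (s, x), us (s, y)⟫ := by
  have cu := h.wave.cw; have cus := h.wave.cws; have cuss := h.wave.cA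
  have cv := h.cv; have cvs := h.cvs; have cvss := h.cvss
  have cq := hY.continuous_layerQuot cv
  have cqd := hY.continuous_layerQuotDeriv cv cvs
  have hl := h.l_pos
  have h1 := integral_inner_deriv_right (f := fun s => v (s, x)) (g := fun s => us (s, y))
    (f' := fun s => vs (s, x)) (g' := fun s => uss (s, y)) hl.le (by fun_prop) (by fun_prop)
    (by fun_prop) (by fun_prop) (h.ds x hx) (h.wave.dA y hy)
  have h2 := integral_inner_deriv_right (f := fun s => vs (s, x) - layerQuot l k Y v (s, x))
    (g := fun s => u (s, y))
    (f' := fun s => vss (s, x) - layerQuotDeriv l k Y v vs (s, x)) (g' := fun s => us (s, y))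
    hl.le (by fun_prop) (by fun_prop) (by fun_prop) (by fun_prop)
    (fun s hs => (h.dss x hx s hs).sub (hY.hasDerivAt_layerQuot_left (h.ds x hx) s hs))
    (h.wave.ds y hy)
  have h3 : ∫ s in (0:ℝ)..l, ⟪vs (s, x) - layerQuot l k Y v (s, x), us (s, y)⟫
      = (∫ s in (0:ℝ)..l, ⟪vs (s, x), us (s, y)⟫)
        - ∫ s in (0:ℝ)..l, ⟪layerQuot l k Y v (s, x), us (s, y)⟫ := by
    rw [← intervalIntegral.integral_sub (Continuous.intervalIntegrable (by fun_prop) _ _)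
      (Continuous.intervalIntegrable (by fun_prop) _ _)]
    simp only [inner_sub_left]
  simp only [h.wave.left y hy, h.wave.right y hy, h.left x hx, inner_zero_right, inner_zero_left,
    sub_zero, zero_sub] at h1 h2
  linarith

theorem layer_integral_sq_le (h : TrackField l B c0 C0 u us uss ut utt v vs vss vt vtt)
    (hY : LayerScale l k η Y) {t : ℝ} (ht : 0 < t) :
    ∫ s in (0:ℝ)..l, ‖vss (s, t) - layerQuotDeriv l k Y v vs (s, t)‖ ^ 2
      ≤ 2 * (l * B ^ 2 + (6 / 5 * k * B) ^ 2 * (5 * (l + 1))) := by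
  have cvss := h.cvss
  have cqd := hY.continuous_layerQuotDeriv h.cv h.cvs
  have hl := h.l_pos
  have hq := hY.integral_layerQuotDeriv_sq_le h.cv h.cvs (h.ds t ht) (h.dss t ht) (h.vss_le t ht)
  have h1 : ∫ s in (0:ℝ)..l, ‖vss (s, t) - layerQuotDeriv l k Y v vs (s, t)‖ ^ 2
      ≤ ∫ s in (0:ℝ)..l, 2 * (B ^ 2 + ‖layerQuotDeriv l k Y v vs (s, t)‖ ^ 2) := by
    refine integral_mono_continuous hl.le (by fun_prop) (by fun_prop) fun s hs => ?_
    have hB := h.vss_le t ht s hs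
    set x := vss (s, t)
    set y := layerQuotDeriv l k Y v vs (s, t)
    have h4 : ‖x - y‖ ^ 2 ≤ 2 * (‖x‖ ^ 2 + ‖y‖ ^ 2) := by
      nlinarith [norm_sub_le x y, norm_nonneg (x - y), sq_nonneg (‖x‖ - ‖y‖)]
    have h5 : ‖x‖ ^ 2 ≤ B ^ 2 := by gcongr
    linarith
  rw [intervalIntegral.integral_const_mul, intervalIntegral.integral_add
    (Continuous.intervalIntegrable (by fun_prop) _ _)
    (Continuous.intervalIntegrable (by fun_prop) _ _), intervalIntegral.integral_const,
    smul_eq_mul, sub_zero] at h1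
  linarith

theorem layer_coer (h : TrackField l B c0 C0 u us uss ut utt v vs vss vt vtt)
    (hY : LayerScale l k η Y) {t : ℝ} (ht : 0 < t) :
    c0 / 2 * (∫ s in (0:ℝ)..l, ‖uss (s, t)‖ ^ 2)
      ≤ -((∫ s in (0:ℝ)..l, ⟪vtt (s, t), uss (s, t)⟫)
          + ∫ s in (0:ℝ)..l, ⟪layerQuot l k Y vtt (s, t), us (s, t)⟫)
        + (C0 + 40 * C0 / (3 * k ^ 5 * c0) * l ^ 2) * (l + fieldEnergy l u us ut t)
        + 40 * C0 / (3 * k ^ 5 * c0) * ∫ s in (0:ℝ)..l, (l - s) ^ 2 * ‖uss (s, t)‖ ^ 2 := by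
  have cu := h.wave.cw; have cus := h.wave.cws; have cuss := h.wave.cA; have cut := h.wave.cwt
  have cvtt := h.cvtt
  have cq := hY.continuous_layerQuot cvtt
  have cY := hY.cY
  have ci : Continuous fun s => (Y s ^ 5)⁻¹ :=
    (cY.pow 5).inv₀ fun s => (pow_pos (hY.pos s) 5).ne'
  have hl := h.l_pos; have hc0 := h.c0_pos; have hC0 := h.C0_pos; have hk := hY.k_pos
  have h1 := integral_mono_continuous hl.le (f := fun s => c0 * ‖uss (s, t)‖ ^ 2)
    (g := fun s => -⟪vtt (s, t), uss (s, t)⟫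
      + (C0 + C0 * (‖u (s, t)‖ ^ 2 + ‖us (s, t)‖ ^ 2 + ‖ut (s, t)‖ ^ 2)))
    (by fun_prop) (by fun_prop) (fun s hs => (h.coer t ht s hs).trans_eq (by ring))
  rw [intervalIntegral.integral_add (Continuous.intervalIntegrable (by fun_prop) _ _)
      (Continuous.intervalIntegrable (by fun_prop) _ _),
    intervalIntegral.integral_add (Continuous.intervalIntegrable (by fun_prop) _ _)
      (Continuous.intervalIntegrable (by fun_prop) _ _),
    intervalIntegral.integral_neg, intervalIntegral.integral_const,
    intervalIntegral.integral_const_mul, intervalIntegral.integral_const_mul, smul_eq_mul,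
    sub_zero] at h1
  change _ ≤ -_ + (l * C0 + C0 * fieldEnergy l u us ut t) at h1
  have hδ : 0 < 4 / c0 := by positivity
  have h2 := abs_integral_inner_le (f := fun s => Y s ^ 5 • layerQuot l k Y vtt (s, t))
    (g := fun s => (Y s ^ 5)⁻¹ • us (s, t)) hl.le hδ (by fun_prop) (by fun_prop)
  have e1 : ∀ s, ⟪Y s ^ 5 • layerQuot l k Y vtt (s, t), (Y s ^ 5)⁻¹ • us (s, t)⟫
      = ⟪layerQuot l k Y vtt (s, t), us (s, t)⟫ := fun s => by
    rw [real_inner_smul_left, real_inner_smul_right, ← mul_assoc,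
      mul_inv_cancel₀ (pow_pos (hY.pos s) 5).ne', one_mul]
  simp only [e1] at h2
  have h3 := integral_norm_sq_div_le (g := fun s => us (s, t)) (g' := fun s => uss (s, t))
    (η := η) (X := fun s => Y s ^ 5) hl.le (by fun_prop) (by fun_prop) (h.wave.dA t ht)
    (h.wave.right t ht) (by fun_prop) (fun s => pow_pos (hY.pos s) 5) hY.pow_eq
  have h4 := hY.integral_weight_layerQuot_le cvtt t
  have h5 := h.integral_weight_le cvtt (ω := fun s => (l - s) ^ 2) (W := l ^ 2) (by fun_prop)
    (fun s _ => sq_nonneg _) (fun s hs =>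
      pow_le_pow_left₀ (by linarith [hs.2]) (by linarith [hs.1]) 2) (h.vtt_le t ht)
  have h6 := h4.trans (mul_le_mul_of_nonneg_left h5 (by positivity : 0 ≤ 20 / (3 * k ^ 5)))
  have h7 := mul_le_mul_of_nonneg_left h6 (by positivity : 0 ≤ 2 / c0)
  have h8 := mul_le_mul_of_nonneg_left h3 (by positivity : 0 ≤ c0 / 8)
  have e2 : ∀ m e : ℝ, 2 / c0 * (20 / (3 * k ^ 5) * (C0 * m + C0 * l ^ 2 * e))
      = 40 * C0 / (3 * k ^ 5 * c0) * l ^ 2 * e + 40 * C0 / (3 * k ^ 5 * c0) * m := fun m e => by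
    field_simp
    ring
  rw [e2] at h7
  have e3 : ∀ p q : ℝ, (4 / c0 * p + (4 / c0)⁻¹ * q) / 2 = 2 / c0 * p + c0 / 8 * q := fun p q => by
    field_simp
    ring
  rw [e3] at h2
  have h9 := (abs_le.1 h2).2
  linarith

theorem layer_second_le (h : TrackField l B c0 C0 u us uss ut utt v vs vss vt vtt)
    (hY : LayerScale l k η Y) {t : ℝ} (ht : 0 < t) :
    |∫ s in (0:ℝ)..l, ⟪vss (s, t) - layerQuotDeriv l k Y v vs (s, t), utt (s, t)⟫|
      ≤ c0 / 4 * (∫ s in (0:ℝ)..l, ‖uss (s, t)‖ ^ 2)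
        + c0 / 4 * (l + fieldEnergy l u us ut t)
        + C0 / c0 * (2 * (l * B ^ 2 + (6 / 5 * k * B) ^ 2 * (5 * (l + 1)))) := by
  have cutt := h.wave.cwtt
  have cvss := h.cvss
  have cqd := hY.continuous_layerQuotDeriv h.cv h.cvs
  have hl := h.l_pos; have hc0 := h.c0_pos; have hC0 := h.C0_pos
  have hδ : 0 < 2 * C0 / c0 := by positivity
  have h1 := abs_integral_inner_le
    (f := fun s => vss (s, t) - layerQuotDeriv l k Y v vs (s, t))
    (g := fun s => utt (s, t)) hl.le hδ (by fun_prop) (by fun_prop)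
  have h2 := h.integral_weight_le cutt (ω := fun _ => 1) (W := 1) (by fun_prop)
    (fun s _ => zero_le_one) (fun s hs => le_rfl) (h.utt_le t ht)
  simp only [one_mul, mul_one] at h2
  have h3 := mul_le_mul_of_nonneg_left h2 (by positivity : 0 ≤ c0 / (4 * C0))
  have h4 := mul_le_mul_of_nonneg_left (h.layer_integral_sq_le hY ht)
    (by positivity : 0 ≤ C0 / c0)
  have e1 : ∀ m e : ℝ, c0 / (4 * C0) * (C0 * m + C0 * e) = c0 / 4 * m + c0 / 4 * e := fun m e => by
    field_simp
  rw [e1] at h3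
  have e3 : ∀ p q : ℝ, (2 * C0 / c0 * p + (2 * C0 / c0)⁻¹ * q) / 2
      = C0 / c0 * p + c0 / (4 * C0) * q := fun p q => by
    field_simp
    ring
  rw [e3] at h1
  linarith

theorem exists_layer_first_le (h : TrackField l B c0 C0 u us uss ut utt v vs vss vt vtt) {k : ℝ}
    (hk : 0 < k) : ∃ C, 0 ≤ C ∧ ∀ {η Y}, LayerScale l k η Y →
      |(∫ s in (0:ℝ)..l, ⟪vt (s, 1), uss (s, 1)⟫)
        + ∫ s in (0:ℝ)..l, ⟪layerQuot l k Y vt (s, 1), us (s, 1)⟫| ≤ C := by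
  have cus := h.wave.cws; have cuss := h.wave.cA; have cvt := h.cvt
  have hl := h.l_pos
  obtain ⟨V, hV⟩ := (isCompact_Icc (a := (0:ℝ)) (b := l)).exists_bound_of_continuousOn
    (f := fun s => vt (s, 1)) (by fun_prop)
  obtain ⟨U, hU⟩ := (isCompact_Icc (a := (0:ℝ)) (b := l)).exists_bound_of_continuousOn
    (f := fun s => uss (s, 1)) (by fun_prop)
  have hl0 : (0:ℝ) ∈ Icc 0 l := ⟨le_rfl, hl.le⟩
  have hV0 : 0 ≤ V := (norm_nonneg _).trans (hV 0 hl0)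
  have hU0 : 0 ≤ U := (norm_nonneg _).trans (hU 0 hl0)
  refine ⟨|∫ s in (0:ℝ)..l, ⟪vt (s, 1), uss (s, 1)⟫| + 2 * V * U * (l + 1) ^ 2 / k * l,
    by positivity, fun {η Y} hY => (abs_add_le _ _).trans (add_le_add le_rfl ?_)⟩
  have := intervalIntegral.norm_integral_le_of_norm_le_const (a := 0) (b := l)
    (f := fun s => ⟪layerQuot l k Y vt (s, 1), us (s, 1)⟫)
    (C := 2 * V * U * (l + 1) ^ 2 / k) (fun s hs => ?_)
  · simpa [abs_of_pos hl] using this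
  · rw [uIoc_of_le hl.le] at hs
    have hs' : s ∈ Icc 0 l := Ioc_subset_Icc_self hs
    have hYs := hY.pos s
    have h1 := hY.norm_layerQuot_le hV hs'
    have h2 := norm_sub_le_of_hasDerivAt (f := fun x => us (x, 1)) (f' := fun x => uss (x, 1))
      (a := s) (b := l) (x := l) (B := U) (by fun_prop)
      (fun x hx => h.wave.dA 1 one_pos x ⟨hs.1.trans_le hx.1, hx.2⟩)
      (fun x hx => hU x ⟨hs.1.le.trans hx.1, hx.2.le⟩) ⟨hs.2, le_rfl⟩
    rw [h.wave.right 1 one_pos, zero_sub, norm_neg] at h2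
    have h3 : l - s ≤ Y s ^ 5 := by rw [hY.pow_eq s hs']; linarith [hY.η_pos]
    have h4 := hY.le_add_one hs'
    calc ‖⟪layerQuot l k Y vt (s, 1), us (s, 1)⟫‖
        ≤ ‖layerQuot l k Y vt (s, 1)‖ * ‖us (s, 1)‖ := norm_inner_le_norm _ _
      _ ≤ (2 * V * (k * Y s ^ 3)⁻¹) * (U * Y s ^ 5) := by
        gcongr
        exact h2.trans (by gcongr)
      _ = 2 * V * U * Y s ^ 2 / k := by field_simp
      _ ≤ _ := by gcongr

end TrackField
end TrackBound

section TrackBoundFinal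

variable {H : Type*} [NormedAddCommGroup H] [InnerProductSpace ℝ H]

namespace TrackField

variable {l B c0 C0 k η : ℝ} {u us uss ut utt v vs vss vt vtt : ℝ × ℝ → H} {Y : ℝ → ℝ}

/-- A layer thin enough that its boundary pairing with three given quantities stays below one. -/
theorem exists_layer (h : TrackField l B c0 C0 u us uss ut utt v vs vss vt vtt) (T : ℝ) :
    ∃ η Y, LayerScale l (l / (4 * (l + 1) ^ 3)) η Y ∧ ∀ t ∈ Icc 1 T, ∀ w : H,
      w = u (l, t) ∨ w = ut (l, t) ∨ w = utt (l, t) →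
      |⟪vs (l, t) - layerQuot l (l / (4 * (l + 1) ^ 3)) Y v (l, t), w⟫| ≤ 1 := by
  have cu := h.wave.cw; have cut := h.wave.cwt; have cutt := h.wave.cwtt
  have hl := h.l_pos; have hB := h.B_nonneg
  obtain ⟨k, hk⟩ : ∃ k, k = l / (4 * (l + 1) ^ 3) := ⟨_, rfl⟩
  rw [← hk]
  have hk0 : 0 < k := by rw [hk]; positivity
  obtain ⟨Z0, hZ0⟩ := (isCompact_Icc (a := (1:ℝ)) (b := T)).exists_bound_of_continuousOn
    (f := fun t => (u (l, t), ut (l, t), utt (l, t))) (by fun_prop)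
  obtain ⟨Z, hZ⟩ : ∃ Z, Z = max Z0 0 := ⟨_, rfl⟩
  have hZn : 0 ≤ Z := hZ ▸ le_max_right _ _
  obtain ⟨ε, hε⟩ : ∃ ε, ε = 1 / (1 + 3 * B * k * Z) := ⟨_, rfl⟩
  have hden : 1 ≤ 1 + 3 * B * k * Z := by
    have : 0 ≤ 3 * B * k * Z := by positivity
    linarith
  have hε0 : 0 < ε := by rw [hε]; positivity
  have hε1 : ε ≤ 1 := by rw [hε]; exact (div_le_one (by linarith)).2 hden
  have hεZ : 3 * B * k * Z * ε ≤ 1 := by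
    rw [hε, mul_one_div, div_le_one (by linarith)]
    linarith
  obtain ⟨Y, hY⟩ := exists_layerScale hl (pow_pos hε0 5) (pow_le_one₀ hε0.le hε1)
  rw [← hk] at hY
  refine ⟨ε ^ 5, Y, hY, fun t ht w hw => ?_⟩
  have ht0 : 0 < t := by linarith [ht.1]
  have hYl : Y l = ε := by
    have := hY.pow_eq l ⟨hl.le, le_rfl⟩
    rw [sub_self, zero_add] at this
    exact (pow_left_inj₀ (hY.pos l).le hε0.le (by norm_num)).1 this
  have hb := hY.norm_right_sub_layerQuot_le h.cv h.cvs (h.ds t ht0) (h.dss t ht0) (h.vss_le t ht0)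
  rw [hYl] at hb
  have hwZ : ‖w‖ ≤ Z := by
    have h1 := (hZ0 t ht).trans (hZ ▸ le_max_left _ _)
    have h2 := norm_prod_le_iff.1 h1
    have h3 := norm_prod_le_iff.1 h2.2
    rcases hw with rfl | rfl | rfl
    exacts [h2.1, h3.1, h3.2]
  have hε3 : ε ^ 3 ≤ ε := pow_le_of_le_one hε0.le hε1 (by norm_num)
  calc _ ≤ ‖vs (l, t) - layerQuot l k Y v (l, t)‖ * ‖w‖ := abs_real_inner_le_norm _ _
    _ ≤ 3 * B * (k * ε) * Z := by
      gcongr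
      exact hb.trans (by gcongr)
    _ ≤ 1 := by linarith

set_option maxHeartbeats 1000000 in
theorem exists_bound [CompleteSpace H]
    (h : TrackField l B c0 C0 u us uss ut utt v vs vss vt vtt) {μ : ℝ} (hμ : 0 < μ) :
    ∃ C, 0 ≤ C ∧ ∀ T ρ M : ℝ, 1 ≤ T → 0 < ρ → ρ ≤ 1 → 1 ≤ M →
      (∀ t ∈ Icc 1 (T + 2 * ρ), 1 + fieldEnergy l u us ut t ≤ M) →
      ∫ t in (1:ℝ)..T, Real.exp (-μ * t) * (∫ s in (0:ℝ)..l, ‖uss (s, t)‖ ^ 2)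
        ≤ C * (M + 1 / ρ ^ 2) := by
  have cu := h.wave.cw; have cus := h.wave.cws; have cut := h.wave.cwt; have cuss := h.wave.cA
  have cutt := h.wave.cwtt
  have cv := h.cv; have cvs := h.cvs; have cvss := h.cvss; have cvt := h.cvt; have cvtt := h.cvtt
  have hl := h.l_pos; have hc0 := h.c0_pos; have hC0 := h.C0_pos; have hB := h.B_nonneg
  obtain ⟨k, hk⟩ : ∃ k, k = l / (4 * (l + 1) ^ 3) := ⟨_, rfl⟩
  have hk0 : 0 < k := by rw [hk]; positivity
  obtain ⟨Cw, hCw, hw⟩ := h.exists_weighted_bound hμ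
  obtain ⟨C7, h7, hC7⟩ := h.exists_layer_first_le hk0
  obtain ⟨D, hD⟩ : ∃ x : ℝ, x = 40 * C0 / (3 * k ^ 5 * c0) := ⟨_, rfl⟩
  obtain ⟨G, hG⟩ : ∃ x : ℝ, x = 2 * (l * B ^ 2 + (6 / 5 * k * B) ^ 2 * (5 * (l + 1))) := ⟨_, rfl⟩
  have hD0 : 0 < D := by rw [hD]; positivity
  have hG0 : 0 ≤ G := by rw [hG]; positivity
  obtain ⟨C3, hC3⟩ : ∃ x : ℝ, x = (C0 + D * l ^ 2) * (l + 1) := ⟨_, rfl⟩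
  obtain ⟨C4, hC4⟩ : ∃ x : ℝ, x = c0 / 4 * (l + 1) + C0 / c0 * G + 1 := ⟨_, rfl⟩
  obtain ⟨C5, hC5⟩ : ∃ x : ℝ, x = G + 2 := ⟨_, rfl⟩
  obtain ⟨C6, hC6⟩ : ∃ x : ℝ, x = 2 * (l ^ 2 * G) + 2 := ⟨_, rfl⟩
  have h3 : 0 ≤ C3 := by rw [hC3]; positivity
  have h4 : 0 ≤ C4 := by rw [hC4]; positivity
  have h5 : 0 ≤ C5 := by rw [hC5]; positivity
  have h6 : 0 ≤ C6 := by rw [hC6]; positivity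
  obtain ⟨C, hC⟩ : ∃ x : ℝ, x = C3 + C4 + C5 + C6 + C7 := ⟨_, rfl⟩
  have hCn : 0 ≤ C := by rw [hC]; positivity
  have hNc : Continuous fun t => ∫ s in (0:ℝ)..l, ‖uss (s, t)‖ ^ 2 :=
    continuous_integral_right (f := fun z => ‖uss z‖ ^ 2) (by fun_prop) 0 l
  have hmc : Continuous fun t => ∫ s in (0:ℝ)..l, (l - s) ^ 2 * ‖uss (s, t)‖ ^ 2 :=
    continuous_integral_right (f := fun z => (l - z.1) ^ 2 * ‖uss z‖ ^ 2) (by fun_prop) 0 l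
  have hm0 : ∀ t, 0 ≤ ∫ s in (0:ℝ)..l, (l - s) ^ 2 * ‖uss (s, t)‖ ^ 2 := fun t =>
    integral_nonneg hl.le fun s _ => by positivity
  have hN0 : ∀ t, 0 ≤ ∫ s in (0:ℝ)..l, ‖uss (s, t)‖ ^ 2 := fun t =>
    integral_nonneg hl.le fun s _ => by positivity
  refine ⟨4 / c0 * ((2 * C + 2 * μ * C + μ ^ 2 * (1 + C)) / μ + 1 + 5 * C + 2 * μ * (1 + C)
    + D * Cw), by positivity, fun T ρ M hT hρ hρ1 hM hE' => ?_⟩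
  have hE : ∀ t ∈ Icc 1 (T + ρ), 1 + fieldEnergy l u us ut t ≤ M := fun t ht =>
    hE' t ⟨ht.1, by linarith [ht.2]⟩
  have hwR := hw (T + ρ) ρ M (by linarith) hρ hM (fun t ht => hE' t ⟨ht.1, by linarith [ht.2]⟩)
  obtain ⟨η, Y, hY, hbd⟩ := h.exists_layer (T + ρ)
  rw [← hk] at hY hbd
  have cq := hY.continuous_layerQuot cv
  have cqt := hY.continuous_layerQuot cvt
  have cqtt := hY.continuous_layerQuot cvtt
  have cqd := hY.continuous_layerQuotDeriv cv cvs
  obtain ⟨δ, hδ⟩ : ∃ δ : ℝ × ℝ → H, δ = fun z => vss z - layerQuotDeriv l k Y v vs z := ⟨_, rfl⟩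
  obtain ⟨b, hb⟩ : ∃ b : ℝ → H, b = fun t => vs (l, t) - layerQuot l k Y v (l, t) := ⟨_, rfl⟩
  have cδ : Continuous δ := by rw [hδ]; fun_prop
  have cb : Continuous b := by rw [hb]; fun_prop
  have hlc : l ∈ Icc 0 l := ⟨hl.le, le_rfl⟩
  have hδ2 : ∀ t, 0 < t → ∫ s in (0:ℝ)..l, ‖δ (s, t)‖ ^ 2 ≤ G := fun t ht => by
    rw [hG, hδ]; exact h.layer_integral_sq_le hY ht
  have hrep : ∀ x y, 0 < x → 0 < y →
      (∫ s in (0:ℝ)..l, ⟪δ (s, x), u (s, y)⟫) - ⟪b x, u (l, y)⟫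
      = (∫ s in (0:ℝ)..l, ⟪v (s, x), uss (s, y)⟫)
        + ∫ s in (0:ℝ)..l, ⟪layerQuot l k Y v (s, x), us (s, y)⟫ := fun x y hx hy => by
    rw [hδ, hb]; exact h.layer_pairing_eq hY hx hy
  have key := integral_le_of_diag
    (a := fun z => (∫ s in (0:ℝ)..l, ⟪δ (s, z.1), u (s, z.2)⟫) - ⟪b z.1, u (l, z.2)⟫)
    (a1 := fun z => (∫ s in (0:ℝ)..l, ⟪vt (s, z.1), uss (s, z.2)⟫)
      + ∫ s in (0:ℝ)..l, ⟪layerQuot l k Y vt (s, z.1), us (s, z.2)⟫)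
    (a2 := fun z => (∫ s in (0:ℝ)..l, ⟪δ (s, z.1), ut (s, z.2)⟫) - ⟪b z.1, ut (l, z.2)⟫)
    (a11 := fun z => (∫ s in (0:ℝ)..l, ⟪vtt (s, z.1), uss (s, z.2)⟫)
      + ∫ s in (0:ℝ)..l, ⟪layerQuot l k Y vtt (s, z.1), us (s, z.2)⟫)
    (a22 := fun z => (∫ s in (0:ℝ)..l, ⟪δ (s, z.1), utt (s, z.2)⟫) - ⟪b z.1, utt (l, z.2)⟫)
    ((continuous_integral_pair cδ cu 0 l).sub (by fun_prop))
    ((continuous_integral_pair cvt cuss 0 l).add (continuous_integral_pair cqt cus 0 l))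
    ((continuous_integral_pair cδ cut 0 l).sub (by fun_prop))
    ((continuous_integral_pair cvtt cuss 0 l).add (continuous_integral_pair cqtt cus 0 l))
    ((continuous_integral_pair cδ cutt 0 l).sub (by fun_prop))
    (fun x y hx hy => ((hasDerivAt_integral_inner_left (g := fun s => uss (s, y)) cv cvt
      (by fun_prop) hl.le hx h.dt).add
      (hasDerivAt_integral_inner_left (g := fun s => us (s, y)) cq cqt (by fun_prop) hl.le hx
        (hY.hasDerivAt_layerQuot_right h.dt))).congr_of_eventuallyEq
      (by filter_upwards [lt_mem_nhds hx] with z hz using hrep z y hz hy))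
    (fun x y hx hy => (hasDerivAt_integral_inner_right (f := fun s => δ (s, x)) cu cut
      (by fun_prop) hl.le hy h.wave.dt).sub
      (by simpa using (hasDerivAt_const y (b x)).inner ℝ (h.wave.dt l hlc y hy)))
    (fun x y hx hy => (hasDerivAt_integral_inner_left (g := fun s => uss (s, y)) cvt cvtt
      (by fun_prop) hl.le hx h.dtt).add
      (hasDerivAt_integral_inner_left (g := fun s => us (s, y)) cqt cqtt (by fun_prop) hl.le hx
        (hY.hasDerivAt_layerQuot_right h.dtt)))
    (fun x y hx hy => (hasDerivAt_integral_inner_right (f := fun s => δ (s, x)) cut cutt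
      (by fun_prop) hl.le hy h.wave.dtt).sub
      (by simpa using (hasDerivAt_const y (b x)).inner ℝ (h.wave.dtt l hlc y hy)))
    (q := fun t => c0 / 4 * ∫ s in (0:ℝ)..l, ‖uss (s, t)‖ ^ 2)
    (R := fun t => D * ∫ s in (0:ℝ)..l, (l - s) ^ 2 * ‖uss (s, t)‖ ^ 2)
    (by fun_prop) (by fun_prop) (fun t _ => mul_nonneg (by positivity) (hN0 t))
    (fun t _ => mul_nonneg hD0.le (hm0 t)) hμ hCn hM hT hρ (C := C) ?_ ?_ ?_ ?_ ?_
  · have e1 : ∀ a x t : ℝ, Real.exp (-μ * t) * (a * x) = a * (Real.exp (-μ * t) * x) :=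
      fun a x t => by ring
    simp only [e1] at key
    rw [intervalIntegral.integral_const_mul, intervalIntegral.integral_const_mul] at key
    have hDw := mul_le_mul_of_nonneg_left hwR hD0.le
    have := mul_le_mul_of_nonneg_left (key.trans (add_le_add_right hDw _))
      (by positivity : 0 ≤ 4 / c0)
    rw [← mul_assoc, show 4 / c0 * (c0 / 4) = 1 by field_simp, one_mul] at this
    linarith
  · intro t ht
    have ht0 : 0 < t := by linarith [ht.1]
    have h1 := h.layer_coer hY ht0
    rw [← hD] at h1
    have hEt := hE t ht
    have f0 : l + fieldEnergy l u us ut t ≤ (l + 1) * M := by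
      have : l ≤ l * M := le_mul_of_one_le_right hl.le hM
      linarith
    have f1 : (C0 + D * l ^ 2) * (l + fieldEnergy l u us ut t) ≤ C3 * M := by
      rw [hC3, mul_assoc]; gcongr
    have f2 : C3 * M ≤ C * M := by
      gcongr
      rw [hC]; linarith
    simp only
    linarith
  · intro t ht
    have ht0 : 0 < t := by linarith [ht.1]
    have h1 := h.layer_second_le hY ht0
    have h2 := hbd t ht _ (Or.inr (Or.inr rfl))
    have hEt := hE t ht
    have f0 : l + fieldEnergy l u us ut t ≤ (l + 1) * M := by
      have : l ≤ l * M := le_mul_of_one_le_right hl.le hM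
      linarith
    have f1 : c0 / 4 * (l + fieldEnergy l u us ut t) ≤ c0 / 4 * ((l + 1) * M) := by gcongr
    have f2 : C0 / c0 * G + 1 ≤ (C0 / c0 * G + 1) * M :=
      le_mul_of_one_le_right (by positivity) hM
    have f3 : C4 * M ≤ C * M := by
      gcongr
      rw [hC]; linarith
    have f4 : C4 * M = c0 / 4 * ((l + 1) * M) + (C0 / c0 * G + 1) * M := by rw [hC4]; ring
    rw [← hG] at h1
    have h3' := abs_sub (∫ s in (0:ℝ)..l, ⟪δ (s, t), utt (s, t)⟫) (⟪b t, utt (l, t)⟫)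
    simp only
    rw [hδ, hb] at h3' ⊢
    linarith
  · intro t ht
    have ht0 : 0 < t := by linarith [ht.1]
    have h1 := abs_integral_inner_le (f := fun s => δ (s, t))
      (g := fun s => ut (s, t)) hl.le one_pos (by fun_prop) (by fun_prop)
    have h2 := h.wave.integral_wt_sq_le_fieldEnergy hl.le t
    have h3' := hδ2 t ht0
    have h4' := hbd t ht _ (Or.inr (Or.inl rfl))
    have hEt := hE t ht
    have h5' := abs_sub (∫ s in (0:ℝ)..l, ⟪δ (s, t), ut (s, t)⟫) (⟪b t, ut (l, t)⟫)
    have f1 : G ≤ G * M := le_mul_of_one_le_right hG0 hM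
    have f2 : C5 * M ≤ C * M := by
      gcongr
      rw [hC]; linarith
    have f3 : 0 ≤ G * M := by positivity
    have f4 : C5 * M = G * M + 2 * M := by rw [hC5]; ring
    have f5 : |⟪b t, ut (l, t)⟫| ≤ 1 := by rw [hb]; exact h4'
    simp only [inv_one, one_mul] at h1
    simp only
    linarith
  · intro t ht
    have ht0 : 0 < t := by linarith [ht.1]
    have h1 := h.sq_integral_inner_le (f := fun s => δ (s, t)) (by fun_prop) ht0
    have hEt := hE t ht
    have he0 := h.fieldEnergy_nonneg t
    have f5 : ⟪b t, u (l, t)⟫ ^ 2 ≤ 1 := by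
      rw [← sq_abs, hb]
      exact pow_le_one₀ (abs_nonneg _) (hbd t ht _ (Or.inl rfl))
    have f6 : l ^ 2 * (∫ s in (0:ℝ)..l, ‖δ (s, t)‖ ^ 2) * fieldEnergy l u us ut t
        ≤ l ^ 2 * G * M := by
      gcongr
      · exact hδ2 t ht0
      · linarith
    have f7 : ∀ x y : ℝ, (x - y) ^ 2 ≤ 2 * x ^ 2 + 2 * y ^ 2 := fun x y => by
      nlinarith [sq_nonneg (x + y)]
    have f8 := f7 (∫ s in (0:ℝ)..l, ⟪δ (s, t), u (s, t)⟫) (⟪b t, u (l, t)⟫)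
    have f2 : C6 * M ≤ C * M := by
      gcongr
      rw [hC]; linarith
    have f4 : C6 * M = 2 * (l ^ 2 * G * M) + 2 * M := by rw [hC6]; ring
    simp only
    linarith
  · have := hC7 hY
    simp only
    rw [hC]; linarith

end TrackField
end TrackBoundFinal

section TrackDecay

variable {H : Type*} [NormedAddCommGroup H] [InnerProductSpace ℝ H] [CompleteSpace H]

/-- Exponential decay of the tracking energy under a forcing that is an exponentially small
multiple of the second space derivative of the tracking error. -/
theorem TrackField.exists_exp_decay {l B c0 C0 : ℝ} {u us uss ut utt v vs vss vt vtt : ℝ × ℝ → H}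
    (h : TrackField l B c0 C0 u us uss ut utt v vs vss vt vtt)
    {K Kp : ℝ → H →L[ℝ] H} {Kv : ℝ × ℝ → H →L[ℝ] H} {k0 k1 k2 d0 d1 : ℝ}
    (hC : WaveCoeff l K Kp Kv k0 k1 k2 d0 d1) {A F : ℝ × ℝ → H}
    (hw : WaveField l K u us ut utt A) (hF : Continuous F)
    (heq : ∀ s ∈ Icc 0 l, ∀ t, 0 < t →
      utt (s, t) = A (s, t) - Kv (s, t) (ut (s, t)) - Kp s (u (s, t)) + F (s, t))
    {μ Cf : ℝ} (hμ : 0 < μ) (hFle : ∀ s ∈ Icc 0 l, ∀ t, 0 < t →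
      ‖F (s, t)‖ ≤ Cf * Real.exp (-μ * t) * (1 + ‖uss (s, t)‖ + ‖us (s, t)‖)) :
    ∃ C > 0, ∃ lam > 0, ∀ t, 1 ≤ t → fieldEnergy l u us ut t ≤ C * Real.exp (-lam * t) := by
  have cu := h.wave.cw; have cus := h.wave.cws; have cut := h.wave.cwt; have cuss := h.wave.cA
  have hl := h.l_pos
  obtain ⟨c, hc, CL, hCL, hLyap⟩ := hC.exists_lyapunov
  obtain ⟨L, L', h1, h2, h3, -⟩ := hLyap hw hF heq
  obtain ⟨Cb, hCb, hbound⟩ := h.exists_bound hμ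
  have hE0 := h.fieldEnergy_nonneg
  have hE : ∀ t, 0 < t → fieldEnergy l u us ut t ≤ L t / c := fun t ht =>
    (le_div_iff₀' hc).2 (h3 t ht)
  have hNc : Continuous fun t => ∫ s in (0:ℝ)..l, ‖uss (s, t)‖ ^ 2 :=
    continuous_integral_right (f := fun z => ‖uss z‖ ^ 2) (by fun_prop) 0 l
  have hN0 : ∀ t, 0 ≤ ∫ s in (0:ℝ)..l, ‖uss (s, t)‖ ^ 2 := fun t =>
    integral_nonneg hl.le fun s _ => by positivity
  have hL0 : ∀ t, 0 < t → 0 ≤ L t := fun t ht =>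
    (mul_nonneg hc.le (hE0 t)).trans (h3 t ht)
  have hmax : ∀ t : ℝ, 1 ≤ t → max t (1 / 2) = t := fun t ht => max_eq_left (by linarith)
  have hFint : ∀ t, 0 < t → ∫ s in (0:ℝ)..l, ‖F (s, t)‖ ^ 2
      ≤ 3 * Cf ^ 2 * Real.exp (-(2 * μ) * t)
        * (l + (∫ s in (0:ℝ)..l, ‖uss (s, t)‖ ^ 2) + fieldEnergy l u us ut t) := by
    intro t ht
    have hee : Real.exp (-(2 * μ) * t) = Real.exp (-μ * t) ^ 2 := by
      rw [sq, ← Real.exp_add]; ring_nf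
    have := integral_mono_continuous hl.le (f := fun s => ‖F (s, t)‖ ^ 2)
      (g := fun s => 3 * Cf ^ 2 * Real.exp (-(2 * μ) * t) * (1 + ‖uss (s, t)‖ ^ 2
        + (‖u (s, t)‖ ^ 2 + ‖us (s, t)‖ ^ 2 + ‖ut (s, t)‖ ^ 2)))
      (by fun_prop) (by fun_prop) (fun s hs => by
        have e1 : ∀ x y : ℝ, (1 + x + y) ^ 2 ≤ 3 * (1 + x ^ 2 + y ^ 2) := fun x y => by
          nlinarith [sq_nonneg (x - 1), sq_nonneg (y - 1), sq_nonneg (x - y)]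
        calc ‖F (s, t)‖ ^ 2
            ≤ (Cf * Real.exp (-μ * t) * (1 + ‖uss (s, t)‖ + ‖us (s, t)‖)) ^ 2 := by
              have := hFle s hs t ht
              gcongr
          _ = Cf ^ 2 * Real.exp (-μ * t) ^ 2 * (1 + ‖uss (s, t)‖ + ‖us (s, t)‖) ^ 2 := by ring
          _ ≤ Cf ^ 2 * Real.exp (-μ * t) ^ 2 * (3 * (1 + ‖uss (s, t)‖ ^ 2
              + (‖u (s, t)‖ ^ 2 + ‖us (s, t)‖ ^ 2 + ‖ut (s, t)‖ ^ 2))) := by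
              gcongr
              refine (e1 _ _).trans ?_
              nlinarith [sq_nonneg ‖u (s, t)‖, sq_nonneg ‖ut (s, t)‖]
          _ = _ := by rw [hee]; ring)
    refine this.trans_eq ?_
    have hi : ∀ f : ℝ → ℝ, Continuous f → IntervalIntegrable f volume 0 l := fun f hf =>
      hf.intervalIntegrable _ _
    rw [intervalIntegral.integral_const_mul,
      intervalIntegral.integral_add (hi _ (by fun_prop)) (hi _ (by fun_prop)),
      intervalIntegral.integral_add (hi _ (by fun_prop)) (hi _ (by fun_prop)),
      intervalIntegral.integral_const, fieldEnergy, smul_eq_mul, sub_zero, mul_one]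
  have hc1 : 0 ≤ 1 / c := by positivity
  obtain ⟨C, hCp, lam, hlam, hfin⟩ := exp_decay_of_window (L := fun t => L (max t (1 / 2)))
    (L' := L') (N := fun t => ∫ s in (0:ℝ)..l, ‖uss (s, t)‖ ^ 2) (c := c)
    (C0 := CL * (3 * Cf ^ 2) * (l + 1 + 1 / c)) (μ := μ) (C1 := Cb * (1 + 1 / c)) hc hμ
    (by positivity) (by positivity) hNc hN0
    (continuous_iff_continuousAt.2 fun t => by
      have ht : 0 < max t (1 / 2) := lt_max_of_lt_right (by norm_num)
      exact (h1 _ ht).continuousAt.comp (f := fun t => max t (1 / 2))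
        (by fun_prop))
    (fun t ht => hL0 _ (lt_max_of_lt_right (by norm_num)))
    (fun t ht => (h1 t (by linarith)).congr_of_eventuallyEq (by
      filter_upwards [lt_mem_nhds (by linarith : (1:ℝ) / 2 < t)] with x hx
      rw [max_eq_left hx.le]))
    (fun t ht => by
      have ht0 : 0 < t := by linarith
      simp only [hmax t ht]
      refine (h2 t ht0).trans (add_le_add le_rfl ?_)
      have hLt := hL0 t ht0
      calc _ ≤ CL * (3 * Cf ^ 2 * Real.exp (-(2 * μ) * t)
            * (l + (∫ s in (0:ℝ)..l, ‖uss (s, t)‖ ^ 2) + fieldEnergy l u us ut t)) := by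
            gcongr; exact hFint t ht0
        _ ≤ CL * (3 * Cf ^ 2 * Real.exp (-(2 * μ) * t)
            * ((l + 1 + 1 / c) * (1 + (∫ s in (0:ℝ)..l, ‖uss (s, t)‖ ^ 2) + L t))) := by
            gcongr
            have := hE t ht0
            have := hN0 t
            have e1 : L t / c = 1 / c * L t := by ring
            nlinarith [mul_nonneg hc1 this, mul_nonneg hl.le this, mul_nonneg hl.le hLt]
        _ = _ := by ring)
    (fun T ρ M hT hρ hρ1 hM hLM => by
      have := hbound T ρ ((1 + 1 / c) * M) hT hρ hρ1 (by nlinarith) (fun t ht => by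
        have h4 := hLM t ht
        rw [hmax t ht.1] at h4
        have ht0 : 0 < t := by linarith [ht.1]
        have h5 := hE t ht0
        have h6 : L t / c ≤ (M - 1) / c := by gcongr; linarith
        have e1 : (M - 1) / c = 1 / c * M - 1 / c := by ring
        linarith)
      refine this.trans ?_
      rw [mul_assoc]
      gcongr
      have : 0 ≤ 1 / c * (1 / ρ ^ 2) := by positivity
      linarith)
  refine ⟨C / c, by positivity, lam, hlam, fun t ht => (hE t (by linarith)).trans ?_⟩
  have := hfin t ht
  rw [hmax t ht] at this
  rw [div_mul_eq_mul_div]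
  gcongr

end TrackDecay

section Clamp

variable {X : Type*}

/-- The retraction of the line onto `[0, l]`. -/
noncomputable def clampIcc (l s : ℝ) : ℝ := max 0 (min s l)

/-- The extension of a function on `[0, l] × [0, ∞)` that is constant along the retraction. -/
noncomputable def clampExt (l : ℝ) (f : ℝ → ℝ → X) (z : ℝ × ℝ) : X := f (clampIcc l z.1) (max z.2 0)

theorem clampIcc_mem {l : ℝ} (hl : 0 ≤ l) (s : ℝ) : clampIcc l s ∈ Icc 0 l :=
  ⟨le_max_left _ _, max_le hl (min_le_right _ _)⟩

theorem clampIcc_of_mem {l s : ℝ} (hs : s ∈ Icc 0 l) : clampIcc l s = s := by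
  rw [clampIcc, min_eq_left hs.2, max_eq_right hs.1]

theorem continuous_clampIcc (l : ℝ) : Continuous (clampIcc l) := by
  unfold clampIcc
  fun_prop

theorem clampExt_apply {l s t : ℝ} (f : ℝ → ℝ → X) (hs : s ∈ Icc 0 l) (ht : 0 ≤ t) :
    clampExt l f (s, t) = f s t := by
  rw [clampExt, clampIcc_of_mem hs, max_eq_left ht]

theorem continuous_comp_clampIcc [TopologicalSpace X] {l : ℝ} (hl : 0 ≤ l) {f : ℝ → X}
    (hf : ContinuousOn f (Icc 0 l)) : Continuous fun s => f (clampIcc l s) :=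
  hf.comp_continuous (continuous_clampIcc l) (clampIcc_mem hl)

theorem continuous_clampExt [TopologicalSpace X] {l : ℝ} (hl : 0 ≤ l) {f : ℝ → ℝ → X}
    (hf : ContinuousOn (fun z : ℝ × ℝ => f z.1 z.2) (Icc 0 l ×ˢ Ici 0)) :
    Continuous (clampExt l f) := by
  have hc : Continuous fun z : ℝ × ℝ => (clampIcc l z.1, max z.2 0) :=
    ((continuous_clampIcc l).comp continuous_fst).prodMk (by fun_prop)
  exact hf.comp_continuous hc fun z => ⟨clampIcc_mem hl _, le_max_right z.2 0⟩

variable [NormedAddCommGroup X] [NormedSpace ℝ X]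

theorem hasDerivAt_clampExt_right {l s t : ℝ} {f : ℝ → ℝ → X} {f' : X} (hs : s ∈ Icc 0 l)
    (ht : 0 < t) (h : HasDerivWithinAt (fun τ => f s τ) f' (Ici 0) t) :
    HasDerivAt (fun τ => clampExt l f (s, τ)) f' t := by
  refine (h.hasDerivAt (Ici_mem_nhds ht)).congr_of_eventuallyEq ?_
  filter_upwards [lt_mem_nhds ht] with τ hτ using clampExt_apply f hs hτ.le

theorem hasDerivAt_clampExt_left {l s t : ℝ} {f : ℝ → ℝ → X} {f' : X} (hs : s ∈ Ioo 0 l)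
    (ht : 0 ≤ t) (h : HasDerivWithinAt (fun x => f x t) f' (Icc 0 l) s) :
    HasDerivAt (fun x => clampExt l f (x, t)) f' s := by
  refine (h.hasDerivAt (Icc_mem_nhds hs.1 hs.2)).congr_of_eventuallyEq ?_
  filter_upwards [Icc_mem_nhds hs.1 hs.2] with x hx using clampExt_apply f hx ht

end Clamp

section ClampField

variable {H : Type*} [NormedAddCommGroup H] [InnerProductSpace ℝ H]

theorem WaveField.of_hasDerivWithinAt {l : ℝ} (hl : 0 ≤ l) {K : ℝ → H →L[ℝ] H}
    {w ws wt wtt A : ℝ → ℝ → H}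
    (cw : ContinuousOn (fun z : ℝ × ℝ => w z.1 z.2) (Icc 0 l ×ˢ Ici 0))
    (cws : ContinuousOn (fun z : ℝ × ℝ => ws z.1 z.2) (Icc 0 l ×ˢ Ici 0))
    (cwt : ContinuousOn (fun z : ℝ × ℝ => wt z.1 z.2) (Icc 0 l ×ˢ Ici 0))
    (cwtt : ContinuousOn (fun z : ℝ × ℝ => wtt z.1 z.2) (Icc 0 l ×ˢ Ici 0))
    (cA : ContinuousOn (fun z : ℝ × ℝ => A z.1 z.2) (Icc 0 l ×ˢ Ici 0))
    (dt : ∀ t ∈ Ici (0:ℝ), ∀ s ∈ Icc 0 l,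
      HasDerivWithinAt (fun τ => w s τ) (wt s t) (Ici 0) t)
    (dtt : ∀ t ∈ Ici (0:ℝ), ∀ s ∈ Icc 0 l,
      HasDerivWithinAt (fun τ => wt s τ) (wtt s t) (Ici 0) t)
    (ds : ∀ t ∈ Ici (0:ℝ), ∀ s ∈ Icc 0 l,
      HasDerivWithinAt (fun x => w x t) (ws s t) (Icc 0 l) s)
    (dA : ∀ t ∈ Ici (0:ℝ), ∀ s ∈ Icc 0 l,
      HasDerivWithinAt (fun x => K x (ws x t)) (A s t) (Icc 0 l) s)
    (left : ∀ t ∈ Ici (0:ℝ), w 0 t = 0) (right : ∀ t ∈ Ici (0:ℝ), ws l t = 0) :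
    WaveField l (fun s => K (clampIcc l s)) (clampExt l w) (clampExt l ws) (clampExt l wt)
      (clampExt l wtt) (clampExt l A) where
  cw := continuous_clampExt hl cw
  cws := continuous_clampExt hl cws
  cwt := continuous_clampExt hl cwt
  cwtt := continuous_clampExt hl cwtt
  cA := continuous_clampExt hl cA
  dt s hs t ht := by
    rw [clampExt_apply wt hs ht.le]
    exact hasDerivAt_clampExt_right hs ht (dt t ht.le s hs)
  dtt s hs t ht := by
    rw [clampExt_apply wtt hs ht.le]
    exact hasDerivAt_clampExt_right hs ht (dtt t ht.le s hs)
  ds t ht s hs := by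
    rw [clampExt_apply ws (Ioo_subset_Icc_self hs) ht.le]
    exact hasDerivAt_clampExt_left hs ht.le (ds t ht.le s (Ioo_subset_Icc_self hs))
  dA t ht s hs := by
    rw [clampExt_apply A (Ioo_subset_Icc_self hs) ht.le]
    refine ((dA t ht.le s (Ioo_subset_Icc_self hs)).hasDerivAt
      (Icc_mem_nhds hs.1 hs.2)).congr_of_eventuallyEq ?_
    filter_upwards [Icc_mem_nhds hs.1 hs.2] with x hx
    rw [clampExt_apply ws hx ht.le, clampIcc_of_mem hx]
  left t ht := by rw [clampExt_apply w ⟨le_rfl, hl⟩ ht.le, left t ht.le]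
  right t ht := by rw [clampExt_apply ws ⟨hl, le_rfl⟩ ht.le, right t ht.le]

theorem WaveCoeff.exists_of_continuousOn {l : ℝ} (hl : 0 < l) {K Kp : ℝ → H →L[ℝ] H}
    {Kv : ℝ → ℝ → H →L[ℝ] H} {k0 d0 d1 : ℝ} (hk0 : 0 < k0) (hd0 : 0 < d0)
    (cK : ContinuousOn K (Icc 0 l)) (cKp : ContinuousOn Kp (Icc 0 l))
    (cKv : ContinuousOn (fun z : ℝ × ℝ => Kv z.1 z.2) (Icc 0 l ×ˢ Ici 0))
    (symmK : ∀ s ∈ Icc 0 l, ∀ x y, ⟪K s x, y⟫ = ⟪x, K s y⟫)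
    (symmKp : ∀ s ∈ Icc 0 l, ∀ x y, ⟪Kp s x, y⟫ = ⟪x, Kp s y⟫)
    (lowK : ∀ s ∈ Icc 0 l, ∀ x, k0 * ‖x‖ ^ 2 ≤ ⟪K s x, x⟫)
    (lowKp : ∀ s ∈ Icc 0 l, ∀ x, 0 ≤ ⟪Kp s x, x⟫)
    (lowKv : ∀ s ∈ Icc 0 l, ∀ t ∈ Ici (0:ℝ), ∀ x, d0 * ‖x‖ ^ 2 ≤ ⟪Kv s t x, x⟫)
    (upKv : ∀ s ∈ Icc 0 l, ∀ t ∈ Ici (0:ℝ), ‖Kv s t‖ ≤ d1) :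
    ∃ k1 k2, WaveCoeff l (fun s => K (clampIcc l s)) (fun s => Kp (clampIcc l s))
      (clampExt l Kv) k0 k1 k2 d0 d1 := by
  obtain ⟨k1, h1⟩ := isCompact_Icc.exists_bound_of_continuousOn cK
  obtain ⟨k2, h2⟩ := isCompact_Icc.exists_bound_of_continuousOn cKp
  exact ⟨k1, k2,
    { l_pos := hl
      k0_pos := hk0
      d0_pos := hd0
      cK := continuous_comp_clampIcc hl.le cK
      cKp := continuous_comp_clampIcc hl.le cKp
      cKv := continuous_clampExt hl.le cKv
      symmK := fun s _ => symmK _ (clampIcc_mem hl.le s)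
      symmKp := fun s _ => symmKp _ (clampIcc_mem hl.le s)
      lowK := fun s _ => lowK _ (clampIcc_mem hl.le s)
      lowKp := fun s _ => lowKp _ (clampIcc_mem hl.le s)
      lowKv := fun s _ t _ => lowKv _ (clampIcc_mem hl.le s) _ (le_max_right t 0)
      upK := fun s _ x => (K _).le_of_opNorm_le (h1 _ (clampIcc_mem hl.le s)) x
      upKp := fun s _ x => (Kp _).le_of_opNorm_le (h2 _ (clampIcc_mem hl.le s)) x
      upKv := fun s _ t _ x => (Kv _ _).le_of_opNorm_le
        (upKv _ (clampIcc_mem hl.le s) _ (le_max_right t 0)) x }⟩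

/-- A continuous function that decays exponentially from some time on does so from time zero. -/
theorem exists_exp_bound_of_eventually {X : Type*} [NormedAddCommGroup X] {l a C lam : ℝ}
    {f : ℝ × ℝ → X} (hf : Continuous f) (hC : 0 < C) (hlam : 0 < lam)
    (h : ∀ t, a ≤ t → ∀ s ∈ Icc 0 l, ‖f (s, t)‖ ≤ C * Real.exp (-lam * t)) :
    ∃ C' > 0, ∀ t ∈ Ici (0:ℝ), ∀ s ∈ Icc 0 l, ‖f (s, t)‖ ≤ C' * Real.exp (-lam * t) := by
  obtain ⟨M, hM⟩ := ((isCompact_Icc (a := (0:ℝ)) (b := l)).prod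
    (isCompact_Icc (a := (0:ℝ)) (b := a))).exists_bound_of_continuousOn hf.continuousOn
  refine ⟨C + |M| * Real.exp (lam * a), by positivity, fun t ht s hs => ?_⟩
  rw [add_mul]
  rcases le_total a t with hat | hta
  · exact (h t hat s hs).trans (le_add_of_nonneg_right (by positivity))
  · refine (hM (s, t) ⟨hs, ht, hta⟩).trans ((le_abs_self M).trans ?_)
    refine le_trans ?_ (le_add_of_nonneg_left (by positivity))
    rw [mul_assoc, ← Real.exp_add]
    refine le_mul_of_one_le_right (abs_nonneg M) (Real.one_le_exp ?_)
    nlinarith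

end ClampField

section ScalarDecay

/-- Uniform exponential decay for the damped string with variable coefficients. -/
theorem exists_exp_decay_string {l : ℝ} (hl : 0 < l) {k d a : ℝ → ℝ} {w ws wt wtt A : ℝ → ℝ → ℝ}
    (ck : ContinuousOn k (Icc 0 l)) (cd : ContinuousOn d (Icc 0 l))
    (ca : ContinuousOn a (Icc 0 l)) (hk : ∀ s ∈ Icc 0 l, 0 < k s) (hd : ∀ s ∈ Icc 0 l, 0 < d s)
    (ha : ∀ s ∈ Icc 0 l, 0 < a s)
    (cw : ContinuousOn (fun z : ℝ × ℝ => w z.1 z.2) (Icc 0 l ×ˢ Ici 0))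
    (cws : ContinuousOn (fun z : ℝ × ℝ => ws z.1 z.2) (Icc 0 l ×ˢ Ici 0))
    (cwt : ContinuousOn (fun z : ℝ × ℝ => wt z.1 z.2) (Icc 0 l ×ˢ Ici 0))
    (cwtt : ContinuousOn (fun z : ℝ × ℝ => wtt z.1 z.2) (Icc 0 l ×ˢ Ici 0))
    (dt : ∀ t ∈ Ici (0:ℝ), ∀ s ∈ Icc 0 l,
      HasDerivWithinAt (fun τ => w s τ) (wt s t) (Ici 0) t)
    (dtt : ∀ t ∈ Ici (0:ℝ), ∀ s ∈ Icc 0 l,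
      HasDerivWithinAt (fun τ => wt s τ) (wtt s t) (Ici 0) t)
    (ds : ∀ t ∈ Ici (0:ℝ), ∀ s ∈ Icc 0 l,
      HasDerivWithinAt (fun x => w x t) (ws s t) (Icc 0 l) s)
    (dA : ∀ t ∈ Ici (0:ℝ), ∀ s ∈ Icc 0 l,
      HasDerivWithinAt (fun x => k x * ws x t) (A s t) (Icc 0 l) s)
    (left : ∀ t ∈ Ici (0:ℝ), w 0 t = 0) (right : ∀ t ∈ Ici (0:ℝ), ws l t = 0)
    (heq : ∀ t ∈ Ici (0:ℝ), ∀ s ∈ Icc 0 l, wtt s t = A s t - d s * wt s t - a s * w s t) :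
    ∃ C > 0, ∃ lam > 0, ∀ t ∈ Ici (0:ℝ), ∀ s ∈ Icc 0 l, |w s t| ≤ C * Real.exp (-lam * t) ∧
      |wt s t| ≤ C * Real.exp (-lam * t) ∧ |ws s t| ≤ C * Real.exp (-lam * t) := by
  have hne : (Icc (0:ℝ) l).Nonempty := ⟨0, le_rfl, hl.le⟩
  obtain ⟨sk, hsk, hk0⟩ := isCompact_Icc.exists_isMinOn hne ck
  obtain ⟨sd, hsd, hd0⟩ := isCompact_Icc.exists_isMinOn hne cd
  obtain ⟨d1, hd1⟩ := isCompact_Icc.exists_bound_of_continuousOn cd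
  have cfst : ContinuousOn (fun z : ℝ × ℝ => z.1) (Icc 0 l ×ˢ Ici 0) := continuous_fst.continuousOn
  have cd' : ContinuousOn (fun z : ℝ × ℝ => d z.1) (Icc 0 l ×ˢ Ici 0) :=
    cd.comp cfst fun z hz => hz.1
  have ca' : ContinuousOn (fun z : ℝ × ℝ => a z.1) (Icc 0 l ×ˢ Ici 0) :=
    ca.comp cfst fun z hz => hz.1
  have cA : ContinuousOn (fun z : ℝ × ℝ => A z.1 z.2) (Icc 0 l ×ˢ Ici 0) := by
    refine ((cwtt.add (cd'.mul cwt)).add (ca'.mul cw)).congr fun z hz => ?_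
    simp only [Pi.add_apply, Pi.mul_apply]
    rw [heq z.2 hz.2 z.1 hz.1]
    ring
  have hW := WaveField.of_hasDerivWithinAt hl.le
    (K := fun s => k s • ContinuousLinearMap.id ℝ ℝ) cw cws cwt cwtt cA dt dtt ds
    (by simpa using dA) left right
  have hsq : ∀ c x : ℝ, ⟪(c • ContinuousLinearMap.id ℝ ℝ) x, x⟫ = c * ‖x‖ ^ 2 := fun c x => by
    simp; ring
  obtain ⟨k1, k2, hC⟩ := WaveCoeff.exists_of_continuousOn hl (hk sk hsk) (hd sd hsd)
    (K := fun s => k s • ContinuousLinearMap.id ℝ ℝ)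
    (Kp := fun s => a s • ContinuousLinearMap.id ℝ ℝ)
    (Kv := fun s _ => d s • ContinuousLinearMap.id ℝ ℝ) (d1 := d1)
    (by fun_prop) (by fun_prop) (cd'.smul continuousOn_const)
    (fun s _ x y => by simp; ring) (fun s _ x y => by simp; ring)
    (fun s hs x => by rw [hsq]; gcongr; exact hk0 hs)
    (fun s hs x => by rw [hsq]; have := ha s hs; positivity)
    (fun s hs t _ x => by rw [hsq]; gcongr; exact hd0 hs)
    (fun s hs t _ => by
      rw [norm_smul, ContinuousLinearMap.norm_id, mul_one]; exact hd1 s hs)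
  obtain ⟨C, hCp, lam, hlam, hdec⟩ := WaveCoeff.homogeneous_decay
    (D := fun s => d (clampIcc l s) • ContinuousLinearMap.id ℝ ℝ) hC hW (fun s hs t ht => by
      rw [clampExt_apply wtt hs ht.le, clampExt_apply A hs ht.le, clampExt_apply wt hs ht.le,
        clampExt_apply w hs ht.le, clampIcc_of_mem hs]
      simpa using heq t ht.le s hs)
  obtain ⟨C', hC', h'⟩ := exists_exp_bound_of_eventually
    (f := fun z => (clampExt l w z, clampExt l wt z, clampExt l ws z)) (l := l)
    (by have := hW.cw; have := hW.cwt; have := hW.cws; fun_prop) hCp hlam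
    (fun t ht s hs => by
      obtain ⟨h1, h2, h3⟩ := hdec t ht s hs
      exact norm_prod_le_iff.2 ⟨h1, norm_prod_le_iff.2 ⟨h2, h3⟩⟩)
  refine ⟨C', hC', lam, hlam, fun t ht s hs => ?_⟩
  have h1 := norm_prod_le_iff.1 (h' t ht s hs)
  have h2 := norm_prod_le_iff.1 h1.2
  have h0 := h1.1
  have h3 := h2.1
  have h4 := h2.2
  simp only [clampExt_apply _ hs ht, Real.norm_eq_abs] at h0 h3 h4
  exact ⟨h0, h3, h4⟩

end ScalarDecay

section SmoothBounded

variable {V : Type*} [NormedAddCommGroup V] [NormedSpace ℝ V]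

/-- A bounded curve with derivative `S1`, such that the curve and its derivative are Lipschitz. -/
structure LipschitzCurve (b : ℝ) (S S1 : ℝ → V) : Prop where
  deriv : ∀ x, HasDerivAt S (S1 x) x
  deriv_continuous : Continuous S1
  le : ∀ x, ‖S x‖ ≤ b
  deriv_le : ∀ x, ‖S1 x‖ ≤ b
  sub_le : ∀ x y, ‖S x - S y‖ ≤ b * |x - y|
  deriv_sub_le : ∀ x y, ‖S1 x - S1 y‖ ≤ b * |x - y|

namespace LipschitzCurve

variable {b : ℝ} {S S1 : ℝ → V}

theorem continuous (h : LipschitzCurve b S S1) : Continuous S :=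
  continuous_iff_continuousAt.2 fun x => (h.deriv x).continuousAt

theorem nonneg (h : LipschitzCurve b S S1) : 0 ≤ b := (norm_nonneg _).trans (h.le 0)

theorem mono (h : LipschitzCurve b S S1) {b' : ℝ} (hb : b ≤ b') : LipschitzCurve b' S S1 where
  deriv := h.deriv
  deriv_continuous := h.deriv_continuous
  le x := (h.le x).trans hb
  deriv_le x := (h.deriv_le x).trans hb
  sub_le x y := (h.sub_le x y).trans (by gcongr)
  deriv_sub_le x y := (h.deriv_sub_le x y).trans (by gcongr)

theorem norm_smul_sub_smul_le (h : LipschitzCurve b S S1) {x y a c B e : ℝ} (hc : |c| ≤ B)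
    (he : |x - y| ≤ e) (hac : |a - c| ≤ e) : ‖a • S1 x - c • S1 y‖ ≤ b * (1 + B) * e := by
  have hb := h.nonneg
  have hB : 0 ≤ B := (abs_nonneg c).trans hc
  have e1 : a • S1 x - c • S1 y = (a - c) • S1 x + c • (S1 x - S1 y) := by module
  calc _ ≤ |a - c| * ‖S1 x‖ + |c| * ‖S1 x - S1 y‖ := by
        rw [e1]
        refine (norm_add_le _ _).trans_eq ?_
        rw [norm_smul, norm_smul, Real.norm_eq_abs, Real.norm_eq_abs]
    _ ≤ e * b + B * (b * e) := by
        gcongr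
        · exact (abs_nonneg _).trans hac
        · exact h.deriv_le x
        · exact (h.deriv_sub_le x y).trans (by gcongr)
    _ = _ := by ring

end LipschitzCurve

theorem exists_lipschitzCurve_trig (n : ℝ) (P0 P1 P2 : V) :
    ∃ b, LipschitzCurve b (fun x => P0 + Real.cos (n * x) • P1 + Real.sin (n * x) • P2)
      (fun x => n • (Real.cos (n * x) • P2 - Real.sin (n * x) • P1)) := by
  have hc1 : ∀ x, |Real.cos (n * x)| ≤ 1 := fun x => Real.abs_cos_le_one _
  have hs1 : ∀ x, |Real.sin (n * x)| ≤ 1 := fun x => Real.abs_sin_le_one _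
  have hdc : ∀ x, HasDerivAt (fun x => Real.cos (n * x)) (-(n * Real.sin (n * x))) x := fun x => by
    refine ((Real.hasDerivAt_cos (n * x)).comp x ((hasDerivAt_id x).const_mul n)).congr_deriv ?_
    ring
  have hds : ∀ x, HasDerivAt (fun x => Real.sin (n * x)) (n * Real.cos (n * x)) x := fun x => by
    refine ((Real.hasDerivAt_sin (n * x)).comp x ((hasDerivAt_id x).const_mul n)).congr_deriv ?_
    ring
  have hn : ∀ {f f' : ℝ → ℝ}, (∀ x, HasDerivAt f (f' x) x) → (∀ x, |f' x| ≤ |n|) →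
      ∀ x y, |f x - f y| ≤ |n| * |x - y| := fun hf hf' x y => by
    simpa using convex_univ.norm_image_sub_le_of_norm_hasDerivWithin_le
      (fun z _ => (hf z).hasDerivWithinAt) (fun z _ => hf' z) (mem_univ y) (mem_univ x)
  have hlc := hn hdc fun x => by
    rw [abs_neg, abs_mul]; exact mul_le_of_le_one_right (abs_nonneg n) (hs1 x)
  have hls := hn hds fun x => by
    rw [abs_mul]; exact mul_le_of_le_one_right (abs_nonneg n) (hc1 x)
  have hnn := abs_nonneg n
  have h0 := norm_nonneg P0
  have hcs : ∀ a c : ℝ, ∀ {m : ℝ}, |a| ≤ m → |c| ≤ m → ‖a • P1 + c • P2‖ ≤ m * (‖P1‖ + ‖P2‖) :=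
    fun a c m ha hc => by
      refine (norm_add_le _ _).trans ?_
      rw [norm_smul, norm_smul, mul_add, Real.norm_eq_abs, Real.norm_eq_abs]
      gcongr
  have hp : 0 ≤ ‖P1‖ + ‖P2‖ := by positivity
  refine ⟨‖P0‖ + (1 + |n| + |n| ^ 2) * (‖P1‖ + ‖P2‖), ?_, ?_, fun x => ?_, fun x => ?_,
    fun x y => ?_, fun x y => ?_⟩
  · intro x
    refine ((((hdc x).smul_const P1).const_add P0).add ((hds x).smul_const P2)).congr_deriv ?_
    module
  · fun_prop
  · rw [add_assoc]
    refine (norm_add_le _ _).trans (add_le_add le_rfl ?_)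
    refine (hcs _ _ (hc1 x) (hs1 x)).trans ?_
    gcongr
    nlinarith
  · have e1 : n • (Real.cos (n * x) • P2 - Real.sin (n * x) • P1)
        = (-(n * Real.sin (n * x))) • P1 + (n * Real.cos (n * x)) • P2 := by module
    rw [e1]
    refine (hcs _ _ (m := |n|) ?_ ?_).trans ?_
    · rw [abs_neg, abs_mul]; exact mul_le_of_le_one_right hnn (hs1 x)
    · rw [abs_mul]; exact mul_le_of_le_one_right hnn (hc1 x)
    · nlinarith [mul_nonneg (sq_nonneg |n|) hp]
  · have e1 : (P0 + Real.cos (n * x) • P1 + Real.sin (n * x) • P2)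
        - (P0 + Real.cos (n * y) • P1 + Real.sin (n * y) • P2)
        = (Real.cos (n * x) - Real.cos (n * y)) • P1
          + (Real.sin (n * x) - Real.sin (n * y)) • P2 := by module
    rw [e1]
    refine (hcs _ _ (hlc x y) (hls x y)).trans ?_
    rw [mul_right_comm]
    gcongr
    nlinarith [mul_nonneg (sq_nonneg |n|) hp]
  · have e1 : n • (Real.cos (n * x) • P2 - Real.sin (n * x) • P1)
        - n • (Real.cos (n * y) • P2 - Real.sin (n * y) • P1)
        = (n * -(Real.sin (n * x) - Real.sin (n * y))) • P1
          + (n * (Real.cos (n * x) - Real.cos (n * y))) • P2 := by module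
    rw [e1]
    refine (hcs _ _ (m := |n| * (|n| * |x - y|)) ?_ ?_).trans ?_
    · rw [abs_mul, abs_neg]; gcongr; exact hls x y
    · rw [abs_mul]; gcongr; exact hlc x y
    · have e2 : |n| * (|n| * |x - y|) * (‖P1‖ + ‖P2‖)
          = |n| ^ 2 * (‖P1‖ + ‖P2‖) * |x - y| := by ring
      rw [e2]
      gcongr
      nlinarith [mul_nonneg hnn hp]

end SmoothBounded

section Coercive

variable {H : Type*} [NormedAddCommGroup H] [InnerProductSpace ℝ H]

/-- The solution of a uniformly coercive system depends continuously on the data. -/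
theorem continuousOn_of_coercive {Z : Type*} [TopologicalSpace Z] {G : Z → H →L[ℝ] H}
    {x y : Z → H} {D : Set Z} {c : ℝ} (hc : 0 < c) (hG : ContinuousOn G D) (hy : ContinuousOn y D)
    (hcoer : ∀ z ∈ D, ∀ v, c * ‖v‖ ^ 2 ≤ ⟪G z v, v⟫) (hxy : ∀ z ∈ D, G z (x z) = y z) :
    ContinuousOn x D := by
  intro w hw
  have hle : ∀ z ∈ D, ‖x z - x w‖ ≤ c⁻¹ * (‖y z - y w‖ + ‖G z - G w‖ * ‖x w‖) := by
    intro z hz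
    have h1 : c * ‖x z - x w‖ ≤ ‖G z (x z - x w)‖ := by
      rcases (norm_nonneg (x z - x w)).eq_or_lt with h0 | h0
      · rw [← h0, mul_zero]; exact norm_nonneg _
      · refine le_of_mul_le_mul_right ?_ h0
        calc c * ‖x z - x w‖ * ‖x z - x w‖ = c * ‖x z - x w‖ ^ 2 := by ring
          _ ≤ _ := (hcoer z hz _).trans (real_inner_le_norm _ _)
    have h2 : G z (x z - x w) = (y z - y w) - (G z - G w) (x w) := by
      rw [map_sub, hxy z hz, ← hxy w hw, _root_.sub_apply]
      abel
    rw [← div_eq_inv_mul, le_div_iff₀' hc]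
    refine h1.trans ?_
    rw [h2]
    exact (norm_sub_le _ _).trans (add_le_add le_rfl ((G z - G w).le_opNorm _))
  have hlim : Tendsto (fun z => c⁻¹ * (‖y z - y w‖ + ‖G z - G w‖ * ‖x w‖)) (𝓝[D] w) (𝓝 0) := by
    have h1 := tendsto_iff_norm_sub_tendsto_zero.1 (hy w hw)
    have h2 := tendsto_iff_norm_sub_tendsto_zero.1 (hG w hw)
    simpa using (h1.add (h2.mul_const ‖x w‖)).const_mul c⁻¹
  refine tendsto_iff_norm_sub_tendsto_zero.2 (squeeze_zero' (Eventually.of_forall fun z =>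
    norm_nonneg _) ?_ hlim)
  filter_upwards [self_mem_nhdsWithin] with z hz using hle z hz

theorem differentiableWithinAt_of_isUnit [CompleteSpace H] {K : ℝ → H →L[ℝ] H} {K' : H →L[ℝ] H}
    {f : ℝ → H} {f' : H} {D : Set ℝ} {s : ℝ} (hs : s ∈ D) (hK : HasDerivWithinAt K K' D s)
    (hu : ∀ x ∈ D, IsUnit (K x)) (hf : HasDerivWithinAt (fun x => K x (f x)) f' D s) :
    DifferentiableWithinAt ℝ f D s := by
  obtain ⟨U, hU⟩ := hu s hs
  have h1 : DifferentiableWithinAt ℝ (fun x => Ring.inverse (K x)) D s := by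
    have := hasFDerivAt_ringInverse (𝕜 := ℝ) U
    rw [hU] at this
    exact (this.comp_hasDerivWithinAt s hK).differentiableWithinAt
  refine (h1.clm_apply hf.differentiableWithinAt).congr (fun x hx => ?_) ?_ <;>
  · rw [← mul_apply_eq_comp, Ring.inverse_mul_cancel _ (hu _ ‹_›),
      one_apply_eq_self]

end Coercive

section TrackSystem

variable {H : Type*} [NormedAddCommGroup H] [InnerProductSpace ℝ H]

/-- The closed-loop translational dynamics: the motion `u + v` obeys the plant equation with stress
`S (θ) (u_s + v_s) - T (θ) q`, while the same stress evaluated along `ψ` matches the target error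
dynamics with gains `K`, `Kv`, `Kp`; the angle `θ` converges exponentially to `ψ`. -/
structure TrackSystem (l : ℝ) (K K' Kp : ℝ → H →L[ℝ] H) (Kv : ℝ → ℝ → H →L[ℝ] H)
    (S S1 T T1 : ℝ → H →L[ℝ] H) (q q' : ℝ → H) (e : H) (θ θs ψ ψs : ℝ → ℝ → ℝ)
    (u us ut utt v vs vss vt vtt D Dψ Dq : ℝ → ℝ → H) (b B g0 d0 d1 μ Cθ : ℝ) : Prop where
  l_pos : 0 < l
  dK : ∀ s ∈ Icc 0 l, HasDerivWithinAt K (K' s) (Icc 0 l) s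
  cK' : ContinuousOn K' (Icc 0 l)
  uK : ∀ s ∈ Icc 0 l, IsUnit (K s)
  symmK : ∀ s ∈ Icc 0 l, ∀ x y, ⟪K s x, y⟫ = ⟪x, K s y⟫
  cKp : ContinuousOn Kp (Icc 0 l)
  symmKp : ∀ s ∈ Icc 0 l, ∀ x y, ⟪Kp s x, y⟫ = ⟪x, Kp s y⟫
  lowKp : ∀ s ∈ Icc 0 l, ∀ x, 0 ≤ ⟪Kp s x, x⟫
  d0_pos : 0 < d0
  cKv : ContinuousOn (fun z : ℝ × ℝ => Kv z.1 z.2) (Icc 0 l ×ˢ Ici 0)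
  lowKv : ∀ s ∈ Icc 0 l, ∀ t ∈ Ici (0:ℝ), ∀ x, d0 * ‖x‖ ^ 2 ≤ ⟪Kv s t x, x⟫
  upKv : ∀ s ∈ Icc 0 l, ∀ t ∈ Ici (0:ℝ), ‖Kv s t‖ ≤ d1
  curveS : LipschitzCurve b S S1
  curveT : LipschitzCurve b T T1
  nonnegS : ∀ a x, 0 ≤ ⟪S a x, x⟫
  g0_pos : 0 < g0
  gap : ∀ s ∈ Icc 0 l, ∀ a x, g0 * ‖x‖ ^ 2 + ⟪S a x, x⟫ ≤ ⟪K s x, x⟫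
  dq : ∀ s ∈ Icc 0 l, HasDerivWithinAt q (q' s) (Icc 0 l) s
  cq' : ContinuousOn q' (Icc 0 l)
  cθ : ContinuousOn (fun z : ℝ × ℝ => θ z.1 z.2) (Icc 0 l ×ˢ Ici 0)
  cθs : ContinuousOn (fun z : ℝ × ℝ => θs z.1 z.2) (Icc 0 l ×ˢ Ici 0)
  cψ : ContinuousOn (fun z : ℝ × ℝ => ψ z.1 z.2) (Icc 0 l ×ˢ Ici 0)
  cψs : ContinuousOn (fun z : ℝ × ℝ => ψs z.1 z.2) (Icc 0 l ×ˢ Ici 0)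
  dθ : ∀ t ∈ Ici (0:ℝ), ∀ s ∈ Icc 0 l,
    HasDerivWithinAt (fun x => θ x t) (θs s t) (Icc 0 l) s
  dψ : ∀ t ∈ Ici (0:ℝ), ∀ s ∈ Icc 0 l,
    HasDerivWithinAt (fun x => ψ x t) (ψs s t) (Icc 0 l) s
  ψs_le : ∀ t ∈ Ici (0:ℝ), ∀ s ∈ Icc 0 l, |ψs s t| ≤ B
  μ_pos : 0 < μ
  θ_sub_le : ∀ t ∈ Ici (0:ℝ), ∀ s ∈ Icc 0 l, |θ s t - ψ s t| ≤ Cθ * Real.exp (-μ * t)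
  θs_sub_le : ∀ t ∈ Ici (0:ℝ), ∀ s ∈ Icc 0 l, |θs s t - ψs s t| ≤ Cθ * Real.exp (-μ * t)
  cu : ContinuousOn (fun z : ℝ × ℝ => u z.1 z.2) (Icc 0 l ×ˢ Ici 0)
  cus : ContinuousOn (fun z : ℝ × ℝ => us z.1 z.2) (Icc 0 l ×ˢ Ici 0)
  cut : ContinuousOn (fun z : ℝ × ℝ => ut z.1 z.2) (Icc 0 l ×ˢ Ici 0)
  cutt : ContinuousOn (fun z : ℝ × ℝ => utt z.1 z.2) (Icc 0 l ×ˢ Ici 0)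
  cv : ContinuousOn (fun z : ℝ × ℝ => v z.1 z.2) (Icc 0 l ×ˢ Ici 0)
  cvs : ContinuousOn (fun z : ℝ × ℝ => vs z.1 z.2) (Icc 0 l ×ˢ Ici 0)
  cvss : ContinuousOn (fun z : ℝ × ℝ => vss z.1 z.2) (Icc 0 l ×ˢ Ici 0)
  cvt : ContinuousOn (fun z : ℝ × ℝ => vt z.1 z.2) (Icc 0 l ×ˢ Ici 0)
  cvtt : ContinuousOn (fun z : ℝ × ℝ => vtt z.1 z.2) (Icc 0 l ×ˢ Ici 0)
  du : ∀ t ∈ Ici (0:ℝ), ∀ s ∈ Icc 0 l,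
    HasDerivWithinAt (fun τ => u s τ) (ut s t) (Ici 0) t
  dut : ∀ t ∈ Ici (0:ℝ), ∀ s ∈ Icc 0 l,
    HasDerivWithinAt (fun τ => ut s τ) (utt s t) (Ici 0) t
  dus : ∀ t ∈ Ici (0:ℝ), ∀ s ∈ Icc 0 l,
    HasDerivWithinAt (fun x => u x t) (us s t) (Icc 0 l) s
  dv : ∀ t ∈ Ici (0:ℝ), ∀ s ∈ Icc 0 l,
    HasDerivWithinAt (fun τ => v s τ) (vt s t) (Ici 0) t
  dvt : ∀ t ∈ Ici (0:ℝ), ∀ s ∈ Icc 0 l,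
    HasDerivWithinAt (fun τ => vt s τ) (vtt s t) (Ici 0) t
  dvs : ∀ t ∈ Ici (0:ℝ), ∀ s ∈ Icc 0 l,
    HasDerivWithinAt (fun x => v x t) (vs s t) (Icc 0 l) s
  dvss : ∀ t ∈ Ici (0:ℝ), ∀ s ∈ Icc 0 l,
    HasDerivWithinAt (fun x => vs x t) (vss s t) (Icc 0 l) s
  vs_le : ∀ t ∈ Ici (0:ℝ), ∀ s ∈ Icc 0 l, ‖vs s t‖ ≤ B
  vss_le : ∀ t ∈ Ici (0:ℝ), ∀ s ∈ Icc 0 l, ‖vss s t‖ ≤ B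
  u_left : ∀ t ∈ Ici (0:ℝ), u 0 t = 0
  u_right : ∀ t ∈ Ici (0:ℝ), us l t = 0
  v_left : ∀ t ∈ Ici (0:ℝ), v 0 t = 0
  dD : ∀ t ∈ Ici (0:ℝ), ∀ s ∈ Icc 0 l, HasDerivWithinAt
    (fun x => S (θ x t) (us x t + vs x t) - T (θ x t) (q x)) (D s t) (Icc 0 l) s
  dDψ : ∀ t ∈ Ici (0:ℝ), ∀ s ∈ Icc 0 l, HasDerivWithinAt
    (fun x => S (ψ x t) (us x t + vs x t) - T (ψ x t) (q x)) (Dψ s t) (Icc 0 l) s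
  dDq : ∀ t ∈ Ici (0:ℝ), ∀ s ∈ Icc 0 l,
    HasDerivWithinAt (fun x => K x (us x t)) (Dq s t) (Icc 0 l) s
  plant : ∀ t ∈ Ici (0:ℝ), ∀ s ∈ Icc 0 l, utt s t + vtt s t = D s t + e
  outer : ∀ t ∈ Ici (0:ℝ), ∀ s ∈ Icc 0 l,
    Dψ s t + e - vtt s t = Dq s t - Kv s t (ut s t) - Kp s (u s t)

theorem sq_sum_le_five (a b c d : ℝ) :
    (1 + a + b + c + d) ^ 2 ≤ 5 * (1 + d ^ 2 + (a ^ 2 + b ^ 2 + c ^ 2)) := by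
  nlinarith [sq_nonneg (1 - a), sq_nonneg (1 - b), sq_nonneg (1 - c), sq_nonneg (1 - d),
    sq_nonneg (a - b), sq_nonneg (a - c), sq_nonneg (a - d), sq_nonneg (b - c), sq_nonneg (b - d),
    sq_nonneg (c - d)]

namespace TrackSystem

variable {l : ℝ} {K K' Kp : ℝ → H →L[ℝ] H} {Kv : ℝ → ℝ → H →L[ℝ] H}
  {S S1 T T1 : ℝ → H →L[ℝ] H} {q q' : ℝ → H} {e : H} {θ θs ψ ψs : ℝ → ℝ → ℝ}
  {u us ut utt v vs vss vt vtt D Dψ Dq : ℝ → ℝ → H} {b B g0 d0 d1 μ Cθ : ℝ}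

/-- The second space derivative of the tracking error. -/
theorem exists_second_deriv [CompleteSpace H]
    (h : TrackSystem l K K' Kp Kv S S1 T T1 q q' e θ θs ψ ψs u us ut utt v vs vss vt vtt D Dψ Dq b B g0 d0 d1 μ Cθ) :
    ∃ uss : ℝ → ℝ → H,
      (∀ t ∈ Ici (0:ℝ), ∀ s ∈ Icc 0 l,
        HasDerivWithinAt (fun x => us x t) (uss s t) (Icc 0 l) s) ∧
      (∀ t ∈ Ici (0:ℝ), ∀ s ∈ Icc 0 l, Dq s t = K' s (us s t) + K s (uss s t)) ∧
      (∀ t ∈ Ici (0:ℝ), ∀ s ∈ Icc 0 l, D s t = (θs s t • S1 (θ s t)) (us s t + vs s t)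
        + S (θ s t) (uss s t + vss s t) - ((θs s t • T1 (θ s t)) (q s) + T (θ s t) (q' s))) ∧
      (∀ t ∈ Ici (0:ℝ), ∀ s ∈ Icc 0 l, Dψ s t = (ψs s t • S1 (ψ s t)) (us s t + vs s t)
        + S (ψ s t) (uss s t + vss s t) - ((ψs s t • T1 (ψ s t)) (q s) + T (ψ s t) (q' s))) := by
  have hud : ∀ s ∈ Icc 0 l, UniqueDiffWithinAt ℝ (Icc 0 l) s := uniqueDiffOn_Icc h.l_pos
  have hd : ∀ t ∈ Ici (0:ℝ), ∀ s ∈ Icc 0 l, HasDerivWithinAt (fun x => us x t)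
      (derivWithin (fun x => us x t) (Icc 0 l) s) (Icc 0 l) s := fun t ht s hs =>
    (differentiableWithinAt_of_isUnit hs (h.dK s hs) h.uK (h.dDq t ht s hs)).hasDerivWithinAt
  have hstress : ∀ (φ φs : ℝ → ℝ → ℝ), ∀ t ∈ Ici (0:ℝ), ∀ s ∈ Icc 0 l,
      HasDerivWithinAt (fun x => φ x t) (φs s t) (Icc 0 l) s →
      HasDerivWithinAt (fun x => S (φ x t) (us x t + vs x t) - T (φ x t) (q x))
        ((φs s t • S1 (φ s t)) (us s t + vs s t)
          + S (φ s t) (derivWithin (fun x => us x t) (Icc 0 l) s + vss s t)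
          - ((φs s t • T1 (φ s t)) (q s) + T (φ s t) (q' s))) (Icc 0 l) s :=
    fun φ φs t ht s hs hφ =>
      ((((h.curveS.deriv _).scomp_hasDerivWithinAt s hφ).clm_apply
        ((hd t ht s hs).add (h.dvss t ht s hs))).sub
        (((h.curveT.deriv _).scomp_hasDerivWithinAt s hφ).clm_apply (h.dq s hs)))
  refine ⟨fun s t => derivWithin (fun x => us x t) (Icc 0 l) s, hd, fun t ht s hs => ?_,
    fun t ht s hs => ?_, fun t ht s hs => ?_⟩
  · exact (hud s hs).eq_deriv _ (h.dDq t ht s hs) ((h.dK s hs).clm_apply (hd t ht s hs))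
  · exact (hud s hs).eq_deriv _ (h.dD t ht s hs) (hstress θ θs t ht s hs (h.dθ t ht s hs))
  · exact (hud s hs).eq_deriv _ (h.dDψ t ht s hs) (hstress ψ ψs t ht s hs (h.dψ t ht s hs))

end TrackSystem

end TrackSystem

section TrackSystemDecay

variable {H : Type*} [NormedAddCommGroup H] [InnerProductSpace ℝ H]

theorem LipschitzCurve.norm_apply_sub_apply_le {b : ℝ} {S S1 : ℝ → H →L[ℝ] H}
    (h : LipschitzCurve b S S1) {x y a c B ε : ℝ} (hc : |c| ≤ B) (he : |x - y| ≤ ε)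
    (hac : |a - c| ≤ ε) (w z : H) :
    ‖((a • S1 x) w + S x z) - ((c • S1 y) w + S y z)‖ ≤ b * (1 + B) * ε * (‖w‖ + ‖z‖) := by
  have hb := h.nonneg
  have hB : 0 ≤ B := (abs_nonneg c).trans hc
  have hε : 0 ≤ ε := (abs_nonneg _).trans he
  have e1 : ((a • S1 x) w + S x z) - ((c • S1 y) w + S y z)
      = (a • S1 x - c • S1 y) w + (S x - S y) z := by
    simp only [_root_.sub_apply]
    abel
  rw [e1, mul_add]
  refine (norm_add_le _ _).trans (add_le_add ?_ ?_)
  · exact ContinuousLinearMap.le_of_opNorm_le _ (h.norm_smul_sub_smul_le hc he hac) w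
  · refine ContinuousLinearMap.le_of_opNorm_le _ ((h.sub_le x y).trans ?_) z
    have : b * |x - y| ≤ b * ε := by gcongr
    nlinarith [mul_nonneg (mul_nonneg hb hB) hε]

theorem LipschitzCurve.norm_apply_add_apply_le {b : ℝ} {S S1 : ℝ → H →L[ℝ] H}
    (h : LipschitzCurve b S S1) {y c B : ℝ} (hc : |c| ≤ B) (w z : H) :
    ‖(c • S1 y) w + S y z‖ ≤ b * (1 + B) * (‖w‖ + ‖z‖) := by
  have hb := h.nonneg
  have hB : 0 ≤ B := (abs_nonneg c).trans hc
  have h1 : ‖(c • S1 y) w‖ ≤ B * b * ‖w‖ := by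
    refine ContinuousLinearMap.le_of_opNorm_le _ ?_ w
    rw [norm_smul, Real.norm_eq_abs]
    gcongr
    exact h.deriv_le y
  have h2 : ‖S y z‖ ≤ b * ‖z‖ := ContinuousLinearMap.le_of_opNorm_le _ (h.le y) z
  refine (norm_add_le _ _).trans ((add_le_add h1 h2).trans ?_)
  nlinarith [mul_nonneg hb (norm_nonneg w), mul_nonneg (mul_nonneg hb hB) (norm_nonneg z)]

namespace TrackSystem

variable {l : ℝ} {K K' Kp : ℝ → H →L[ℝ] H} {Kv : ℝ → ℝ → H →L[ℝ] H}
  {S S1 T T1 : ℝ → H →L[ℝ] H} {q q' : ℝ → H} {e : H} {θ θs ψ ψs : ℝ → ℝ → ℝ}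
  {u us ut utt v vs vss vt vtt D Dψ Dq : ℝ → ℝ → H} {b B g0 d0 d1 μ Cθ : ℝ}

theorem B_nonneg (h : TrackSystem l K K' Kp Kv S S1 T T1 q q' e θ θs ψ ψs u us ut utt
    v vs vss vt vtt D Dψ Dq b B g0 d0 d1 μ Cθ) : 0 ≤ B :=
  (norm_nonneg _).trans (h.vs_le 0 self_mem_Ici 0 ⟨le_rfl, h.l_pos.le⟩)

theorem Cθ_nonneg (h : TrackSystem l K K' Kp Kv S S1 T T1 q q' e θ θs ψ ψs u us ut utt
    v vs vss vt vtt D Dψ Dq b B g0 d0 d1 μ Cθ) : 0 ≤ Cθ := by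
  have := (abs_nonneg _).trans (h.θ_sub_le 0 self_mem_Ici 0 ⟨le_rfl, h.l_pos.le⟩)
  simpa using this

theorem continuousOn_K (h : TrackSystem l K K' Kp Kv S S1 T T1 q q' e θ θs ψ ψs u us ut utt
    v vs vss vt vtt D Dψ Dq b B g0 d0 d1 μ Cθ) : ContinuousOn K (Icc 0 l) :=
  fun s hs => (h.dK s hs).continuousWithinAt

/-- The stress mismatch is exponentially small relative to the second space derivative. -/
theorem exists_mismatch_bound (h : TrackSystem l K K' Kp Kv S S1 T T1 q q' e θ θs ψ ψs u us ut utt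
    v vs vss vt vtt D Dψ Dq b B g0 d0 d1 μ Cθ) {uss : ℝ → ℝ → H}
    (hD : ∀ t ∈ Ici (0:ℝ), ∀ s ∈ Icc 0 l, D s t = (θs s t • S1 (θ s t)) (us s t + vs s t)
      + S (θ s t) (uss s t + vss s t) - ((θs s t • T1 (θ s t)) (q s) + T (θ s t) (q' s)))
    (hDψ : ∀ t ∈ Ici (0:ℝ), ∀ s ∈ Icc 0 l, Dψ s t = (ψs s t • S1 (ψ s t)) (us s t + vs s t)
      + S (ψ s t) (uss s t + vss s t) - ((ψs s t • T1 (ψ s t)) (q s) + T (ψ s t) (q' s))) :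
    ∃ Cf, 0 ≤ Cf ∧ ∀ t ∈ Ici (0:ℝ), ∀ s ∈ Icc 0 l,
      ‖D s t - Dψ s t‖ ≤ Cf * Real.exp (-μ * t) * (1 + ‖uss s t‖ + ‖us s t‖) := by
  obtain ⟨Q, hQ⟩ := isCompact_Icc.exists_bound_of_continuousOn
    (fun s hs => (h.dq s hs).continuousWithinAt : ContinuousOn q (Icc 0 l))
  obtain ⟨Q', hQ'⟩ := isCompact_Icc.exists_bound_of_continuousOn h.cq'
  have h0 : (0:ℝ) ∈ Icc 0 l := ⟨le_rfl, h.l_pos.le⟩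
  have hB := h.B_nonneg
  have hCθ := h.Cθ_nonneg
  have hb := h.curveS.nonneg
  have hQ0 : 0 ≤ Q := (norm_nonneg _).trans (hQ 0 h0)
  have hQ'0 : 0 ≤ Q' := (norm_nonneg _).trans (hQ' 0 h0)
  refine ⟨b * (1 + B) * Cθ * (1 + 2 * B + Q + Q'), by positivity, fun t ht s hs => ?_⟩
  have hS := h.curveS.norm_apply_sub_apply_le (h.ψs_le t ht s hs) (h.θ_sub_le t ht s hs)
    (h.θs_sub_le t ht s hs) (us s t + vs s t) (uss s t + vss s t)
  have hT := h.curveT.norm_apply_sub_apply_le (h.ψs_le t ht s hs) (h.θ_sub_le t ht s hs)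
    (h.θs_sub_le t ht s hs) (q s) (q' s)
  have e1 : ∀ a c x y : H, a - c - (x - y) = (a - x) - (c - y) := fun a c x y => by abel
  rw [hD t ht s hs, hDψ t ht s hs, e1]
  refine (norm_sub_le _ _).trans ((add_le_add hS hT).trans ?_)
  rw [← mul_add]
  have h1 := (norm_add_le (us s t) (vs s t)).trans (add_le_add le_rfl (h.vs_le t ht s hs))
  have h2 := (norm_add_le (uss s t) (vss s t)).trans (add_le_add le_rfl (h.vss_le t ht s hs))
  have h3 : ‖us s t + vs s t‖ + ‖uss s t + vss s t‖ + (‖q s‖ + ‖q' s‖)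
      ≤ (1 + 2 * B + Q + Q') * (1 + ‖uss s t‖ + ‖us s t‖) := by
    have := hQ s hs
    have := hQ' s hs
    nlinarith [mul_nonneg (by positivity : 0 ≤ 2 * B + Q + Q')
      (by positivity : 0 ≤ ‖uss s t‖ + ‖us s t‖)]
  calc _ ≤ b * (1 + B) * (Cθ * Real.exp (-μ * t))
        * ((1 + 2 * B + Q + Q') * (1 + ‖uss s t‖ + ‖us s t‖)) := by gcongr
    _ = _ := by ring

/-- The target error dynamics determine the acceleration of the reference up to lower-order
terms. -/
theorem exists_remainder (h : TrackSystem l K K' Kp Kv S S1 T T1 q q' e θ θs ψ ψs u us ut utt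
    v vs vss vt vtt D Dψ Dq b B g0 d0 d1 μ Cθ) {uss : ℝ → ℝ → H}
    (hDq : ∀ t ∈ Ici (0:ℝ), ∀ s ∈ Icc 0 l, Dq s t = K' s (us s t) + K s (uss s t))
    (hDψ : ∀ t ∈ Ici (0:ℝ), ∀ s ∈ Icc 0 l, Dψ s t = (ψs s t • S1 (ψ s t)) (us s t + vs s t)
      + S (ψ s t) (uss s t + vss s t) - ((ψs s t • T1 (ψ s t)) (q s) + T (ψ s t) (q' s))) :
    ∃ (r : ℝ → ℝ → H) (R : ℝ), 0 ≤ R ∧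
      ContinuousOn (fun z : ℝ × ℝ => r z.1 z.2) (Icc 0 l ×ˢ Ici 0) ∧
      (∀ t ∈ Ici (0:ℝ), ∀ s ∈ Icc 0 l, (K s - S (ψ s t)) (uss s t) = r s t - vtt s t) ∧
      (∀ t ∈ Ici (0:ℝ), ∀ s ∈ Icc 0 l,
        ‖r s t‖ ≤ R * (1 + ‖u s t‖ + ‖us s t‖ + ‖ut s t‖)) := by
  obtain ⟨Q, hQ⟩ := isCompact_Icc.exists_bound_of_continuousOn
    (fun s hs => (h.dq s hs).continuousWithinAt : ContinuousOn q (Icc 0 l))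
  obtain ⟨Q', hQ'⟩ := isCompact_Icc.exists_bound_of_continuousOn h.cq'
  obtain ⟨k', hk'⟩ := isCompact_Icc.exists_bound_of_continuousOn h.cK'
  obtain ⟨kp, hkp⟩ := isCompact_Icc.exists_bound_of_continuousOn h.cKp
  have h0 : (0:ℝ) ∈ Icc 0 l := ⟨le_rfl, h.l_pos.le⟩
  have hB := h.B_nonneg
  have hb := h.curveS.nonneg
  have hQ0 : 0 ≤ Q := (norm_nonneg _).trans (hQ 0 h0)
  have hQ'0 : 0 ≤ Q' := (norm_nonneg _).trans (hQ' 0 h0)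
  have hk'0 : 0 ≤ k' := (norm_nonneg _).trans (hk' 0 h0)
  have hkp0 : 0 ≤ kp := (norm_nonneg _).trans (hkp 0 h0)
  have hd1 : 0 ≤ d1 := (norm_nonneg _).trans (h.upKv 0 h0 0 self_mem_Ici)
  have hfst : MapsTo (Prod.fst : ℝ × ℝ → ℝ) (Icc 0 l ×ˢ Ici 0) (Icc 0 l) := fun z hz => hz.1
  have cq : ContinuousOn (fun z : ℝ × ℝ => q z.1) (Icc 0 l ×ˢ Ici 0) :=
    ContinuousOn.comp (fun s hs => (h.dq s hs).continuousWithinAt) continuousOn_fst hfst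
  have cq' : ContinuousOn (fun z : ℝ × ℝ => q' z.1) (Icc 0 l ×ˢ Ici 0) :=
    h.cq'.comp continuousOn_fst hfst
  have cK' : ContinuousOn (fun z : ℝ × ℝ => K' z.1) (Icc 0 l ×ˢ Ici 0) :=
    h.cK'.comp continuousOn_fst hfst
  have cKp : ContinuousOn (fun z : ℝ × ℝ => Kp z.1) (Icc 0 l ×ˢ Ici 0) :=
    h.cKp.comp continuousOn_fst hfst
  have hcc := fun {f : ℝ → H →L[ℝ] H} (hf : Continuous f) => hf.comp_continuousOn h.cψ
  have c1 := ((h.cψs.smul (hcc h.curveS.deriv_continuous)).clm_apply (h.cus.add h.cvs)).add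
    ((hcc h.curveS.continuous).clm_apply h.cvss)
  have c2 := ((h.cψs.smul (hcc h.curveT.deriv_continuous)).clm_apply cq).add
    ((hcc h.curveT.continuous).clm_apply cq')
  refine ⟨fun s t => (ψs s t • S1 (ψ s t)) (us s t + vs s t) + S (ψ s t) (vss s t)
      - ((ψs s t • T1 (ψ s t)) (q s) + T (ψ s t) (q' s)) + e - K' s (us s t) + Kv s t (ut s t)
      + Kp s (u s t), b * (1 + B) * (1 + 2 * B + Q + Q') + ‖e‖ + k' + d1 + kp, by positivity,
    ((((c1.sub c2).add continuousOn_const).sub (cK'.clm_apply h.cus)).add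
      (h.cKv.clm_apply h.cut)).add (cKp.clm_apply h.cu), fun t ht s hs => ?_, fun t ht s hs => ?_⟩
  · have ho := h.outer t ht s hs
    rw [hDq t ht s hs, hDψ t ht s hs, map_add (S (ψ s t))] at ho
    rw [_root_.sub_apply]
    rw [← sub_eq_zero] at ho ⊢
    rw [← neg_eq_zero, ← ho]
    dsimp only
    abel
  · have hS := h.curveS.norm_apply_add_apply_le (h.ψs_le t ht s hs) (y := ψ s t)
      (us s t + vs s t) (vss s t)
    have hT := h.curveT.norm_apply_add_apply_le (h.ψs_le t ht s hs) (y := ψ s t) (q s) (q' s)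
    have h1 := (norm_add_le (us s t) (vs s t)).trans (add_le_add le_rfl (h.vs_le t ht s hs))
    have h2 := h.vss_le t ht s hs
    have h3 := (K' s).le_of_opNorm_le (hk' s hs) (us s t)
    have h4 := (Kv s t).le_of_opNorm_le (h.upKv s hs t ht) (ut s t)
    have h5 := (Kp s).le_of_opNorm_le (hkp s hs) (u s t)
    have hS' : b * (1 + B) * (‖us s t + vs s t‖ + ‖vss s t‖)
        ≤ b * (1 + B) * (‖us s t‖ + B + B) := by gcongr
    have hT' : b * (1 + B) * (‖q s‖ + ‖q' s‖) ≤ b * (1 + B) * (Q + Q') := by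
      gcongr
      · exact hQ s hs
      · exact hQ' s hs
    have hn : ∀ x y f k v p : H, ‖x - y + f - k + v + p‖ ≤ ‖x‖ + ‖y‖ + ‖f‖ + ‖k‖ + ‖v‖ + ‖p‖ :=
      fun x y f k v p => (norm_add_le _ _).trans (add_le_add ((norm_add_le _ _).trans (add_le_add
        ((norm_sub_le _ _).trans (add_le_add ((norm_add_le _ _).trans (add_le_add
          (norm_sub_le _ _) le_rfl)) le_rfl)) le_rfl)) le_rfl)
    refine (hn _ _ _ _ _ _).trans ?_
    have hm : 0 ≤ b * (1 + B) := by positivity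
    have hX := norm_nonneg (u s t); have hY := norm_nonneg (us s t)
    have hZ := norm_nonneg (ut s t)
    generalize b * (1 + B) = m at *
    nlinarith [mul_nonneg hm hX, mul_nonneg hm hY, mul_nonneg hm hZ,
      mul_nonneg (mul_nonneg hm hB) (add_nonneg (add_nonneg hX hY) hZ),
      mul_nonneg (mul_nonneg hm hQ0) (add_nonneg (add_nonneg hX hY) hZ),
      mul_nonneg (mul_nonneg hm hQ'0) (add_nonneg (add_nonneg hX hY) hZ),
      mul_nonneg (norm_nonneg e) (add_nonneg (add_nonneg hX hY) hZ),
      mul_nonneg hk'0 (add_nonneg hX hZ), mul_nonneg hd1 (add_nonneg hX hY),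
      mul_nonneg hkp0 (add_nonneg hY hZ)]

end TrackSystem

end TrackSystemDecay

section TrackSystemDecay

variable {H : Type*} [NormedAddCommGroup H] [InnerProductSpace ℝ H]

namespace TrackSystem

variable {l : ℝ} {K K' Kp : ℝ → H →L[ℝ] H} {Kv : ℝ → ℝ → H →L[ℝ] H}
  {S S1 T T1 : ℝ → H →L[ℝ] H} {q q' : ℝ → H} {e : H} {θ θs ψ ψs : ℝ → ℝ → ℝ}
  {u us ut utt v vs vss vt vtt D Dψ Dq : ℝ → ℝ → H} {b B g0 d0 d1 μ Cθ : ℝ}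

theorem continuousOn_second_deriv
    (h : TrackSystem l K K' Kp Kv S S1 T T1 q q' e θ θs ψ ψs u us ut utt
      v vs vss vt vtt D Dψ Dq b B g0 d0 d1 μ Cθ) {uss r : ℝ → ℝ → H}
    (cr : ContinuousOn (fun z : ℝ × ℝ => r z.1 z.2) (Icc 0 l ×ˢ Ici 0))
    (hr : ∀ t ∈ Ici (0:ℝ), ∀ s ∈ Icc 0 l, (K s - S (ψ s t)) (uss s t) = r s t - vtt s t) :
    ContinuousOn (fun z : ℝ × ℝ => uss z.1 z.2) (Icc 0 l ×ˢ Ici 0) := by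
  have hfst : MapsTo (Prod.fst : ℝ × ℝ → ℝ) (Icc 0 l ×ˢ Ici 0) (Icc 0 l) := fun z hz => hz.1
  refine continuousOn_of_coercive (G := fun z : ℝ × ℝ => K z.1 - S (ψ z.1 z.2))
    (x := fun z => uss z.1 z.2) (y := fun z => r z.1 z.2 - vtt z.1 z.2) h.g0_pos
    ((h.continuousOn_K.comp continuousOn_fst hfst).sub
      (h.curveS.continuous.comp_continuousOn h.cψ)) (cr.sub h.cvtt)
    (fun z hz x => ?_) (fun z hz => hr z.2 hz.2 z.1 hz.1)
  rw [_root_.sub_apply, inner_sub_left]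
  linarith [h.gap z.1 hz.1 (ψ z.1 z.2) x]

/-- The pointwise estimates on the accelerations of the reference and of the tracking error. -/
theorem exists_acceleration_bounds
    (h : TrackSystem l K K' Kp Kv S S1 T T1 q q' e θ θs ψ ψs u us ut utt
      v vs vss vt vtt D Dψ Dq b B g0 d0 d1 μ Cθ) {uss r : ℝ → ℝ → H} {R Cf : ℝ} (hR : 0 ≤ R)
    (hCf : 0 ≤ Cf)
    (hr : ∀ t ∈ Ici (0:ℝ), ∀ s ∈ Icc 0 l, (K s - S (ψ s t)) (uss s t) = r s t - vtt s t)
    (hrR : ∀ t ∈ Ici (0:ℝ), ∀ s ∈ Icc 0 l,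
      ‖r s t‖ ≤ R * (1 + ‖u s t‖ + ‖us s t‖ + ‖ut s t‖))
    (hDq : ∀ t ∈ Ici (0:ℝ), ∀ s ∈ Icc 0 l, Dq s t = K' s (us s t) + K s (uss s t))
    (hF : ∀ t ∈ Ici (0:ℝ), ∀ s ∈ Icc 0 l,
      ‖D s t - Dψ s t‖ ≤ Cf * Real.exp (-μ * t) * (1 + ‖uss s t‖ + ‖us s t‖)) :
    ∃ C0 > 0, ∀ t ∈ Ici (0:ℝ), ∀ s ∈ Icc 0 l,
      g0 / 2 * ‖uss s t‖ ^ 2 ≤ -⟪vtt s t, uss s t⟫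
        + C0 * (1 + (‖u s t‖ ^ 2 + ‖us s t‖ ^ 2 + ‖ut s t‖ ^ 2)) ∧
      ‖vtt s t‖ ^ 2 ≤ C0 * (1 + ‖uss s t‖ ^ 2
        + (‖u s t‖ ^ 2 + ‖us s t‖ ^ 2 + ‖ut s t‖ ^ 2)) ∧
      ‖utt s t‖ ^ 2 ≤ C0 * (1 + ‖uss s t‖ ^ 2
        + (‖u s t‖ ^ 2 + ‖us s t‖ ^ 2 + ‖ut s t‖ ^ 2)) := by
  obtain ⟨k, hk⟩ := isCompact_Icc.exists_bound_of_continuousOn h.continuousOn_K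
  obtain ⟨k', hk'⟩ := isCompact_Icc.exists_bound_of_continuousOn h.cK'
  obtain ⟨kp, hkp⟩ := isCompact_Icc.exists_bound_of_continuousOn h.cKp
  have h0 : (0:ℝ) ∈ Icc 0 l := ⟨le_rfl, h.l_pos.le⟩
  have hb := h.curveS.nonneg
  have hg0 := h.g0_pos
  have hk0 : 0 ≤ k := (norm_nonneg _).trans (hk 0 h0)
  have hk'0 : 0 ≤ k' := (norm_nonneg _).trans (hk' 0 h0)
  have hkp0 : 0 ≤ kp := (norm_nonneg _).trans (hkp 0 h0)
  have hd1 : 0 ≤ d1 := (norm_nonneg _).trans (h.upKv 0 h0 0 self_mem_Ici)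
  refine ⟨1 + 5 * R ^ 2 / (2 * g0) + 5 * (k + b + R) ^ 2 + 5 * (k + k' + d1 + kp + Cf) ^ 2,
    by positivity, fun t ht s hs => ?_⟩
  have hr' := hr t ht s hs
  have hrR' := hrR t ht s hs
  have hu0 := norm_nonneg (u s t); have hus0 := norm_nonneg (us s t)
  have hut0 := norm_nonneg (ut s t); have huss0 := norm_nonneg (uss s t)
  have hsq := sq_sum_le_five ‖u s t‖ ‖us s t‖ ‖ut s t‖ ‖uss s t‖
  have hsq0 : (1 + ‖u s t‖ + ‖us s t‖ + ‖ut s t‖) ^ 2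
      ≤ 5 * (1 + (‖u s t‖ ^ 2 + ‖us s t‖ ^ 2 + ‖ut s t‖ ^ 2)) := by
    simpa using sq_sum_le_five ‖u s t‖ ‖us s t‖ ‖ut s t‖ 0
  have hX : (1 + ‖u s t‖ + ‖us s t‖ + ‖ut s t‖ + ‖uss s t‖) ^ 2
      ≤ 5 * (1 + ‖uss s t‖ ^ 2 + (‖u s t‖ ^ 2 + ‖us s t‖ ^ 2 + ‖ut s t‖ ^ 2)) := hsq
  have h1 : 0 ≤ 5 * R ^ 2 / (2 * g0) := by positivity
  have h2 : 0 ≤ 5 * (k + b + R) ^ 2 := by positivity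
  have h3 : 0 ≤ 5 * (k + k' + d1 + kp + Cf) ^ 2 := by positivity
  refine ⟨?_, ?_, ?_⟩
  · have hgap := h.gap s hs (ψ s t) (uss s t)
    have e1 : ⟪(K s - S (ψ s t)) (uss s t), uss s t⟫ = ⟪r s t, uss s t⟫ - ⟪vtt s t, uss s t⟫ := by
      rw [hr', inner_sub_left]
    rw [_root_.sub_apply, inner_sub_left] at e1
    have h4 := real_inner_le_norm (r s t) (uss s t)
    have h5 : ‖r s t‖ * ‖uss s t‖ ≤ g0 / 2 * ‖uss s t‖ ^ 2 + ‖r s t‖ ^ 2 / (2 * g0) := by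
      have : 0 ≤ (g0 * ‖uss s t‖ - ‖r s t‖) ^ 2 / (2 * g0) := by positivity
      have e2 : (g0 * ‖uss s t‖ - ‖r s t‖) ^ 2 / (2 * g0)
          = g0 / 2 * ‖uss s t‖ ^ 2 + ‖r s t‖ ^ 2 / (2 * g0) - ‖r s t‖ * ‖uss s t‖ := by
        field_simp
        ring
      linarith
    have h6 : ‖r s t‖ ^ 2 / (2 * g0)
        ≤ 5 * R ^ 2 / (2 * g0) * (1 + (‖u s t‖ ^ 2 + ‖us s t‖ ^ 2 + ‖ut s t‖ ^ 2)) := by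
      rw [div_mul_eq_mul_div]
      gcongr
      calc ‖r s t‖ ^ 2 ≤ (R * (1 + ‖u s t‖ + ‖us s t‖ + ‖ut s t‖)) ^ 2 := by gcongr
        _ = R ^ 2 * (1 + ‖u s t‖ + ‖us s t‖ + ‖ut s t‖) ^ 2 := by ring
        _ ≤ R ^ 2 * (5 * (1 + (‖u s t‖ ^ 2 + ‖us s t‖ ^ 2 + ‖ut s t‖ ^ 2))) := by gcongr
        _ = _ := by ring
    have h7 : 5 * R ^ 2 / (2 * g0) * (1 + (‖u s t‖ ^ 2 + ‖us s t‖ ^ 2 + ‖ut s t‖ ^ 2))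
        ≤ (1 + 5 * R ^ 2 / (2 * g0) + 5 * (k + b + R) ^ 2 + 5 * (k + k' + d1 + kp + Cf) ^ 2)
          * (1 + (‖u s t‖ ^ 2 + ‖us s t‖ ^ 2 + ‖ut s t‖ ^ 2)) := by
      gcongr
      linarith
    linarith
  · have h4 : ‖vtt s t‖ ≤ (k + b + R) * (1 + ‖u s t‖ + ‖us s t‖ + ‖ut s t‖ + ‖uss s t‖) := by
      have e1 : vtt s t = r s t - (K s - S (ψ s t)) (uss s t) := by rw [hr']; abel
      have h5 : ‖(K s - S (ψ s t)) (uss s t)‖ ≤ (k + b) * ‖uss s t‖ :=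
        ContinuousLinearMap.le_of_opNorm_le _
          ((norm_sub_le _ _).trans (add_le_add (hk s hs) (h.curveS.le _))) _
      rw [e1]
      refine (norm_sub_le _ _).trans ?_
      nlinarith [mul_nonneg (add_nonneg hk0 hb)
        (by positivity : 0 ≤ 1 + ‖u s t‖ + ‖us s t‖ + ‖ut s t‖), mul_nonneg hR huss0]
    calc ‖vtt s t‖ ^ 2
        ≤ ((k + b + R) * (1 + ‖u s t‖ + ‖us s t‖ + ‖ut s t‖ + ‖uss s t‖)) ^ 2 := by gcongr
      _ = (k + b + R) ^ 2 * (1 + ‖u s t‖ + ‖us s t‖ + ‖ut s t‖ + ‖uss s t‖) ^ 2 := by ring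
      _ ≤ (k + b + R) ^ 2 * (5 * (1 + ‖uss s t‖ ^ 2
          + (‖u s t‖ ^ 2 + ‖us s t‖ ^ 2 + ‖ut s t‖ ^ 2))) := by gcongr
      _ = 5 * (k + b + R) ^ 2 * (1 + ‖uss s t‖ ^ 2
          + (‖u s t‖ ^ 2 + ‖us s t‖ ^ 2 + ‖ut s t‖ ^ 2)) := by ring
      _ ≤ _ := by
        gcongr
        linarith
  · have h4 : ‖utt s t‖ ≤ (k + k' + d1 + kp + Cf)
        * (1 + ‖u s t‖ + ‖us s t‖ + ‖ut s t‖ + ‖uss s t‖) := by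
      have e1 : utt s t = (D s t - Dψ s t) + (K' s (us s t) + K s (uss s t)) - Kv s t (ut s t)
          - Kp s (u s t) := by
        have hp := h.plant t ht s hs
        have ho := h.outer t ht s hs
        rw [← hDq t ht s hs, add_sub_assoc, add_sub_assoc, sub_sub, ← sub_sub, ← ho,
          eq_sub_of_add_eq hp]
        abel
      have h5 : ‖D s t - Dψ s t‖ ≤ Cf * (1 + ‖uss s t‖ + ‖us s t‖) := by
        refine (hF t ht s hs).trans ?_
        gcongr
        refine mul_le_of_le_one_right hCf (Real.exp_le_one_iff.2 ?_)
        have : 0 ≤ t := ht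
        nlinarith [h.μ_pos]
      have h6 := (K' s).le_of_opNorm_le (hk' s hs) (us s t)
      have h7 := (Kv s t).le_of_opNorm_le (h.upKv s hs t ht) (ut s t)
      have h8 := (Kp s).le_of_opNorm_le (hkp s hs) (u s t)
      have h9 := (K s).le_of_opNorm_le (hk s hs) (uss s t)
      have hn : ∀ x y z v w : H, ‖x + (y + z) - v - w‖ ≤ ‖x‖ + (‖y‖ + ‖z‖) + ‖v‖ + ‖w‖ :=
        fun x y z v w => (norm_sub_le _ _).trans (add_le_add ((norm_sub_le _ _).trans (add_le_add
          ((norm_add_le _ _).trans (add_le_add le_rfl (norm_add_le _ _))) le_rfl)) le_rfl)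
      rw [e1]
      refine (hn _ _ _ _ _).trans ?_
      set X := 1 + ‖u s t‖ + ‖us s t‖ + ‖ut s t‖ + ‖uss s t‖ with hXdef
      have g1 : Cf * (1 + ‖uss s t‖ + ‖us s t‖) ≤ Cf * X :=
        mul_le_mul_of_nonneg_left (by linarith) hCf
      have g2 : k' * ‖us s t‖ ≤ k' * X := mul_le_mul_of_nonneg_left (by linarith) hk'0
      have g3 : k * ‖uss s t‖ ≤ k * X := mul_le_mul_of_nonneg_left (by linarith) hk0
      have g4 : d1 * ‖ut s t‖ ≤ d1 * X := mul_le_mul_of_nonneg_left (by linarith) hd1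
      have g5 : kp * ‖u s t‖ ≤ kp * X := mul_le_mul_of_nonneg_left (by linarith) hkp0
      linarith
    calc ‖utt s t‖ ^ 2 ≤ ((k + k' + d1 + kp + Cf)
          * (1 + ‖u s t‖ + ‖us s t‖ + ‖ut s t‖ + ‖uss s t‖)) ^ 2 := by gcongr
      _ = (k + k' + d1 + kp + Cf) ^ 2
          * (1 + ‖u s t‖ + ‖us s t‖ + ‖ut s t‖ + ‖uss s t‖) ^ 2 := by ring
      _ ≤ (k + k' + d1 + kp + Cf) ^ 2 * (5 * (1 + ‖uss s t‖ ^ 2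
          + (‖u s t‖ ^ 2 + ‖us s t‖ ^ 2 + ‖ut s t‖ ^ 2))) := by gcongr
      _ = 5 * (k + k' + d1 + kp + Cf) ^ 2 * (1 + ‖uss s t‖ ^ 2
          + (‖u s t‖ ^ 2 + ‖us s t‖ ^ 2 + ‖ut s t‖ ^ 2)) := by ring
      _ ≤ _ := by
        gcongr
        linarith

end TrackSystem

end TrackSystemDecay

section TrackSystemDecay

variable {H : Type*} [NormedAddCommGroup H] [InnerProductSpace ℝ H]

/-- Exponential decay of the tracking energy of the closed-loop system. -/
theorem TrackSystem.exists_exp_decay [CompleteSpace H]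
    {l : ℝ} {K K' Kp : ℝ → H →L[ℝ] H} {Kv : ℝ → ℝ → H →L[ℝ] H}
    {S S1 T T1 : ℝ → H →L[ℝ] H} {q q' : ℝ → H} {e : H} {θ θs ψ ψs : ℝ → ℝ → ℝ}
    {u us ut utt v vs vss vt vtt D Dψ Dq : ℝ → ℝ → H} {b B g0 d0 d1 μ Cθ : ℝ}
    (h : TrackSystem l K K' Kp Kv S S1 T T1 q q' e θ θs ψ ψs u us ut utt
      v vs vss vt vtt D Dψ Dq b B g0 d0 d1 μ Cθ) :
    ∃ C > 0, ∃ lam > 0, ∀ t ∈ Ici (0:ℝ),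
      ∫ s in (0:ℝ)..l, (‖u s t‖ ^ 2 + ‖us s t‖ ^ 2 + ‖ut s t‖ ^ 2) ≤ C * Real.exp (-lam * t) := by
  have hl := h.l_pos
  obtain ⟨uss, hdss, hDq, hD, hDψ⟩ := h.exists_second_deriv
  obtain ⟨Cf, hCf, hF⟩ := h.exists_mismatch_bound hD hDψ
  obtain ⟨r, R, hR, cr, hr, hrR⟩ := h.exists_remainder hDq hDψ
  obtain ⟨C0, hC0, hacc⟩ := h.exists_acceleration_bounds hR hCf hr hrR hDq hF
  have cuss := h.continuousOn_second_deriv cr hr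
  have hfst : MapsTo (Prod.fst : ℝ × ℝ → ℝ) (Icc 0 l ×ˢ Ici 0) (Icc 0 l) := fun z hz => hz.1
  have cDq : ContinuousOn (fun z : ℝ × ℝ => Dq z.1 z.2) (Icc 0 l ×ˢ Ici 0) := by
    refine (((h.cK'.comp continuousOn_fst hfst).clm_apply h.cus).add
      ((h.continuousOn_K.comp continuousOn_fst hfst).clm_apply cuss)).congr fun z hz => ?_
    exact hDq z.2 hz.2 z.1 hz.1
  have hkey : ∀ t ∈ Ici (0:ℝ), ∀ s ∈ Icc 0 l,
      utt s t = Dq s t - Kv s t (ut s t) - Kp s (u s t) + (D s t - Dψ s t) := fun t ht s hs => by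
    rw [← h.outer t ht s hs, eq_sub_of_add_eq (h.plant t ht s hs)]
    abel
  have cF : ContinuousOn (fun z : ℝ × ℝ => D z.1 z.2 - Dψ z.1 z.2) (Icc 0 l ×ˢ Ici 0) := by
    refine (h.cutt.sub ((cDq.sub (h.cKv.clm_apply h.cut)).sub
      ((h.cKp.comp continuousOn_fst hfst).clm_apply h.cu))).congr fun z hz => ?_
    have := hkey z.2 hz.2 z.1 hz.1
    simp only [Pi.sub_apply, Function.comp_apply, this]
    abel
  have hwave := WaveField.of_hasDerivWithinAt hl.le (K := K) h.cu h.cus h.cut h.cutt cDq h.du h.dut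
    h.dus h.dDq h.u_left h.u_right
  have hid := WaveField.of_hasDerivWithinAt hl.le (K := fun _ => ContinuousLinearMap.id ℝ H)
    h.cu h.cus h.cut h.cutt cuss h.du h.dut h.dus hdss h.u_left h.u_right
  obtain ⟨k1, k2, hcoeff⟩ := WaveCoeff.exists_of_continuousOn hl h.g0_pos h.d0_pos h.continuousOn_K
    h.cKp h.cKv h.symmK h.symmKp
    (fun s hs x => (le_add_of_nonneg_right (h.nonnegS 0 x)).trans (h.gap s hs 0 x))
    h.lowKp h.lowKv h.upKv
  have htrack : TrackField l B (g0 / 2) C0 (clampExt l u) (clampExt l us) (clampExt l uss)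
      (clampExt l ut) (clampExt l utt) (clampExt l v) (clampExt l vs) (clampExt l vss)
      (clampExt l vt) (clampExt l vtt) :=
    { wave := hid
      l_pos := hl
      B_nonneg := h.B_nonneg
      c0_pos := half_pos h.g0_pos
      C0_pos := hC0
      cv := continuous_clampExt hl.le h.cv
      cvs := continuous_clampExt hl.le h.cvs
      cvss := continuous_clampExt hl.le h.cvss
      cvt := continuous_clampExt hl.le h.cvt
      cvtt := continuous_clampExt hl.le h.cvtt
      dt := fun s hs t ht => by
        rw [clampExt_apply vt hs ht.le]
        exact hasDerivAt_clampExt_right hs ht (h.dv t ht.le s hs)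
      dtt := fun s hs t ht => by
        rw [clampExt_apply vtt hs ht.le]
        exact hasDerivAt_clampExt_right hs ht (h.dvt t ht.le s hs)
      ds := fun t ht s hs => by
        rw [clampExt_apply vs (Ioo_subset_Icc_self hs) ht.le]
        exact hasDerivAt_clampExt_left hs ht.le (h.dvs t ht.le s (Ioo_subset_Icc_self hs))
      dss := fun t ht s hs => by
        rw [clampExt_apply vss (Ioo_subset_Icc_self hs) ht.le]
        exact hasDerivAt_clampExt_left hs ht.le (h.dvss t ht.le s (Ioo_subset_Icc_self hs))
      left := fun t ht => by rw [clampExt_apply v ⟨le_rfl, hl.le⟩ ht.le, h.v_left t ht.le]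
      vs_le := fun t ht s hs => by
        rw [clampExt_apply vs hs ht.le]
        exact h.vs_le t ht.le s hs
      vss_le := fun t ht s hs => by
        rw [clampExt_apply vss hs ht.le]
        exact h.vss_le t ht.le s hs
      coer := fun t ht s hs => by
        simp only [clampExt_apply _ hs ht.le]
        exact (hacc t ht.le s hs).1
      vtt_le := fun t ht s hs => by
        simp only [clampExt_apply _ hs ht.le]
        exact (hacc t ht.le s hs).2.1
      utt_le := fun t ht s hs => by
        simp only [clampExt_apply _ hs ht.le]
        exact (hacc t ht.le s hs).2.2 }
  obtain ⟨C, hC, lam, hlam, hdec⟩ := htrack.exists_exp_decay hcoeff hwave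
    (continuous_clampExt hl.le (f := fun s t => D s t - Dψ s t) cF)
    (fun s hs t ht => by
      simp only [clampExt_apply _ hs ht.le, clampIcc_of_mem hs]
      exact hkey t ht.le s hs) h.μ_pos (Cf := Cf)
    (fun s hs t ht => by
      simp only [clampExt_apply _ hs ht.le]
      exact hF t ht.le s hs)
  have cE : Continuous (fieldEnergy l (clampExt l u) (clampExt l us) (clampExt l ut)) := by
    have c1 := hid.cw; have c2 := hid.cws; have c3 := hid.cwt
    exact continuous_integral_right (f := fun z => ‖clampExt l u z‖ ^ 2 + ‖clampExt l us z‖ ^ 2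
      + ‖clampExt l ut z‖ ^ 2) (by fun_prop) 0 l
  obtain ⟨C', hC', hdec'⟩ := exists_exp_bound_of_eventually (l := 0) (cE.comp continuous_snd)
    hC hlam fun t ht s _ => by
      rw [Function.comp_apply, Real.norm_of_nonneg (htrack.fieldEnergy_nonneg t)]
      exact hdec t ht
  refine ⟨C', hC', lam, hlam, fun t ht => ?_⟩
  refine le_trans (le_of_eq ?_) ((le_abs_self _).trans (hdec' t ht 0 ⟨le_rfl, le_rfl⟩))
  refine integral_congr fun s hs => ?_
  rw [uIcc_of_le hl.le] at hs
  simp only [clampExt_apply _ hs ht]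

end TrackSystemDecay

section Plane

/-- Plane vectors with the Euclidean norm. -/
noncomputable def planeVec : (Fin 2 → ℝ) →L[ℝ] EuclideanSpace ℝ (Fin 2) :=
  ((EuclideanSpace.equiv (Fin 2) ℝ).symm : (Fin 2 → ℝ) →L[ℝ] EuclideanSpace ℝ (Fin 2))

/-- Plane matrices as operators on the Euclidean plane. -/
noncomputable def planeOp : Matrix (Fin 2) (Fin 2) ℝ →L[ℝ]
    (EuclideanSpace ℝ (Fin 2) →L[ℝ] EuclideanSpace ℝ (Fin 2)) :=
  LinearMap.toContinuousLinearMap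
    (Matrix.toEuclideanCLM (n := Fin 2) (𝕜 := ℝ)).toAlgEquiv.toLinearMap

theorem planeOp_planeVec (A : Matrix (Fin 2) (Fin 2) ℝ) (x : Fin 2 → ℝ) :
    planeOp A (planeVec x) = planeVec (A *ᵥ x) := rfl

theorem exists_planeVec_eq (x : EuclideanSpace ℝ (Fin 2)) : ∃ y, planeVec y = x :=
  ⟨x.ofLp, rfl⟩

theorem norm_sq_planeVec (x : Fin 2 → ℝ) : ‖planeVec x‖ ^ 2 = x 0 ^ 2 + x 1 ^ 2 := by
  rw [EuclideanSpace.real_norm_sq_eq, Fin.sum_univ_two]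
  rfl

theorem inner_planeVec (x y : Fin 2 → ℝ) : ⟪planeVec x, planeVec y⟫ = y ⬝ᵥ x :=
  EuclideanSpace.inner_toLp_toLp x y

theorem norm_planeVec_le {x : Fin 2 → ℝ} {B : ℝ} (h : ‖x‖ ≤ B) : ‖planeVec x‖ ≤ 2 * B := by
  have hB := (norm_nonneg x).trans h
  refine le_of_sq_le_sq ?_ (by positivity)
  have h0 : |x 0| ≤ B := (norm_le_pi_norm x 0).trans h
  have h1 : |x 1| ≤ B := (norm_le_pi_norm x 1).trans h
  rw [norm_sq_planeVec]
  nlinarith [sq_le_sq' (abs_le.1 h0).1 (abs_le.1 h0).2, sq_le_sq' (abs_le.1 h1).1 (abs_le.1 h1).2,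
    sq_nonneg B]

theorem inner_planeOp (A : Matrix (Fin 2) (Fin 2) ℝ) (x : Fin 2 → ℝ) :
    ⟪planeOp A (planeVec x), planeVec x⟫ = x ⬝ᵥ (A *ᵥ x) := by
  rw [planeOp_planeVec, inner_planeVec]

theorem inner_planeOp_comm {A : Matrix (Fin 2) (Fin 2) ℝ} (hA : A.IsSymm)
    (x y : EuclideanSpace ℝ (Fin 2)) : ⟪planeOp A x, y⟫ = ⟪x, planeOp A y⟫ := by
  obtain ⟨x, rfl⟩ := exists_planeVec_eq x
  obtain ⟨y, rfl⟩ := exists_planeVec_eq y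
  have h := hA.apply 0 1
  rw [planeOp_planeVec, planeOp_planeVec, inner_planeVec, inner_planeVec]
  simp only [dotProduct, mulVec, Fin.sum_univ_two]
  rw [h]
  ring

theorem inner_planeOp_nonneg {A : Matrix (Fin 2) (Fin 2) ℝ} (hA : A.PosSemidef)
    (x : EuclideanSpace ℝ (Fin 2)) : 0 ≤ ⟪planeOp A x, x⟫ := by
  obtain ⟨x, rfl⟩ := exists_planeVec_eq x
  rw [inner_planeOp]
  exact hA.dotProduct_mulVec_nonneg x

theorem isUnit_planeOp {A : Matrix (Fin 2) (Fin 2) ℝ} (hA : A.PosDef) : IsUnit (planeOp A) :=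
  hA.isUnit.map (Matrix.toEuclideanCLM (n := Fin 2) (𝕜 := ℝ))

theorem planeOp_one : planeOp 1 = 1 := map_one (Matrix.toEuclideanCLM (n := Fin 2) (𝕜 := ℝ))

theorem planeOp_eq_sum (A : Matrix (Fin 2) (Fin 2) ℝ) :
    planeOp A = ∑ i, ∑ j, A i j • planeOp (Matrix.single i j 1) := by
  conv_lhs => rw [Matrix.matrix_eq_sum_single A]
  simp only [map_sum, ← map_smul, Matrix.smul_single, smul_eq_mul, mul_one]

theorem norm_planeOp_le {A : Matrix (Fin 2) (Fin 2) ℝ} {k : ℝ} (h : ∀ i j, |A i j| ≤ k) :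
    ‖planeOp A‖ ≤ ∑ i, ∑ j, k * ‖planeOp (Matrix.single i j 1)‖ := by
  rw [planeOp_eq_sum]
  refine norm_sum_le_of_le _ fun i _ => norm_sum_le_of_le _ fun j _ => ?_
  rw [norm_smul, Real.norm_eq_abs]
  gcongr
  exact h i j

theorem hasDerivWithinAt_planeOp {A : ℝ → Matrix (Fin 2) (Fin 2) ℝ} {A' : Matrix (Fin 2) (Fin 2) ℝ}
    {D : Set ℝ} {s : ℝ} (h : ∀ i j, HasDerivWithinAt (fun x => A x i j) (A' i j) D s) :
    HasDerivWithinAt (fun x => planeOp (A x)) (planeOp A') D s := by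
  simp only [planeOp_eq_sum (A _), planeOp_eq_sum A']
  exact HasDerivWithinAt.fun_sum fun i _ => HasDerivWithinAt.fun_sum fun j _ =>
    HasDerivWithinAt.smul_const (F := EuclideanSpace ℝ (Fin 2) →L[ℝ] EuclideanSpace ℝ (Fin 2))
      (h i j) (planeOp (Matrix.single i j 1))

theorem hasDerivWithinAt_planeVec {f : ℝ → Fin 2 → ℝ} {f' : Fin 2 → ℝ} {D : Set ℝ} {s : ℝ}
    (h : HasDerivWithinAt f f' D s) :
    HasDerivWithinAt (fun x => planeVec (f x)) (planeVec f') D s :=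
  planeVec.hasFDerivAt.comp_hasDerivWithinAt s h

theorem abs_entry_le_of_posSemidef {A : Matrix (Fin 2) (Fin 2) ℝ} {k : ℝ} (hA : A.PosSemidef)
    (hk : (k • (1 : Matrix (Fin 2) (Fin 2) ℝ) - A).PosSemidef) (hs : A.IsSymm) (i j : Fin 2) :
    |A i j| ≤ k := by
  have h := hs.apply 0 1
  have h1 : ∀ x : Fin 2 → ℝ, 0 ≤ x ⬝ᵥ (A *ᵥ x) := hA.dotProduct_mulVec_nonneg
  have h2 : ∀ x : Fin 2 → ℝ, 0 ≤ x ⬝ᵥ ((k • (1 : Matrix (Fin 2) (Fin 2) ℝ) - A) *ᵥ x) :=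
    hk.dotProduct_mulVec_nonneg
  have a1 := h1 ![1, 0]; have a2 := h1 ![0, 1]; have a3 := h1 ![1, 1]; have a4 := h1 ![1, -1]
  have b1 := h2 ![1, 0]; have b2 := h2 ![0, 1]; have b3 := h2 ![1, 1]; have b4 := h2 ![1, -1]
  simp [dotProduct, mulVec, Fin.sum_univ_two] at a1 a2 a3 a4 b1 b2 b3 b4
  fin_cases i <;> fin_cases j <;> simp only [abs_le] <;> constructor <;> simp <;> linarith

theorem exists_lipschitzCurve_rot_conj {A : Matrix (Fin 2) (Fin 2) ℝ} (h01 : A 0 1 = 0)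
    (h10 : A 1 0 = 0) :
    ∃ b S1, LipschitzCurve b (fun x => planeOp (Rot x * A * (Rot x)ᵀ)) S1 := by
  obtain ⟨b, hb⟩ := exists_lipschitzCurve_trig 2
    (planeOp (((A 0 0 + A 1 1) / 2) • (1 : Matrix (Fin 2) (Fin 2) ℝ)))
    (planeOp (((A 0 0 - A 1 1) / 2) • !![1, 0; 0, -1]))
    (planeOp (((A 0 0 - A 1 1) / 2) • !![0, 1; 1, 0]))
  refine ⟨b, _, Eq.subst (motive := fun S => LipschitzCurve b S _) (funext fun x => ?_) hb⟩
  rw [← planeOp.map_smul, ← planeOp.map_smul, ← planeOp.map_add, ← planeOp.map_add]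
  congr 1
  rw [Real.cos_two_mul, Real.sin_two_mul]
  have hsc := Real.sin_sq_add_cos_sq x
  ext i j
  fin_cases i <;> fin_cases j <;>
    simp [Rot, Matrix.mul_apply, Fin.sum_univ_two, Matrix.vecMul, dotProduct, h01, h10]
  · linear_combination -A 1 1 * hsc
  · ring
  · ring
  · linear_combination -A 0 0 * hsc

theorem exists_lipschitzCurve_rot_mul (A : Matrix (Fin 2) (Fin 2) ℝ) :
    ∃ b S1, LipschitzCurve b (fun x => planeOp (Rot x * A)) S1 := by
  obtain ⟨b, hb⟩ := exists_lipschitzCurve_trig 1 0 (planeOp A) (planeOp (!![0, -1; 1, 0] * A))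
  refine ⟨b, _, Eq.subst (motive := fun S => LipschitzCurve b S _) (funext fun x => ?_) hb⟩
  rw [zero_add, ← planeOp.map_smul, ← planeOp.map_smul, ← planeOp.map_add, one_mul]
  congr 1
  ext i j
  fin_cases i <;> fin_cases j <;>
    simp [Rot, Matrix.mul_apply, Fin.sum_univ_two, Matrix.vecMul, dotProduct, add_comm]

theorem dotProduct_rot_conj (A : Matrix (Fin 2) (Fin 2) ℝ) (a : ℝ) (x : Fin 2 → ℝ) :
    x ⬝ᵥ ((Rot a * A * (Rot a)ᵀ) *ᵥ x) = ((Rot a)ᵀ *ᵥ x) ⬝ᵥ (A *ᵥ ((Rot a)ᵀ *ᵥ x)) := by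
  rw [← Matrix.mulVec_mulVec, ← Matrix.mulVec_mulVec, Matrix.dotProduct_mulVec,
    ← Matrix.mulVec_transpose]

theorem rot_transpose_mulVec_sq (a : ℝ) (x : Fin 2 → ℝ) :
    ((Rot a)ᵀ *ᵥ x) 0 ^ 2 + ((Rot a)ᵀ *ᵥ x) 1 ^ 2 = x 0 ^ 2 + x 1 ^ 2 := by
  simp [Rot, mulVec, dotProduct, Fin.sum_univ_two]
  linear_combination (x 0 ^ 2 + x 1 ^ 2) * Real.sin_sq_add_cos_sq a

end Plane

section Coercivity

variable {H : Type*} [NormedAddCommGroup H] [InnerProductSpace ℝ H] [FiniteDimensional ℝ H]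

/-- A continuous family of positive forms on a compact interval is uniformly coercive. -/
theorem exists_uniform_coercive {l : ℝ} {K : ℝ → H →L[ℝ] H} (cK : ContinuousOn K (Icc 0 l))
    (hpos : ∀ s ∈ Icc 0 l, ∀ x, x ≠ 0 → 0 < ⟪K s x, x⟫) :
    ∃ g > 0, ∀ s ∈ Icc 0 l, ∀ x, g * ‖x‖ ^ 2 ≤ ⟪K s x, x⟫ := by
  have hcomp : IsCompact (Icc 0 l ×ˢ Metric.sphere (0 : H) 1) :=
    isCompact_Icc.prod (isCompact_sphere 0 1)
  have hcont : ContinuousOn (fun z : ℝ × H => ⟪K z.1 z.2, z.2⟫)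
      (Icc 0 l ×ˢ Metric.sphere (0 : H) 1) :=
    (ContinuousOn.clm_apply (cK.comp continuousOn_fst fun (z : ℝ × H) hz => hz.1)
      continuousOn_snd).inner continuousOn_snd
  obtain ⟨g, hg, hle⟩ := hcomp.exists_forall_le' hcont (a := 0) fun z hz => hpos z.1 hz.1 z.2
    (ne_zero_of_mem_unit_sphere ⟨z.2, hz.2⟩)
  refine ⟨g, hg, fun s hs x => ?_⟩
  rcases eq_or_ne x 0 with rfl | hx
  · simp
  have hn : 0 < ‖x‖ := norm_pos_iff.2 hx
  have h1 := hle (s, ‖x‖⁻¹ • x) ⟨hs, by simp [norm_smul, hn.ne']⟩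
  simp only [map_smul, inner_smul_left, inner_smul_right, conj_trivial] at h1
  calc g * ‖x‖ ^ 2 ≤ ‖x‖⁻¹ * (‖x‖⁻¹ * ⟪K s x, x⟫) * ‖x‖ ^ 2 := by gcongr
    _ = ⟪K s x, x⟫ := by field_simp

end Coercivity

section Norms

theorem linfNorm_le {l M : ℝ} {f : ℝ → ℝ} (hM : 0 ≤ M) (h : ∀ s ∈ Icc 0 l, |f s| ≤ M) :
    LinfNorm l f ≤ M :=
  Real.sSup_le (by rintro _ ⟨s, hs, rfl⟩; exact h s hs) hM

theorem l2norm_le {l M : ℝ} {f : ℝ → ℝ} (hl : 0 ≤ l) (hM : 0 ≤ M)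
    (h : ∀ s ∈ Icc 0 l, |f s| ≤ M) : L2norm l f ≤ √l * M := by
  have h1 : ‖∫ s in (0:ℝ)..l, f s ^ 2‖ ≤ M ^ 2 * |l - 0| :=
    norm_integral_le_of_norm_le_const fun s hs => by
      rw [uIoc_of_le hl] at hs
      rw [norm_pow, Real.norm_eq_abs]
      exact pow_le_pow_left₀ (abs_nonneg _) (h s ⟨hs.1.le, hs.2⟩) 2
  rw [sub_zero, abs_of_nonneg hl] at h1
  calc L2norm l f ≤ √(M ^ 2 * l) := Real.sqrt_le_sqrt ((le_abs_self _).trans h1)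
    _ = √l * M := by rw [Real.sqrt_mul (sq_nonneg M), Real.sqrt_sq hM, mul_comm]

theorem l2vnorm_le {l M : ℝ} {f : ℝ → Fin 2 → ℝ} {G : ℝ → ℝ} (hl : 0 ≤ l)
    (cf : ContinuousOn f (Icc 0 l)) (cG : ContinuousOn G (Icc 0 l))
    (h : ∀ s ∈ Icc 0 l, ‖planeVec (f s)‖ ^ 2 ≤ G s) (hM : ∫ s in (0:ℝ)..l, G s ≤ M) :
    L2vnorm l f ≤ √M := by
  refine Real.sqrt_le_sqrt (le_trans (integral_mono_on hl ?_ ?_ fun s hs => ?_) hM)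
  · have h0 : ContinuousOn (fun s => f s 0) (Icc 0 l) :=
      (continuous_apply (0 : Fin 2)).comp_continuousOn cf
    have h1 : ContinuousOn (fun s => f s 1) (Icc 0 l) :=
      (continuous_apply (1 : Fin 2)).comp_continuousOn cf
    exact ContinuousOn.intervalIntegrable_of_Icc hl ((h0.pow 2).add (h1.pow 2))
  · exact ContinuousOn.intervalIntegrable_of_Icc hl cG
  · rw [← norm_sq_planeVec]
    exact h s hs

theorem sqrt_mul_exp {C x : ℝ} (hC : 0 ≤ C) :
    √(C * Real.exp x) = √C * Real.exp (x / 2) := by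
  rw [Real.sqrt_mul hC, Real.exp_half]

end Norms

section Gains

theorem inner_planeOp_rot_conj_nonneg {A : Matrix (Fin 2) (Fin 2) ℝ} (hA : A.PosDef) (a : ℝ)
    (x : EuclideanSpace ℝ (Fin 2)) : 0 ≤ ⟪planeOp (Rot a * A * (Rot a)ᵀ) x, x⟫ := by
  obtain ⟨x, rfl⟩ := exists_planeVec_eq x
  rw [inner_planeOp, dotProduct_rot_conj]
  exact hA.posSemidef.dotProduct_mulVec_nonneg _

theorem exists_rot_conj_gap {l : ℝ} {A : Matrix (Fin 2) (Fin 2) ℝ} (h01 : A 0 1 = 0)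
    (h10 : A 1 0 = 0) {K : ℝ → Matrix (Fin 2) (Fin 2) ℝ} (cK : ContinuousOn K (Icc 0 l))
    (hK : ∀ s ∈ Icc 0 l, ∃ μ : ℝ, (∀ y : Fin 2 → ℝ, y ≠ 0 → y ⬝ᵥ (A *ᵥ y) < μ * (y ⬝ᵥ y)) ∧
      (∀ x : Fin 2 → ℝ, μ * (x ⬝ᵥ x) ≤ x ⬝ᵥ (K s *ᵥ x))) :
    ∃ g > 0, ∀ s ∈ Icc 0 l, ∀ a, ∀ x : EuclideanSpace ℝ (Fin 2),
      g * ‖x‖ ^ 2 + ⟪planeOp (Rot a * A * (Rot a)ᵀ) x, x⟫ ≤ ⟪planeOp (K s) x, x⟫ := by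
  have hsq : ∀ x : Fin 2 → ℝ, x ⬝ᵥ x = ‖planeVec x‖ ^ 2 := fun x => by
    rw [norm_sq_planeVec]
    simp [dotProduct, Fin.sum_univ_two, sq]
  set k : ℝ := max (A 0 0) (A 1 1)
  have hsub : ∀ s (x : EuclideanSpace ℝ (Fin 2)), ⟪(planeOp (K s)
      - k • (1 : EuclideanSpace ℝ (Fin 2) →L[ℝ] EuclideanSpace ℝ (Fin 2))) x, x⟫
        = ⟪planeOp (K s) x, x⟫ - k * ‖x‖ ^ 2 := fun s x => by
    change ⟪planeOp (K s) x - k • x, x⟫ = _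
    rw [inner_sub_left, real_inner_smul_left, real_inner_self_eq_norm_sq]
  obtain ⟨g, hg, hle⟩ := exists_uniform_coercive
    (K := fun s => planeOp (K s)
      - k • (1 : EuclideanSpace ℝ (Fin 2) →L[ℝ] EuclideanSpace ℝ (Fin 2)))
    ((planeOp.continuous.comp_continuousOn cK).sub continuousOn_const) (l := l) (by
      intro s hs x hx
      obtain ⟨μ, h1, h2⟩ := hK s hs
      obtain ⟨x, rfl⟩ := exists_planeVec_eq x
      have e0 := h1 ![1, 0] (by simp)
      have e1 := h1 ![0, 1] (by simp)
      simp [dotProduct, mulVec, Fin.sum_univ_two] at e0 e1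
      have hkμ : k < μ := max_lt e0 e1
      have h3 := h2 x
      rw [hsq, ← inner_planeOp] at h3
      have hn : 0 < ‖planeVec x‖ ^ 2 := by
        have := norm_pos_iff.2 hx
        positivity
      rw [hsub]
      nlinarith)
  refine ⟨g, hg, fun s hs a x => ?_⟩
  have h5 := hle s hs x
  obtain ⟨x, rfl⟩ := exists_planeVec_eq x
  have h6 : ⟪planeOp (Rot a * A * (Rot a)ᵀ) (planeVec x), planeVec x⟫ ≤ k * ‖planeVec x‖ ^ 2 := by
    rw [inner_planeOp, dotProduct_rot_conj, norm_sq_planeVec, ← rot_transpose_mulVec_sq a x]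
    generalize (Rot a)ᵀ *ᵥ x = y
    simp only [dotProduct, mulVec, Fin.sum_univ_two, h01, h10]
    have k0 : A 0 0 ≤ k := le_max_left _ _
    have k1 : A 1 1 ≤ k := le_max_right _ _
    nlinarith [mul_le_mul_of_nonneg_right k0 (sq_nonneg (y 0)),
      mul_le_mul_of_nonneg_right k1 (sq_nonneg (y 1))]
  rw [hsub] at h5
  linarith

theorem le_inner_planeOp {A : Matrix (Fin 2) (Fin 2) ℝ} {k : ℝ}
    (hA : (A - k • (1 : Matrix (Fin 2) (Fin 2) ℝ)).PosSemidef) (x : EuclideanSpace ℝ (Fin 2)) :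
    k * ‖x‖ ^ 2 ≤ ⟪planeOp A x, x⟫ := by
  have h := inner_planeOp_nonneg hA x
  rw [map_sub, map_smul, planeOp_one] at h
  change 0 ≤ ⟪planeOp A x - k • x, x⟫ at h
  rw [inner_sub_left, real_inner_smul_left, real_inner_self_eq_norm_sq] at h
  linarith

theorem norm_planeOp_le_of_posSemidef {A : Matrix (Fin 2) (Fin 2) ℝ} {k k' : ℝ} (hk : 0 ≤ k)
    (hA : (A - k • (1 : Matrix (Fin 2) (Fin 2) ℝ)).PosSemidef)
    (hA' : (k' • (1 : Matrix (Fin 2) (Fin 2) ℝ) - A).PosSemidef) (hs : A.IsSymm) :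
    ‖planeOp A‖ ≤ ∑ i, ∑ j, k' * ‖planeOp (Matrix.single i j 1)‖ := by
  have h : A.PosSemidef := by
    simpa using hA.add (Matrix.PosSemidef.one.smul hk)
  exact norm_planeOp_le (abs_entry_le_of_posSemidef h hA' hs)

end Gains

end ClosedLoopDecay

set_option maxHeartbeats 1000000 in
/-- Theorem 1 of the paper: exponential stability of task-space
position tracking for the planar Cosserat-rod model
`p_tt = (R K₃ Rᵀ p_s − R K₃ q̄)_s + g e₃`,
`θ_tt = K₄ θ_ss − (1/(ρJ))(m_c)_s + p̂_sᵀ (R K₅ (Rᵀ p_s − q̄))`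
under the inner-outer loop control (outer and inner matching equations). -/
theorem stmt_0 (ℓ ρ J K₄ K₅ g : ℝ)
    (hℓ : 0 < ℓ) (hρ : 0 < ρ) (hJ : 0 < J) (hK₄ : 0 < K₄) (hK₅ : 0 < K₅)
    (K₃ : Matrix (Fin 2) (Fin 2) ℝ)
    (hK₃diag : K₃ 0 1 = 0 ∧ K₃ 1 0 = 0) (hK₃pd : K₃.PosDef)
    -- undeformed strain q̄ ∈ C¹([0,ℓ])
    (qbar qbar' : ℝ → Fin 2 → ℝ)
    (hqbar : ∀ s ∈ Set.Icc (0:ℝ) ℓ, HasDerivWithinAt qbar (qbar' s) (Set.Icc 0 ℓ) s)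
    (hqbar'c : ContinuousOn qbar' (Set.Icc 0 ℓ))
    -- the state (p, θ), the input m_c, and their partial derivatives
    (p ps pt pst ptt : ℝ → ℝ → Fin 2 → ℝ)
    (θ θs θt θst θss θtt θstt θttt : ℝ → ℝ → ℝ)
    (mc mc' : ℝ → ℝ → ℝ)
    (hps : ∀ t ∈ Set.Ici (0:ℝ), ∀ s ∈ Set.Icc (0:ℝ) ℓ,
      HasDerivWithinAt (fun x => p x t) (ps s t) (Set.Icc 0 ℓ) s)
    (hpt : ∀ t ∈ Set.Ici (0:ℝ), ∀ s ∈ Set.Icc (0:ℝ) ℓ,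
      HasDerivWithinAt (fun τ => p s τ) (pt s t) (Set.Ici 0) t)
    (hpst : ∀ t ∈ Set.Ici (0:ℝ), ∀ s ∈ Set.Icc (0:ℝ) ℓ,
      HasDerivWithinAt (fun τ => ps s τ) (pst s t) (Set.Ici 0) t)
    (hpts : ∀ t ∈ Set.Ici (0:ℝ), ∀ s ∈ Set.Icc (0:ℝ) ℓ,
      HasDerivWithinAt (fun x => pt x t) (pst s t) (Set.Icc 0 ℓ) s)
    (hptt : ∀ t ∈ Set.Ici (0:ℝ), ∀ s ∈ Set.Icc (0:ℝ) ℓ,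
      HasDerivWithinAt (fun τ => pt s τ) (ptt s t) (Set.Ici 0) t)
    (hθs : ∀ t ∈ Set.Ici (0:ℝ), ∀ s ∈ Set.Icc (0:ℝ) ℓ,
      HasDerivWithinAt (fun x => θ x t) (θs s t) (Set.Icc 0 ℓ) s)
    (hθt : ∀ t ∈ Set.Ici (0:ℝ), ∀ s ∈ Set.Icc (0:ℝ) ℓ,
      HasDerivWithinAt (fun τ => θ s τ) (θt s t) (Set.Ici 0) t)
    (hθst : ∀ t ∈ Set.Ici (0:ℝ), ∀ s ∈ Set.Icc (0:ℝ) ℓ,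
      HasDerivWithinAt (fun τ => θs s τ) (θst s t) (Set.Ici 0) t)
    (hθts : ∀ t ∈ Set.Ici (0:ℝ), ∀ s ∈ Set.Icc (0:ℝ) ℓ,
      HasDerivWithinAt (fun x => θt x t) (θst s t) (Set.Icc 0 ℓ) s)
    (hθss : ∀ t ∈ Set.Ici (0:ℝ), ∀ s ∈ Set.Icc (0:ℝ) ℓ,
      HasDerivWithinAt (fun x => θs x t) (θss s t) (Set.Icc 0 ℓ) s)
    (hθtt : ∀ t ∈ Set.Ici (0:ℝ), ∀ s ∈ Set.Icc (0:ℝ) ℓ,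
      HasDerivWithinAt (fun τ => θt s τ) (θtt s t) (Set.Ici 0) t)
    -- third-order regularity of the rotational motion (C³ classical solutions)
    (hθstt : ∀ t ∈ Set.Ici (0:ℝ), ∀ s ∈ Set.Icc (0:ℝ) ℓ,
      HasDerivWithinAt (fun τ => θst s τ) (θstt s t) (Set.Ici 0) t)
    (hθtts : ∀ t ∈ Set.Ici (0:ℝ), ∀ s ∈ Set.Icc (0:ℝ) ℓ,
      HasDerivWithinAt (fun x => θtt x t) (θstt s t) (Set.Icc 0 ℓ) s)
    (hθttt : ∀ t ∈ Set.Ici (0:ℝ), ∀ s ∈ Set.Icc (0:ℝ) ℓ,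
      HasDerivWithinAt (fun τ => θtt s τ) (θttt s t) (Set.Ici 0) t)
    (hmc' : ∀ t ∈ Set.Ici (0:ℝ), ∀ s ∈ Set.Icc (0:ℝ) ℓ,
      HasDerivWithinAt (fun x => mc x t) (mc' s t) (Set.Icc 0 ℓ) s)
    -- continuity of the state and its derivatives on [0,ℓ]×[0,∞)
    (hcont₁ : ContinuousOn
      (fun z : ℝ × ℝ => (p z.1 z.2, ps z.1 z.2, pt z.1 z.2, pst z.1 z.2, ptt z.1 z.2))
      (Set.Icc 0 ℓ ×ˢ Set.Ici 0))
    (hcont₂ : ContinuousOn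
      (fun z : ℝ × ℝ => (θ z.1 z.2, θs z.1 z.2, θt z.1 z.2, θst z.1 z.2, θss z.1 z.2,
        θtt z.1 z.2, θstt z.1 z.2, θttt z.1 z.2, mc z.1 z.2, mc' z.1 z.2))
      (Set.Icc 0 ℓ ×ˢ Set.Ici 0))
    -- the translational equation: p_tt = (R K₃ Rᵀ p_s − R K₃ q̄)_s + g e₃
    (D1 : ℝ → ℝ → Fin 2 → ℝ)
    (hD1 : ∀ t ∈ Set.Ici (0:ℝ), ∀ s ∈ Set.Icc (0:ℝ) ℓ,
      HasDerivWithinAt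
        (fun x => (Rot (θ x t) * K₃ * (Rot (θ x t))ᵀ) *ᵥ ps x t
          - (Rot (θ x t) * K₃) *ᵥ qbar x)
        (D1 s t) (Set.Icc 0 ℓ) s)
    (hpdeP : ∀ t ∈ Set.Ici (0:ℝ), ∀ s ∈ Set.Icc (0:ℝ) ℓ,
      ptt s t = D1 s t + g • (![0, 1] : Fin 2 → ℝ))
    -- the rotational equation: θ_tt = K₄θ_ss − (1/(ρJ))(m_c)_s + p̂_sᵀ(R K₅(Rᵀp_s − q̄))
    (hpdeθ : ∀ t ∈ Set.Ici (0:ℝ), ∀ s ∈ Set.Icc (0:ℝ) ℓ,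
      θtt s t = K₄ * θss s t - (1 / (ρ * J)) * mc' s t
        + rot90 (ps s t) ⬝ᵥ (K₅ • (Rot (θ s t) *ᵥ ((Rot (θ s t))ᵀ *ᵥ ps s t - qbar s))))
    -- boundary conditions of the plant
    (hbcp0 : ∀ t ∈ Set.Ici (0:ℝ), p 0 t = 0)
    (hbcθ0 : ∀ t ∈ Set.Ici (0:ℝ), θ 0 t = 0)
    (hbcpl : ∀ t ∈ Set.Ici (0:ℝ), (Rot (θ ℓ t))ᵀ *ᵥ ps ℓ t = qbar ℓ)
    (hbcml : ∀ t ∈ Set.Ici (0:ℝ), mc ℓ t = (ρ * J * K₄) * θs ℓ t)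
    -- desired trajectory p* (C³, suitable boundary conditions, bounded derivatives)
    (pstar pstars pstarss pstart pstartt : ℝ → ℝ → Fin 2 → ℝ)
    (hpstars : ∀ t ∈ Set.Ici (0:ℝ), ∀ s ∈ Set.Icc (0:ℝ) ℓ,
      HasDerivWithinAt (fun x => pstar x t) (pstars s t) (Set.Icc 0 ℓ) s)
    (hpstarss : ∀ t ∈ Set.Ici (0:ℝ), ∀ s ∈ Set.Icc (0:ℝ) ℓ,
      HasDerivWithinAt (fun x => pstars x t) (pstarss s t) (Set.Icc 0 ℓ) s)
    (hpstart : ∀ t ∈ Set.Ici (0:ℝ), ∀ s ∈ Set.Icc (0:ℝ) ℓ,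
      HasDerivWithinAt (fun τ => pstar s τ) (pstart s t) (Set.Ici 0) t)
    (hpstartt : ∀ t ∈ Set.Ici (0:ℝ), ∀ s ∈ Set.Icc (0:ℝ) ℓ,
      HasDerivWithinAt (fun τ => pstart s τ) (pstartt s t) (Set.Ici 0) t)
    (hcont₃ : ContinuousOn
      (fun z : ℝ × ℝ => (pstar z.1 z.2, pstars z.1 z.2, pstarss z.1 z.2,
        pstart z.1 z.2, pstartt z.1 z.2))
      (Set.Icc 0 ℓ ×ˢ Set.Ici 0))
    (hbcstar0 : ∀ t ∈ Set.Ici (0:ℝ), pstar 0 t = 0)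
    (hbcstarl : ∀ t ∈ Set.Ici (0:ℝ), pstars ℓ t = ps ℓ t)
    (hpstarbdd : ∃ B : ℝ, ∀ t ∈ Set.Ici (0:ℝ), ∀ s ∈ Set.Icc (0:ℝ) ℓ,
      ‖pstars s t‖ ≤ B ∧ ‖pstarss s t‖ ≤ B)
    -- the desired rotation θ* (with bounded θ*_s and trackability boundary conditions)
    (θstar θstars θstart θstartt : ℝ → ℝ → ℝ)
    (hθstars : ∀ t ∈ Set.Ici (0:ℝ), ∀ s ∈ Set.Icc (0:ℝ) ℓ,
      HasDerivWithinAt (fun x => θstar x t) (θstars s t) (Set.Icc 0 ℓ) s)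
    (hθstart : ∀ t ∈ Set.Ici (0:ℝ), ∀ s ∈ Set.Icc (0:ℝ) ℓ,
      HasDerivWithinAt (fun τ => θstar s τ) (θstart s t) (Set.Ici 0) t)
    (hθstartt : ∀ t ∈ Set.Ici (0:ℝ), ∀ s ∈ Set.Icc (0:ℝ) ℓ,
      HasDerivWithinAt (fun τ => θstart s τ) (θstartt s t) (Set.Ici 0) t)
    (hcont₄ : ContinuousOn
      (fun z : ℝ × ℝ => (θstar z.1 z.2, θstars z.1 z.2, θstart z.1 z.2, θstartt z.1 z.2))
      (Set.Icc 0 ℓ ×ˢ Set.Ici 0))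
    (hbcθstar0 : ∀ t ∈ Set.Ici (0:ℝ), θstar 0 t = 0)
    (hbcθstarl : ∀ t ∈ Set.Ici (0:ℝ), θstars ℓ t = θs ℓ t)
    (hθstarbdd : ∃ B : ℝ, ∀ t ∈ Set.Ici (0:ℝ), ∀ s ∈ Set.Icc (0:ℝ) ℓ, |θstars s t| ≤ B)
    -- gains K_q ∈ C¹, K_p ∈ C⁰ symmetric positive definite, K_v continuous with κI ⪯ K_v ⪯ κ'I
    (Kq Kq' Kp : ℝ → Matrix (Fin 2) (Fin 2) ℝ)
    (Kv : ℝ → ℝ → Matrix (Fin 2) (Fin 2) ℝ) (κ κ' : ℝ) (hκ : 0 < κ) (hκκ' : κ ≤ κ')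
    (hKq' : ∀ s ∈ Set.Icc (0:ℝ) ℓ, ∀ i j,
      HasDerivWithinAt (fun x => Kq x i j) (Kq' s i j) (Set.Icc 0 ℓ) s)
    (hKq'c : ContinuousOn Kq' (Set.Icc 0 ℓ))
    (hKqsym : ∀ s ∈ Set.Icc (0:ℝ) ℓ, (Kq s).IsSymm)
    (hKqpd : ∀ s ∈ Set.Icc (0:ℝ) ℓ, (Kq s).PosDef)
    (hKpc : ContinuousOn Kp (Set.Icc 0 ℓ))
    (hKpsym : ∀ s ∈ Set.Icc (0:ℝ) ℓ, (Kp s).IsSymm)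
    (hKppd : ∀ s ∈ Set.Icc (0:ℝ) ℓ, (Kp s).PosDef)
    (hKvc : ContinuousOn (fun z : ℝ × ℝ => Kv z.1 z.2) (Set.Icc 0 ℓ ×ˢ Set.Ici 0))
    (hKvsym : ∀ s ∈ Set.Icc (0:ℝ) ℓ, ∀ t ∈ Set.Ici (0:ℝ), (Kv s t).IsSymm)
    (hKvlb : ∀ s ∈ Set.Icc (0:ℝ) ℓ, ∀ t ∈ Set.Ici (0:ℝ),
      (Kv s t - κ • (1 : Matrix (Fin 2) (Fin 2) ℝ)).PosSemidef)
    (hKvub : ∀ s ∈ Set.Icc (0:ℝ) ℓ, ∀ t ∈ Set.Ici (0:ℝ),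
      (κ' • (1 : Matrix (Fin 2) (Fin 2) ℝ) - Kv s t).PosSemidef)
    -- the outer-loop matching equation:
    -- (R*K₃R*ᵀp_s − R*K₃q̄)_s + ge₃ − p*_tt = (K_q p̃_s)_s − K_v p̃_t − K_p p̃
    (D1star Dq : ℝ → ℝ → Fin 2 → ℝ)
    (hD1star : ∀ t ∈ Set.Ici (0:ℝ), ∀ s ∈ Set.Icc (0:ℝ) ℓ,
      HasDerivWithinAt
        (fun x => (Rot (θstar x t) * K₃ * (Rot (θstar x t))ᵀ) *ᵥ ps x t
          - (Rot (θstar x t) * K₃) *ᵥ qbar x)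
        (D1star s t) (Set.Icc 0 ℓ) s)
    (hDq : ∀ t ∈ Set.Ici (0:ℝ), ∀ s ∈ Set.Icc (0:ℝ) ℓ,
      HasDerivWithinAt (fun x => Kq x *ᵥ (ps x t - pstars x t)) (Dq s t) (Set.Icc 0 ℓ) s)
    (houter : ∀ t ∈ Set.Ici (0:ℝ), ∀ s ∈ Set.Icc (0:ℝ) ℓ,
      D1star s t + g • (![0, 1] : Fin 2 → ℝ) - pstartt s t
        = Dq s t - Kv s t *ᵥ (pt s t - pstart s t) - Kp s *ᵥ (p s t - pstar s t))
    -- inner-loop gains k_u ∈ C¹, k_w, k_θ ∈ C⁰ strictly positive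
    (ku ku' kw kθ : ℝ → ℝ)
    (hku : ∀ s ∈ Set.Icc (0:ℝ) ℓ, HasDerivWithinAt ku (ku' s) (Set.Icc 0 ℓ) s)
    (hku'c : ContinuousOn ku' (Set.Icc 0 ℓ))
    (hkwc : ContinuousOn kw (Set.Icc 0 ℓ))
    (hkθc : ContinuousOn kθ (Set.Icc 0 ℓ))
    (hkupos : ∀ s ∈ Set.Icc (0:ℝ) ℓ, 0 < ku s)
    (hkwpos : ∀ s ∈ Set.Icc (0:ℝ) ℓ, 0 < kw s)
    (hkθpos : ∀ s ∈ Set.Icc (0:ℝ) ℓ, 0 < kθ s)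
    -- the inner-loop matching equation:
    -- K₄θ_ss − (1/(ρJ))(m_c)_s + p̂_sᵀ(RK₅(Rᵀp_s − q̄)) − θ*_tt = (k_uθ̃_s)_s − k_wθ̃_t − k_θθ̃
    (E : ℝ → ℝ → ℝ)
    (hE : ∀ t ∈ Set.Ici (0:ℝ), ∀ s ∈ Set.Icc (0:ℝ) ℓ,
      HasDerivWithinAt (fun x => ku x * (θs x t - θstars x t)) (E s t) (Set.Icc 0 ℓ) s)
    (hinner : ∀ t ∈ Set.Ici (0:ℝ), ∀ s ∈ Set.Icc (0:ℝ) ℓ,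
      K₄ * θss s t - (1 / (ρ * J)) * mc' s t
        + rot90 (ps s t) ⬝ᵥ (K₅ • (Rot (θ s t) *ᵥ ((Rot (θ s t))ᵀ *ᵥ ps s t - qbar s)))
        - θstartt s t
        = E s t - kw s * (θt s t - θstart s t) - kθ s * (θ s t - θstar s t))
    -- the smallest eigenvalue of K_q(s) exceeds the largest eigenvalue of K₃ for every s
    (heig : ∀ s ∈ Set.Icc (0:ℝ) ℓ, ∃ μ : ℝ,
      (∀ y : Fin 2 → ℝ, y ≠ 0 → y ⬝ᵥ (K₃ *ᵥ y) < μ * (y ⬝ᵥ y)) ∧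
      (∀ x : Fin 2 → ℝ, μ * (x ⬝ᵥ x) ≤ x ⬝ᵥ (Kq s *ᵥ x))) :
    ∃ C > (0:ℝ), ∃ lam > (0:ℝ), ∀ t ∈ Set.Ici (0:ℝ),
      LinfNorm ℓ (fun s => θ s t - θstar s t)
        + LinfNorm ℓ (fun s => θt s t - θstart s t)
        + L2norm ℓ (fun s => θs s t - θstars s t)
        + L2vnorm ℓ (fun s => p s t - pstar s t)
        + L2vnorm ℓ (fun s => pt s t - pstart s t)
        + L2vnorm ℓ (fun s => ps s t - pstars s t)
        ≤ C * Real.exp (-lam * t) := by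
  have dplane : ∀ {f : ℝ → Fin 2 → ℝ} {f' : Fin 2 → ℝ} {D : Set ℝ} {s : ℝ},
      HasDerivWithinAt f f' D s → HasDerivWithinAt (fun x => planeVec (f x)) (planeVec f') D s :=
    hasDerivWithinAt_planeVec
  have cplane : ∀ {f : ℝ × ℝ → Fin 2 → ℝ}, ContinuousOn f (Set.Icc 0 ℓ ×ˢ Set.Ici 0) →
      ContinuousOn (fun z => planeVec (f z)) (Set.Icc 0 ℓ ×ˢ Set.Ici 0) := fun h =>
    planeVec.continuous.comp_continuousOn h
  -- rotational tracking error
  obtain ⟨Cθ, hCθ, μ, hμ, hθdec⟩ := exists_exp_decay_string hℓ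
    (w := fun s t => θ s t - θstar s t) (ws := fun s t => θs s t - θstars s t)
    (wt := fun s t => θt s t - θstart s t) (wtt := fun s t => θtt s t - θstartt s t) (A := E)
    (fun s hs => (hku s hs).continuousWithinAt) hkwc hkθc hkupos hkwpos hkθpos
    (hcont₂.fst.sub hcont₄.fst) (hcont₂.snd.fst.sub hcont₄.snd.fst)
    (hcont₂.snd.snd.fst.sub hcont₄.snd.snd.fst)
    (hcont₂.snd.snd.snd.snd.snd.fst.sub hcont₄.snd.snd.snd)
    (fun t ht s hs => (hθt t ht s hs).sub (hθstart t ht s hs))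
    (fun t ht s hs => (hθtt t ht s hs).sub (hθstartt t ht s hs))
    (fun t ht s hs => (hθs t ht s hs).sub (hθstars t ht s hs)) hE
    (fun t ht => by rw [hbcθ0 t ht, hbcθstar0 t ht, sub_zero])
    (fun t ht => by rw [hbcθstarl t ht, sub_self])
    (fun t ht s hs => by rw [hpdeθ t ht s hs, hinner t ht s hs])
  -- translational tracking error
  obtain ⟨bS, S1, hS⟩ := exists_lipschitzCurve_rot_conj hK₃diag.1 hK₃diag.2
  obtain ⟨bT, T1, hT⟩ := exists_lipschitzCurve_rot_mul K₃
  obtain ⟨Bp, hBp⟩ := hpstarbdd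
  obtain ⟨Bθ, hBθ⟩ := hθstarbdd
  have dKq : ∀ s ∈ Set.Icc (0:ℝ) ℓ,
      HasDerivWithinAt (fun x => planeOp (Kq x)) (planeOp (Kq' s)) (Set.Icc 0 ℓ) s :=
    fun s hs => hasDerivWithinAt_planeOp (hKq' s hs)
  have cKq : ContinuousOn Kq (Set.Icc 0 ℓ) :=
    continuousOn_pi.2 fun i => continuousOn_pi.2 fun j s hs => (hKq' s hs i j).continuousWithinAt
  obtain ⟨g0, hg0, hgap⟩ := exists_rot_conj_gap hK₃diag.1 hK₃diag.2 cKq heig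
  have hsum : ∀ s t, planeVec (ps s t - pstars s t) + planeVec (pstars s t) = planeVec (ps s t) :=
    fun s t => by rw [← map_add, sub_add_cancel]
  have dstress : ∀ {α : ℝ → ℝ → ℝ} {D : ℝ → ℝ → Fin 2 → ℝ} {t s : ℝ},
      HasDerivWithinAt (fun x => (Rot (α x t) * K₃ * (Rot (α x t))ᵀ) *ᵥ ps x t
        - (Rot (α x t) * K₃) *ᵥ qbar x) (D s t) (Set.Icc 0 ℓ) s →
      HasDerivWithinAt (fun x => planeOp (Rot (α x t) * K₃ * (Rot (α x t))ᵀ)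
        (planeVec (ps x t - pstars x t) + planeVec (pstars x t))
        - planeOp (Rot (α x t) * K₃) (planeVec (qbar x))) (planeVec (D s t)) (Set.Icc 0 ℓ) s := by
    intro α D t s h
    simp only [hsum, planeOp_planeVec, ← map_sub]
    exact dplane h
  have htrack : TrackSystem ℓ (fun s => planeOp (Kq s)) (fun s => planeOp (Kq' s))
      (fun s => planeOp (Kp s)) (fun s t => planeOp (Kv s t))
      (fun x => planeOp (Rot x * K₃ * (Rot x)ᵀ)) S1 (fun x => planeOp (Rot x * K₃)) T1
      (fun s => planeVec (qbar s)) (fun s => planeVec (qbar' s))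
      (planeVec (g • (![0, 1] : Fin 2 → ℝ))) θ θs θstar θstars
      (fun s t => planeVec (p s t - pstar s t)) (fun s t => planeVec (ps s t - pstars s t))
      (fun s t => planeVec (pt s t - pstart s t)) (fun s t => planeVec (ptt s t - pstartt s t))
      (fun s t => planeVec (pstar s t)) (fun s t => planeVec (pstars s t))
      (fun s t => planeVec (pstarss s t)) (fun s t => planeVec (pstart s t))
      (fun s t => planeVec (pstartt s t)) (fun s t => planeVec (D1 s t))
      (fun s t => planeVec (D1star s t)) (fun s t => planeVec (Dq s t))
      (max bS bT) (max Bθ (2 * Bp)) g0 κ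
      (∑ i, ∑ j, κ' * ‖planeOp (Matrix.single i j 1)‖) μ Cθ :=
    { l_pos := hℓ
      dK := dKq
      cK' := planeOp.continuous.comp_continuousOn hKq'c
      uK := fun s hs => isUnit_planeOp (hKqpd s hs)
      symmK := fun s hs => inner_planeOp_comm (hKqsym s hs)
      cKp := planeOp.continuous.comp_continuousOn hKpc
      symmKp := fun s hs => inner_planeOp_comm (hKpsym s hs)
      lowKp := fun s hs => inner_planeOp_nonneg (hKppd s hs).posSemidef
      d0_pos := hκ
      cKv := planeOp.continuous.comp_continuousOn hKvc
      lowKv := fun s hs t ht => le_inner_planeOp (hKvlb s hs t ht)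
      upKv := fun s hs t ht => norm_planeOp_le_of_posSemidef hκ.le (hKvlb s hs t ht)
        (hKvub s hs t ht) (hKvsym s hs t ht)
      curveS := hS.mono (le_max_left _ _)
      curveT := hT.mono (le_max_right _ _)
      nonnegS := inner_planeOp_rot_conj_nonneg hK₃pd
      g0_pos := hg0
      gap := hgap
      dq := fun s hs => dplane (hqbar s hs)
      cq' := planeVec.continuous.comp_continuousOn hqbar'c
      cθ := hcont₂.fst
      cθs := hcont₂.snd.fst
      cψ := hcont₄.fst
      cψs := hcont₄.snd.fst
      dθ := hθs
      dψ := hθstars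
      ψs_le := fun t ht s hs => (hBθ t ht s hs).trans (le_max_left _ _)
      μ_pos := hμ
      θ_sub_le := fun t ht s hs => (hθdec t ht s hs).1
      θs_sub_le := fun t ht s hs => (hθdec t ht s hs).2.2
      cu := cplane (hcont₁.fst.sub hcont₃.fst)
      cus := cplane (hcont₁.snd.fst.sub hcont₃.snd.fst)
      cut := cplane (hcont₁.snd.snd.fst.sub hcont₃.snd.snd.snd.fst)
      cutt := cplane (hcont₁.snd.snd.snd.snd.sub hcont₃.snd.snd.snd.snd)
      cv := cplane hcont₃.fst
      cvs := cplane hcont₃.snd.fst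
      cvss := cplane hcont₃.snd.snd.fst
      cvt := cplane hcont₃.snd.snd.snd.fst
      cvtt := cplane hcont₃.snd.snd.snd.snd
      du := fun t ht s hs => dplane ((hpt t ht s hs).sub (hpstart t ht s hs))
      dut := fun t ht s hs => dplane ((hptt t ht s hs).sub (hpstartt t ht s hs))
      dus := fun t ht s hs => dplane ((hps t ht s hs).sub (hpstars t ht s hs))
      dv := fun t ht s hs => dplane (hpstart t ht s hs)
      dvt := fun t ht s hs => dplane (hpstartt t ht s hs)
      dvs := fun t ht s hs => dplane (hpstars t ht s hs)
      dvss := fun t ht s hs => dplane (hpstarss t ht s hs)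
      vs_le := fun t ht s hs => (norm_planeVec_le (hBp t ht s hs).1).trans (le_max_right _ _)
      vss_le := fun t ht s hs => (norm_planeVec_le (hBp t ht s hs).2).trans (le_max_right _ _)
      u_left := fun t ht => by
        change planeVec (p 0 t - pstar 0 t) = 0
        rw [hbcp0 t ht, hbcstar0 t ht, sub_zero, map_zero]
      u_right := fun t ht => by
        change planeVec (ps ℓ t - pstars ℓ t) = 0
        rw [hbcstarl t ht, sub_self, map_zero]
      v_left := fun t ht => by
        change planeVec (pstar 0 t) = 0
        rw [hbcstar0 t ht, map_zero]
      dD := fun t ht s hs => dstress (hD1 t ht s hs)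
      dDψ := fun t ht s hs => dstress (hD1star t ht s hs)
      dDq := fun t ht s hs => dplane (hDq t ht s hs)
      plant := fun t ht s hs => by
        change planeVec (ptt s t - pstartt s t) + planeVec (pstartt s t)
          = planeVec (D1 s t) + planeVec (g • (![0, 1] : Fin 2 → ℝ))
        rw [← map_add, ← map_add, sub_add_cancel, hpdeP t ht s hs]
      outer := fun t ht s hs => by
        change planeVec (D1star s t) + planeVec (g • (![0, 1] : Fin 2 → ℝ))
          - planeVec (pstartt s t) = planeVec (Dq s t)
          - planeVec (Kv s t *ᵥ (pt s t - pstart s t)) - planeVec (Kp s *ᵥ (p s t - pstar s t))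
        rw [← map_add, ← map_sub, ← map_sub, ← map_sub, houter t ht s hs] }
  obtain ⟨Cp, hCp, ν, hν, hpdec⟩ := htrack.exists_exp_decay
  -- assembling the norms
  refine ⟨(2 + √ℓ) * Cθ + 3 * √Cp, by positivity, min μ (ν / 2), by positivity, fun t ht => ?_⟩
  have ht0 : (0:ℝ) ≤ t := ht
  have cslice : ∀ {F : Type} [TopologicalSpace F] {f : ℝ → ℝ → F},
      ContinuousOn (fun z : ℝ × ℝ => f z.1 z.2) (Set.Icc 0 ℓ ×ˢ Set.Ici 0) →
      ContinuousOn (fun s => f s t) (Set.Icc 0 ℓ) := fun h =>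
    h.comp (continuous_id.prodMk continuous_const).continuousOn fun s hs => ⟨hs, ht⟩
  have hMθ : 0 ≤ Cθ * Real.exp (-μ * t) := by positivity
  have e1 : Real.exp (-μ * t) ≤ Real.exp (-min μ (ν / 2) * t) := by
    gcongr
    exact min_le_left _ _
  have e2 : √(Cp * Real.exp (-ν * t)) ≤ √Cp * Real.exp (-min μ (ν / 2) * t) := by
    rw [sqrt_mul_exp hCp.le]
    gcongr
    nlinarith [mul_le_mul_of_nonneg_right (min_le_right μ (ν / 2)) ht0]
  have cu := cslice (f := fun s t => planeVec (p s t - pstar s t)) htrack.cu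
  have cus := cslice (f := fun s t => planeVec (ps s t - pstars s t)) htrack.cus
  have cut := cslice (f := fun s t => planeVec (pt s t - pstart s t)) htrack.cut
  have cG : ContinuousOn (fun s => ‖planeVec (p s t - pstar s t)‖ ^ 2
      + ‖planeVec (ps s t - pstars s t)‖ ^ 2 + ‖planeVec (pt s t - pstart s t)‖ ^ 2)
      (Set.Icc 0 ℓ) :=
    ((cu.norm.pow 2).add (cus.norm.pow 2)).add (cut.norm.pow 2)
  have n1 := linfNorm_le hMθ fun s hs => (hθdec t ht s hs).1
  have n2 := linfNorm_le hMθ fun s hs => (hθdec t ht s hs).2.1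
  have n3 := l2norm_le hℓ.le hMθ fun s hs => (hθdec t ht s hs).2.2
  have n4 := l2vnorm_le hℓ.le (cslice (f := fun s t => p s t - pstar s t)
    (hcont₁.fst.sub hcont₃.fst)) cG
    (fun s _ => by
      nlinarith [sq_nonneg ‖planeVec (ps s t - pstars s t)‖,
        sq_nonneg ‖planeVec (pt s t - pstart s t)‖]) (hpdec t ht)
  have n5 := l2vnorm_le hℓ.le (cslice (f := fun s t => pt s t - pstart s t)
    (hcont₁.snd.snd.fst.sub hcont₃.snd.snd.snd.fst)) cG
    (fun s _ => by
      nlinarith [sq_nonneg ‖planeVec (ps s t - pstars s t)‖,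
        sq_nonneg ‖planeVec (p s t - pstar s t)‖]) (hpdec t ht)
  have n6 := l2vnorm_le hℓ.le (cslice (f := fun s t => ps s t - pstars s t)
    (hcont₁.snd.fst.sub hcont₃.snd.fst)) cG
    (fun s _ => by
      nlinarith [sq_nonneg ‖planeVec (pt s t - pstart s t)‖,
        sq_nonneg ‖planeVec (p s t - pstar s t)‖]) (hpdec t ht)
  have m1 : Cθ * Real.exp (-μ * t) ≤ Cθ * Real.exp (-min μ (ν / 2) * t) := by gcongr
  have m3 : √ℓ * (Cθ * Real.exp (-μ * t)) ≤ √ℓ * (Cθ * Real.exp (-min μ (ν / 2) * t)) := by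
    gcongr
  linarith
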